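/- There exists a universal R₀ > 0 such that the following holds. Let K ≥ 0, let V be C¹ on B_1 ∩ {z ≠ 0} with |V| + |FV| ≤ K ψ there, and let u be a C² function on B_1 with |u| ≤ 1 solving 𝓛u + Vu = 0 pointwise in B_1, with ∫_{B_{R₀/4}} u² ψ > 0. Then there exist constants C₁, C₂ > 0, depending only on universal quantities and on ∫_{B_{R₀/4}} u² ψ, such that for all 0 < r ≤ R₀ one has sup_{B_r} |u| ≥ C₁ (r/R₀)^{C₂ (K^{1/2}+1)}. -/

import Mathlib

open MeasureTheory Real Set Filter Asymptotics

noncomputable section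

/-- The underlying space ℝ^m × ℝ^k. -/
abbrev E (m k : ℕ) : Type :=
  EuclideanSpace ℝ (Fin m) × EuclideanSpace ℝ (Fin k)

namespace BG

variable {m k : ℕ}

/-- The Baouendi–Grushin gauge ρ. -/
def rho (γ : ℝ) (p : E m k) : ℝ :=
  (‖p.1‖ ^ (2 * (γ + 1)) + (γ + 1) ^ 2 * ‖p.2‖ ^ 2) ^ (1 / (2 * (γ + 1)))

/-- The angle function ψ = |z|^{2γ}/ρ^{2γ}. -/
def psi (γ : ℝ) (p : E m k) : ℝ :=
  ‖p.1‖ ^ (2 * γ) / rho γ p ^ (2 * γ)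

/-- The gauge ball B_r = {ρ < r}. -/
def ball (γ r : ℝ) : Set (E m k) := {p | rho γ p < r}

/-- The Baouendi–Grushin vector fields as direction fields:
X_i = ∂_{z_i} for i < m, X_{m+j} = |z|^γ ∂_{t_j}. -/
def Xvec (γ : ℝ) (p : E m k) (i : Fin (m + k)) : E m k :=
  if h : (i : ℕ) < m then (EuclideanSpace.single ⟨(i : ℕ), h⟩ 1, 0)
  else (0, EuclideanSpace.single ⟨(i : ℕ) - m, by have := i.isLt; omega⟩ (‖p.1‖ ^ γ))

/-- Derivative along the i-th Baouendi–Grushin vector field. -/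
def Xd (γ : ℝ) (i : Fin (m + k)) (f : E m k → ℝ) (p : E m k) : ℝ :=
  fderiv ℝ f p (Xvec γ p i)

/-- The quadratic form ⟨A Xu, Xu⟩. -/
def quadA (γ : ℝ) (A : E m k → Matrix (Fin (m + k)) (Fin (m + k)) ℝ)
    (u : E m k → ℝ) (p : E m k) : ℝ :=
  ∑ i, ∑ j, A p i j * Xd γ i u p * Xd γ j u p

/-- μ = ⟨A Xρ, Xρ⟩. -/
def mu (γ : ℝ) (A : E m k → Matrix (Fin (m + k)) (Fin (m + k)) ℝ) (p : E m k) : ℝ :=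
  quadA γ A (rho γ) p

/-- The operator 𝓛 u = Σ_{i,j} X_i(a_{ij} X_j u). -/
def Lop (γ : ℝ) (A : E m k → Matrix (Fin (m + k)) (Fin (m + k)) ℝ)
    (u : E m k → ℝ) (p : E m k) : ℝ :=
  ∑ i, ∑ j, Xd γ i (fun q => A q i j * Xd γ j u q) p

/-- The vector field F = (ρ/μ) Σ a_{ij} X_iρ X_j, as a first order operator. -/
def Fop (γ : ℝ) (A : E m k → Matrix (Fin (m + k)) (Fin (m + k)) ℝ)
    (v : E m k → ℝ) (p : E m k) : ℝ :=
  rho γ p / mu γ A p * ∑ i, ∑ j, A p i j * Xd γ i (rho γ) p * Xd γ j v p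

/-- The Baouendi–Grushin operator 𝓑_γ = Δ_z + |z|^{2γ} Δ_t = Σ_i X_i X_i. -/
def Bop (γ : ℝ) (u : E m k → ℝ) (p : E m k) : ℝ :=
  ∑ i : Fin (m + k), Xd γ i (Xd γ i u) p

/-- The generator of anisotropic dilations Z = Σ z_i ∂_{z_i} + (γ+1) Σ t_j ∂_{t_j},
as a first order operator: the derivative in the direction (z, (γ+1) t). -/
def Zd (γ : ℝ) (v : E m k → ℝ) (p : E m k) : ℝ :=
  fderiv ℝ v p (p.1, (γ + 1) • p.2)

/-- The Euclidean divergence of a vector field on ℝ^m × ℝ^k. -/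
def divV (V : E m k → E m k) (p : E m k) : ℝ :=
  (∑ i : Fin m, (fderiv ℝ V p (EuclideanSpace.single i 1, 0)).1 i) +
    ∑ j : Fin k,
      (fderiv ℝ V p ((0 : EuclideanSpace ℝ (Fin m)), EuclideanSpace.single j 1)).2 j

/-- Uniform ellipticity: λ|η|² ≤ ⟨Aη,η⟩ ≤ λ⁻¹|η|². -/
def Elliptic (lam : ℝ) (A : E m k → Matrix (Fin (m + k)) (Fin (m + k)) ℝ) : Prop :=
  ∀ (p : E m k) (η : Fin (m + k) → ℝ),
    lam * ∑ i, η i ^ 2 ≤ ∑ i, ∑ j, A p i j * η i * η j ∧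
      ∑ i, ∑ j, A p i j * η i * η j ≤ lam⁻¹ * ∑ i, η i ^ 2

/-- Symmetry of the matrix A. -/
def Symm (A : E m k → Matrix (Fin (m + k)) (Fin (m + k)) ℝ) : Prop :=
  ∀ p i j, A p i j = A p j i

/-- The entries of A are C¹. -/
def C1coeff (A : E m k → Matrix (Fin (m + k)) (Fin (m + k)) ℝ) : Prop :=
  ∀ i j, ContDiff ℝ 1 fun p => A p i j

/-- The structural hypothesis (H) on B = A - I, in B_1. -/
def HypH (γ Λ : ℝ) (A : E m k → Matrix (Fin (m + k)) (Fin (m + k)) ℝ) : Prop :=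
  ∀ p ∈ ball (m := m) (k := k) γ 1,
    (∀ i j : Fin (m + k),
        |(A p - 1) i j| ≤
          if (i : ℕ) < m ∧ (j : ℕ) < m then Λ * rho γ p
          else Λ * psi γ p ^ ((1 : ℝ) / 2 + 1 / (2 * γ)) * rho γ p) ∧
      ∀ l i j : Fin (m + k),
        |Xd γ l (fun q => (A q - 1) i j) p| ≤
          if (l : ℕ) < m ∧ (i : ℕ) < m ∧ (j : ℕ) < m then Λ
          else if m ≤ (l : ℕ) ∧ (m ≤ (i : ℕ) ∨ m ≤ (j : ℕ)) then
            Λ * psi γ p ^ ((1 : ℝ) + 1 / (2 * γ))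
          else Λ * psi γ p ^ ((1 : ℝ) / 2)

end BG

section
open scoped Topology
namespace BG
variable {m k : ℕ}

/-! ### Coordinates -/

/-- Standard basis vectors of ℝ^m × ℝ^k, indexed by `Fin (m + k)`. -/
def bas (i : Fin (m + k)) : E m k :=
  if h : (i : ℕ) < m then (EuclideanSpace.single ⟨(i : ℕ), h⟩ 1, 0)
  else (0, EuclideanSpace.single ⟨(i : ℕ) - m, by have := i.isLt; omega⟩ 1)

/-- Coordinate functionals. -/
def co (i : Fin (m + k)) : E m k →L[ℝ] ℝ :=
  if h : (i : ℕ) < m then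
    (EuclideanSpace.proj (⟨(i : ℕ), h⟩ : Fin m) : EuclideanSpace ℝ (Fin m) →L[ℝ] ℝ).comp
      (ContinuousLinearMap.fst ℝ _ _)
  else (EuclideanSpace.proj (⟨(i : ℕ) - m, by have := i.isLt; omega⟩ : Fin k) :
      EuclideanSpace ℝ (Fin k) →L[ℝ] ℝ).comp
      (ContinuousLinearMap.snd ℝ _ _)

lemma co_of_lt {i : Fin (m + k)} (h : (i : ℕ) < m) (p : E m k) : co i p = p.1 ⟨i, h⟩ := by
  simp [co, h]

lemma co_of_ge {i : Fin (m + k)} (h : ¬ (i : ℕ) < m) (p : E m k) :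
    co i p = p.2 ⟨(i : ℕ) - m, by have := i.isLt; omega⟩ := by
  simp [co, h]

lemma co_castAdd (i : Fin m) (p : E m k) : co (Fin.castAdd k i) p = p.1 i := by
  rw [co_of_lt (by simp)]; rfl

lemma co_natAdd (j : Fin k) (p : E m k) : co (Fin.natAdd m j) p = p.2 j := by
  rw [co_of_ge (by simp)]; simp

lemma bas_castAdd (i : Fin m) : (bas (Fin.castAdd k i) : E m k) = (EuclideanSpace.single i 1, 0) := by
  simp [bas]

lemma bas_natAdd (j : Fin k) : (bas (Fin.natAdd m j) : E m k) = (0, EuclideanSpace.single j 1) := by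
  simp [bas]

lemma sum_co (p : E m k) : ∑ i, co i p • bas i = p := by
  rw [Fin.sum_univ_add]
  simp only [co_castAdd, co_natAdd, bas_castAdd, bas_natAdd]
  apply Prod.ext
  · ext a
    simp [Prod.fst_sum, Pi.single_apply]
  · ext a
    simp [Prod.snd_sum, Pi.single_apply]

lemma co_bas (i j : Fin (m + k)) : co i (bas j : E m k) = if i = j then 1 else 0 := by
  induction i using Fin.addCases with
  | left i =>
    rw [co_castAdd]
    induction j using Fin.addCases with
    | left j => rw [bas_castAdd]; simp [Fin.ext_iff]
    | right j =>
      have : Fin.castAdd k i ≠ Fin.natAdd m j := by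
        intro h; have := congrArg Fin.val h; simp at this; omega
      rw [bas_natAdd]; simp [this]
  | right i =>
    rw [co_natAdd]
    induction j using Fin.addCases with
    | left j =>
      have : Fin.natAdd m i ≠ Fin.castAdd k j := by
        intro h; have := congrArg Fin.val h; simp at this; omega
      rw [bas_castAdd]; simp [this]
    | right j => rw [bas_natAdd]; simp [Fin.ext_iff]

/-- Partial derivative. -/
def Dc (f : E m k → ℝ) (p : E m k) (i : Fin (m + k)) : ℝ := fderiv ℝ f p (bas i)

lemma clm_eq_sum (L : E m k →L[ℝ] ℝ) (w : E m k) : L w = ∑ i, co i w * L (bas i) := by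
  conv_lhs => rw [← sum_co w]
  simp [map_sum]

lemma fderiv_eq_sum (f : E m k → ℝ) (p w : E m k) :
    fderiv ℝ f p w = ∑ i, co i w * Dc f p i := clm_eq_sum _ _

/-- Divergence. -/
def Div (W : E m k → E m k) (p : E m k) : ℝ := ∑ i, co i (fderiv ℝ W p (bas i))

lemma Div_add {W W' : E m k → E m k} {p : E m k} (h : DifferentiableAt ℝ W p)
    (h' : DifferentiableAt ℝ W' p) :
    Div (fun q => W q + W' q) p = Div W p + Div W' p := by
  simp only [Div]
  rw [fderiv_fun_add h h']
  simp [Finset.sum_add_distrib]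

lemma Div_sub {W W' : E m k → E m k} {p : E m k} (h : DifferentiableAt ℝ W p)
    (h' : DifferentiableAt ℝ W' p) :
    Div (fun q => W q - W' q) p = Div W p - Div W' p := by
  simp only [Div]
  rw [fderiv_fun_sub h h']
  simp [Finset.sum_sub_distrib]

lemma Div_smul {f : E m k → ℝ} {W : E m k → E m k} {p : E m k} (hf : DifferentiableAt ℝ f p)
    (h : DifferentiableAt ℝ W p) :
    Div (fun q => f q • W q) p = f p * Div W p + fderiv ℝ f p (W p) := by
  simp only [Div]
  rw [fderiv_fun_smul hf h, fderiv_eq_sum f p (W p), Finset.mul_sum, ← Finset.sum_add_distrib]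
  refine Finset.sum_congr rfl fun i _ => ?_
  simp [Dc]; ring

lemma co_fderiv {W : E m k → E m k} {p w : E m k} (h : DifferentiableAt ℝ W p) (i : Fin (m + k)) :
    co i (fderiv ℝ W p w) = fderiv ℝ (fun q => co i (W q)) p w := by
  have := ((co i).hasFDerivAt.comp p h.hasFDerivAt).fderiv
  have h2 : fderiv ℝ (fun q => co i (W q)) p = (co i).comp (fderiv ℝ W p) := this
  rw [h2]; rfl

lemma Div_congr {W W' : E m k → E m k} {p : E m k} (h : W =ᶠ[𝓝 p] W') : Div W p = Div W' p := by
  simp only [Div, h.fderiv_eq]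

/-- The weights: 1 in the z-directions, |z|^γ in the t-directions. -/
def dd (γ : ℝ) (i : Fin (m + k)) (p : E m k) : ℝ := if (i : ℕ) < m then 1 else ‖p.1‖ ^ γ

lemma Xvec_eq (γ : ℝ) (p : E m k) (i : Fin (m + k)) : Xvec γ p i = dd γ i p • bas i := by
  unfold Xvec dd bas
  split_ifs with h
  · simp
  · ext a <;> simp

lemma Xd_eq (γ : ℝ) (i : Fin (m + k)) (f : E m k → ℝ) (p : E m k) :
    Xd γ i f p = dd γ i p * Dc f p i := by
  simp [Xd, Xvec_eq, Dc]

/-- Coefficients in the Euclidean frame. -/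
def cA (γ : ℝ) (A : E m k → Matrix (Fin (m + k)) (Fin (m + k)) ℝ) (i j : Fin (m + k))
    (p : E m k) : ℝ := dd γ i p * dd γ j p * A p i j

/-- The vector field 𝒜∇v. -/
def Yv (γ : ℝ) (A : E m k → Matrix (Fin (m + k)) (Fin (m + k)) ℝ) (v : E m k → ℝ)
    (p : E m k) : E m k := ∑ i, (∑ j, cA γ A i j p * Dc v p j) • bas i

/-- The vector field F. -/
def Ff (γ : ℝ) (A : E m k → Matrix (Fin (m + k)) (Fin (m + k)) ℝ) (p : E m k) : E m k :=
  (rho γ p / mu γ A p) • Yv γ A (rho γ) p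

lemma co_sum_smul (c : Fin (m + k) → ℝ) (i : Fin (m + k)) :
    co i (∑ j, c j • (bas j : E m k)) = c i := by
  simp [map_sum, co_bas]

lemma co_Yv (γ : ℝ) (A : E m k → Matrix (Fin (m + k)) (Fin (m + k)) ℝ) (v : E m k → ℝ)
    (p : E m k) (i : Fin (m + k)) : co i (Yv γ A v p) = ∑ j, cA γ A i j p * Dc v p j :=
  co_sum_smul _ _

lemma quadA_eq (γ : ℝ) (A : E m k → Matrix (Fin (m + k)) (Fin (m + k)) ℝ) (v : E m k → ℝ)
    (p : E m k) : quadA γ A v p = ∑ i, ∑ j, cA γ A i j p * Dc v p i * Dc v p j := by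
  simp only [quadA, Xd_eq, cA]
  refine Finset.sum_congr rfl fun i _ => Finset.sum_congr rfl fun j _ => by ring

lemma fderiv_Yv (γ : ℝ) (A : E m k → Matrix (Fin (m + k)) (Fin (m + k)) ℝ) (v w : E m k → ℝ)
    (p : E m k) :
    fderiv ℝ w p (Yv γ A v p) = ∑ i, ∑ j, cA γ A i j p * Dc w p i * Dc v p j := by
  rw [fderiv_eq_sum]
  simp only [co_Yv, Finset.sum_mul]
  refine Finset.sum_congr rfl fun i _ => Finset.sum_congr rfl fun j _ => by ring

lemma fderiv_Yv_self (γ : ℝ) (A : E m k → Matrix (Fin (m + k)) (Fin (m + k)) ℝ) (v : E m k → ℝ)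
    (p : E m k) : fderiv ℝ v p (Yv γ A v p) = quadA γ A v p := by
  rw [fderiv_Yv, quadA_eq]

lemma cA_symm {γ : ℝ} {A : E m k → Matrix (Fin (m + k)) (Fin (m + k)) ℝ} (hS : Symm A)
    (i j : Fin (m + k)) (p : E m k) : cA γ A i j p = cA γ A j i p := by
  simp only [cA, hS p i j]; ring

lemma fderiv_Yv_comm {γ : ℝ} {A : E m k → Matrix (Fin (m + k)) (Fin (m + k)) ℝ} (hS : Symm A)
    (v w : E m k → ℝ) (p : E m k) :
    fderiv ℝ w p (Yv γ A v p) = fderiv ℝ v p (Yv γ A w p) := by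
  rw [fderiv_Yv, fderiv_Yv, Finset.sum_comm]
  refine Finset.sum_congr rfl fun i _ => Finset.sum_congr rfl fun j _ => ?_
  rw [cA_symm hS]; ring

lemma Fop_eq {γ : ℝ} {A : E m k → Matrix (Fin (m + k)) (Fin (m + k)) ℝ} (hS : Symm A)
    (v : E m k → ℝ) (p : E m k) : Fop γ A v p = fderiv ℝ v p (Ff γ A p) := by
  simp only [Ff, map_smul, smul_eq_mul, Fop]
  rw [fderiv_Yv_comm hS, fderiv_Yv]
  simp only [Xd_eq, cA]
  congr 1
  refine Finset.sum_congr rfl fun i _ => Finset.sum_congr rfl fun j _ => by ring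

/-! ### The gauge -/

lemma rho_nonneg (γ : ℝ) (p : E m k) : 0 ≤ rho γ p := by
  unfold rho; positivity

lemma rho_base_pos {γ : ℝ} (hγ : 0 < γ) {p : E m k} (hp : p ≠ 0) :
    0 < ‖p.1‖ ^ (2 * (γ + 1)) + (γ + 1) ^ 2 * ‖p.2‖ ^ 2 := by
  by_cases h : p.1 = 0
  · have h2 : p.2 ≠ 0 := fun h2 => hp (Prod.ext h h2)
    have : 0 < ‖p.2‖ := norm_pos_iff.2 h2
    positivity
  · have : 0 < ‖p.1‖ := norm_pos_iff.2 h
    positivity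

lemma rho_pos {γ : ℝ} (hγ : 0 < γ) {p : E m k} (hp : p ≠ 0) : 0 < rho γ p :=
  rpow_pos_of_pos (rho_base_pos hγ hp) _

lemma rho_zero {γ : ℝ} (hγ : 0 < γ) : rho γ (0 : E m k) = 0 := by
  have h1 : 2 * (γ + 1) ≠ 0 := by positivity
  have h2 : (2 * (γ + 1))⁻¹ ≠ 0 := inv_ne_zero h1
  simp [rho, zero_rpow h1]
  rw [zero_rpow]; positivity

lemma ne_zero_of_fst {p : E m k} (h : p.1 ≠ 0) : p ≠ 0 := fun h' => h (by simp [h'])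

lemma rho_rpow {γ : ℝ} (hγ : 0 < γ) (p : E m k) :
    rho γ p ^ (2 * (γ + 1)) = ‖p.1‖ ^ (2 * (γ + 1)) + (γ + 1) ^ 2 * ‖p.2‖ ^ 2 := by
  unfold rho
  rw [← rpow_mul (by positivity), one_div_mul_cancel (by positivity), rpow_one]

lemma norm_fst_le_rho {γ : ℝ} (hγ : 0 < γ) (p : E m k) : ‖p.1‖ ≤ rho γ p := by
  have h := rho_rpow hγ p
  have : ‖p.1‖ ^ (2 * (γ + 1)) ≤ rho γ p ^ (2 * (γ + 1)) := by
    rw [h]; nlinarith [sq_nonneg (γ + 1), sq_nonneg ‖p.2‖, mul_nonneg (sq_nonneg (γ + 1)) (sq_nonneg ‖p.2‖)]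
  exact (rpow_le_rpow_iff (norm_nonneg _) (rho_nonneg _ _) (by positivity)).1 this

lemma norm_snd_le_rho {γ : ℝ} (hγ : 0 < γ) (p : E m k) :
    (γ + 1) * ‖p.2‖ ≤ rho γ p ^ (γ + 1) := by
  have h := rho_rpow hγ p
  have h2 : (rho γ p ^ (γ + 1)) ^ 2 = rho γ p ^ (2 * (γ + 1)) := by
    rw [← rpow_natCast, ← rpow_mul (rho_nonneg _ _)]; congr 1; push_cast; ring
  have h3 : 0 ≤ ‖p.1‖ ^ (2 * (γ + 1)) := by positivity
  apply abs_le_of_sq_le_sq' _ (rpow_nonneg (rho_nonneg _ _) _) |>.2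
  rw [h2, h]; nlinarith

lemma continuous_rho {γ : ℝ} (hγ : 0 < γ) : Continuous (rho γ : E m k → ℝ) := by
  unfold rho
  refine Continuous.rpow_const ?_ (fun p => Or.inr (by positivity))
  refine Continuous.add ?_ (by fun_prop)
  exact Continuous.rpow_const (by fun_prop) (fun p => Or.inr (by positivity))

lemma isOpen_ball {γ : ℝ} (hγ : 0 < γ) (r : ℝ) : IsOpen (ball γ r : Set (E m k)) :=
  isOpen_lt (continuous_rho hγ) continuous_const

/-- The differential of ρ. -/
def drho (γ : ℝ) (p : E m k) : E m k →L[ℝ] ℝ :=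
  rho γ p ^ (-(2 * γ + 1)) • (‖p.1‖ ^ (2 * γ) • (innerSL ℝ p.1).comp (ContinuousLinearMap.fst ℝ _ _)
    + (γ + 1) • (innerSL ℝ p.2).comp (ContinuousLinearMap.snd ℝ _ _))

lemma hasFDerivAt_rho {γ : ℝ} (hγ : 0 < γ) {p : E m k} (hp : p ≠ 0) :
    HasFDerivAt (rho γ) (drho γ p) p := by
  have h1 : HasFDerivAt (fun q : E m k => ‖q.1‖ ^ (2 * (γ + 1)))
      (((2 * (γ + 1)) * ‖p.1‖ ^ (2 * (γ + 1) - 2)) • (innerSL ℝ p.1).comp (ContinuousLinearMap.fst ℝ _ _)) p := by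
    have := (hasFDerivAt_norm_rpow p.1 (p := 2 * (γ + 1)) (by linarith)).comp p
      (hasFDerivAt_fst (𝕜 := ℝ) (p := p))
    exact this
  have h2 : HasFDerivAt (fun q : E m k => ‖q.2‖ ^ 2)
      ((2 : ℝ) • (innerSL ℝ p.2).comp (ContinuousLinearMap.snd ℝ _ _)) p := by
    have := (hasStrictFDerivAt_norm_sq p.2).hasFDerivAt.comp p (hasFDerivAt_snd (𝕜 := ℝ) (p := p))
    refine this.congr_fderiv ?_
    ext <;> simp
  have h3 := (h1.add (h2.const_mul ((γ + 1) ^ 2))).rpow_const (p := 1 / (2 * (γ + 1)))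
    (Or.inl (rho_base_pos hγ hp).ne')
  refine h3.congr_fderiv ?_
  have e1 : (‖p.1‖ ^ (2 * (γ + 1)) + (γ + 1) ^ 2 * ‖p.2‖ ^ 2) ^ (1 / (2 * (γ + 1)) - 1)
      = rho γ p ^ (-(2 * γ + 1)) := by
    rw [rho, ← rpow_mul (rho_base_pos hγ hp).le]; congr 1; field_simp; ring
  have e2 : 2 * (γ + 1) - 2 = 2 * γ := by ring
  unfold drho
  simp only [Pi.add_apply] at *
  rw [e1, e2]
  ext x
  · simp; field_simp
  · simp; field_simp

lemma fderiv_rho {γ : ℝ} (hγ : 0 < γ) {p : E m k} (hp : p ≠ 0) :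
    fderiv ℝ (rho γ) p = drho γ p := (hasFDerivAt_rho hγ hp).fderiv

lemma contDiffAt_rho_one {γ : ℝ} (hγ : 0 < γ) {p : E m k} (hp : p ≠ 0) :
    ContDiffAt ℝ 1 (rho γ) p := by
  unfold rho
  refine ContDiffAt.rpow_const_of_ne ?_ (rho_base_pos hγ hp).ne'
  have h1 : ContDiff ℝ 1 (fun q : E m k => ‖q.1‖ ^ (2 * (γ + 1))) :=
    ContDiff.norm_rpow contDiff_fst (by linarith)
  have h2 : ContDiff ℝ 1 (fun q : E m k => ‖q.2‖ ^ 2) := contDiff_snd.norm_sq ℝ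
  exact (h1.add (contDiff_const.mul h2)).contDiffAt

lemma contDiffAt_normfst {n : WithTop ℕ∞} {p : E m k} (hp : p.1 ≠ 0) :
    ContDiffAt ℝ n (fun q : E m k => ‖q.1‖) p := contDiffAt_fst.norm ℝ hp

lemma contDiffAt_normfst_rpow {n : WithTop ℕ∞} (a : ℝ) {p : E m k} (hp : p.1 ≠ 0) :
    ContDiffAt ℝ n (fun q : E m k => ‖q.1‖ ^ a) p :=
  (contDiffAt_normfst hp).rpow_const_of_ne (norm_ne_zero_iff.2 hp)

lemma contDiffAt_rho {n : WithTop ℕ∞} {γ : ℝ} (hγ : 0 < γ) {p : E m k} (hp : p.1 ≠ 0) :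
    ContDiffAt ℝ n (rho γ) p := by
  unfold rho
  refine ContDiffAt.rpow_const_of_ne ?_ (rho_base_pos hγ (ne_zero_of_fst hp)).ne'
  have h2 : ContDiff ℝ n (fun q : E m k => ‖q.2‖ ^ 2) := contDiff_snd.norm_sq ℝ
  exact (contDiffAt_normfst_rpow _ hp).add (contDiff_const.mul h2).contDiffAt

lemma contDiffAt_dd {n : WithTop ℕ∞} (γ : ℝ) (i : Fin (m + k)) {p : E m k} (hp : p.1 ≠ 0) :
    ContDiffAt ℝ n (dd γ i) p := by
  unfold dd
  split_ifs
  · exact contDiffAt_const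
  · exact contDiffAt_normfst_rpow _ hp

lemma isOpen_fst_ne : IsOpen {p : E m k | p.1 ≠ 0} :=
  isOpen_ne_fun continuous_fst continuous_const

lemma eventually_fst_ne {p : E m k} (hp : p.1 ≠ 0) : ∀ᶠ q in 𝓝 p, q.1 ≠ 0 :=
  isOpen_fst_ne.mem_nhds hp

/-- Coordinate expression of ∂_i ρ. -/
def rr (γ : ℝ) (i : Fin (m + k)) (p : E m k) : ℝ :=
  rho γ p ^ (-(2 * γ + 1)) * ((if (i : ℕ) < m then ‖p.1‖ ^ (2 * γ) else (γ + 1)) * co i p)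

lemma inner_fst_bas (i : Fin (m + k)) (p : E m k) :
    inner ℝ p.1 (bas i : E m k).1 = if (i : ℕ) < m then co i p else 0 := by
  unfold bas
  split_ifs with h
  · simp [co_of_lt h, EuclideanSpace.inner_single_right]
  · simp

lemma inner_snd_bas (i : Fin (m + k)) (p : E m k) :
    inner ℝ p.2 (bas i : E m k).2 = if (i : ℕ) < m then 0 else co i p := by
  unfold bas
  split_ifs with h
  · simp
  · simp [co_of_ge h, EuclideanSpace.inner_single_right]

lemma Dc_rho {γ : ℝ} (hγ : 0 < γ) {p : E m k} (hp : p ≠ 0) (i : Fin (m + k)) :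
    Dc (rho γ) p i = rr γ i p := by
  simp only [Dc, fderiv_rho hγ hp, drho, rr]
  simp only [_root_.smul_apply, _root_.add_apply,
    ContinuousLinearMap.comp_apply, ContinuousLinearMap.coe_fst', ContinuousLinearMap.coe_snd',
    innerSL_apply_apply, inner_fst_bas, inner_snd_bas, smul_eq_mul]
  split_ifs <;> simp

end BG
end

section
open scoped Topology
namespace BG
variable {m k : ℕ}

/-! ### Symbol classes with universal constants -/

/-- An admissible coefficient matrix together with a point of `B_1` off `{z = 0}`. -/
structure Dat (m k : ℕ) (γ lam Λ : ℝ) where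
  A : E m k → Matrix (Fin (m + k)) (Fin (m + k)) ℝ
  hC : C1coeff A
  hS : Symm A
  hE : Elliptic lam A
  hH : HypH γ Λ A
  p : E m k
  hz : p.1 ≠ 0
  hρ : rho γ p < 1

variable {γ lam Λ : ℝ}

namespace Dat
/-- ρ at the point. -/
def R (x : Dat m k γ lam Λ) : ℝ := rho γ x.p
/-- |z|/ρ at the point. -/
def T (x : Dat m k γ lam Λ) : ℝ := ‖x.p.1‖ / rho γ x.p
/-- (|z|/ρ)^γ at the point. -/
def S (x : Dat m k γ lam Λ) : ℝ := (‖x.p.1‖ / rho γ x.p) ^ γ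
/-- ρ^γ at the point. -/
def P (x : Dat m k γ lam Λ) : ℝ := rho γ x.p ^ γ
/-- weight of the coordinate functions -/
def zw (x : Dat m k γ lam Λ) (i : Fin (m + k)) : ℝ := if (i : ℕ) < m then x.T * x.R else x.P * x.R
/-- weight of dd -/
def dw (x : Dat m k γ lam Λ) (i : Fin (m + k)) : ℝ := if (i : ℕ) < m then 1 else x.S * x.P
/-- weight of rr -/
def rw (x : Dat m k γ lam Λ) (i : Fin (m + k)) : ℝ :=
  if (i : ℕ) < m then x.S ^ 2 * x.T else 1 / x.P
/-- weight of b_ij -/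
def bw (x : Dat m k γ lam Λ) (i j : Fin (m + k)) : ℝ :=
  if (i : ℕ) < m ∧ (j : ℕ) < m then x.R else x.S * x.T * x.R


lemma R_pos (hγ : 0 < γ) (x : Dat m k γ lam Λ) : 0 < x.R := rho_pos hγ (ne_zero_of_fst x.hz)
lemma R_lt (x : Dat m k γ lam Λ) : x.R < 1 := x.hρ
lemma Z_pos (x : Dat m k γ lam Λ) : 0 < ‖x.p.1‖ := norm_pos_iff.2 x.hz
lemma T_pos (hγ : 0 < γ) (x : Dat m k γ lam Λ) : 0 < x.T := div_pos x.Z_pos (x.R_pos hγ)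
lemma T_le (hγ : 0 < γ) (x : Dat m k γ lam Λ) : x.T ≤ 1 := (div_le_one (x.R_pos hγ)).2 (norm_fst_le_rho hγ _)
lemma S_pos (hγ : 0 < γ) (x : Dat m k γ lam Λ) : 0 < x.S := rpow_pos_of_pos (x.T_pos hγ) _
lemma S_le (hγ : 0 < γ) (x : Dat m k γ lam Λ) : x.S ≤ 1 := rpow_le_one (x.T_pos hγ).le (x.T_le hγ) hγ.le
lemma P_pos (hγ : 0 < γ) (x : Dat m k γ lam Λ) : 0 < x.P := rpow_pos_of_pos (x.R_pos hγ) _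
lemma Z_eq (hγ : 0 < γ) (x : Dat m k γ lam Λ) : ‖x.p.1‖ = x.T * x.R := (div_mul_cancel₀ _ (x.R_pos hγ).ne').symm
lemma Zg_eq (hγ : 0 < γ) (x : Dat m k γ lam Λ) : ‖x.p.1‖ ^ γ = x.S * x.P := by
  rw [x.Z_eq hγ, mul_rpow (x.T_pos hγ).le (x.R_pos hγ).le]; rfl
lemma Z2g_eq (hγ : 0 < γ) (x : Dat m k γ lam Λ) : ‖x.p.1‖ ^ (2 * γ) = x.S ^ 2 * x.P ^ 2 := by
  rw [← mul_pow, ← x.Zg_eq hγ, ← rpow_natCast, ← rpow_mul (norm_nonneg _)]; congr 1; push_cast; ring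
lemma R2g_eq (hγ : 0 < γ) (x : Dat m k γ lam Λ) : rho γ x.p ^ (2 * γ) = x.P ^ 2 := by
  rw [P, ← rpow_natCast, ← rpow_mul (rho_nonneg _ _)]; congr 1; push_cast; ring
lemma Rg1_eq (hγ : 0 < γ) (x : Dat m k γ lam Λ) : rho γ x.p ^ (γ + 1) = x.P * x.R := by
  have h : 0 < rho γ x.p := x.R_pos hγ
  rw [rpow_add h, rpow_one]; rfl
lemma Rneg_eq (hγ : 0 < γ) (x : Dat m k γ lam Λ) : rho γ x.p ^ (-(2 * γ + 1)) = 1 / (x.P ^ 2 * x.R) := by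
  have h : 0 < rho γ x.p := x.R_pos hγ
  rw [rpow_neg h.le, rpow_add h, rpow_one, x.R2g_eq hγ, one_div]; rfl
lemma psi_eq (hγ : 0 < γ) (x : Dat m k γ lam Λ) : psi γ x.p = x.S ^ 2 := by
  have := x.P_pos hγ
  rw [psi, x.Z2g_eq hγ, x.R2g_eq hγ]; field_simp
lemma zw_pos (hγ : 0 < γ) (x : Dat m k γ lam Λ) (i) : 0 < x.zw i := by
  have := x.P_pos hγ; have := x.R_pos hγ; have := x.T_pos hγ
  unfold zw; split_ifs <;> positivity
lemma dw_pos (hγ : 0 < γ) (x : Dat m k γ lam Λ) (i) : 0 < x.dw i := by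
  have := x.P_pos hγ; have := x.S_pos hγ
  unfold dw; split_ifs <;> positivity
lemma rw_pos (hγ : 0 < γ) (x : Dat m k γ lam Λ) (i) : 0 < x.rw i := by
  have := x.P_pos hγ; have := x.S_pos hγ; have := x.T_pos hγ
  unfold rw; split_ifs <;> positivity
lemma bw_pos (hγ : 0 < γ) (x : Dat m k γ lam Λ) (i j) : 0 < x.bw i j := by
  have := x.R_pos hγ; have := x.S_pos hγ; have := x.T_pos hγ
  unfold bw; split_ifs <;> positivity
end Dat

/-- Symbol class. -/
def SC (f : Dat m k γ lam Λ → E m k → ℝ) (w : Dat m k γ lam Λ → ℝ) : Prop :=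
  ∃ C : ℝ, 0 ≤ C ∧ ∀ x : Dat m k γ lam Λ, 0 ≤ w x ∧ DifferentiableAt ℝ (f x) x.p ∧
    |f x x.p| ≤ C * w x ∧ ∀ i, |Dc (f x) x.p i| ≤ C * w x / x.zw i

lemma Dc_mul {f g : E m k → ℝ} {p : E m k} (hf : DifferentiableAt ℝ f p)
    (hg : DifferentiableAt ℝ g p) (i : Fin (m + k)) :
    Dc (fun q => f q * g q) p i = f p * Dc g p i + g p * Dc f p i := by
  simp [Dc, fderiv_fun_mul hf hg]

lemma Dc_add {f g : E m k → ℝ} {p : E m k} (hf : DifferentiableAt ℝ f p)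
    (hg : DifferentiableAt ℝ g p) (i : Fin (m + k)) :
    Dc (fun q => f q + g q) p i = Dc f p i + Dc g p i := by
  simp [Dc, fderiv_fun_add hf hg]

lemma SC.mul (hγ : 0 < γ) {f g : Dat m k γ lam Λ → E m k → ℝ} {w w' : Dat m k γ lam Λ → ℝ}
    (hf : SC f w) (hg : SC g w') : SC (fun x q => f x q * g x q) (fun x => w x * w' x) := by
  obtain ⟨C, hC, hf⟩ := hf
  obtain ⟨D, hD, hg⟩ := hg
  refine ⟨2 * (C * D), by positivity, fun x => ?_⟩
  obtain ⟨w0, fd, f1, f2⟩ := hf x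
  obtain ⟨w0', gd, g1, g2⟩ := hg x
  refine ⟨by positivity, fd.mul gd, ?_, fun i => ?_⟩
  · rw [abs_mul]
    have := mul_le_mul f1 g1 (abs_nonneg _) (by positivity)
    have : 0 ≤ C * w x * (D * w' x) := by positivity
    linarith
  · rw [Dc_mul fd gd]
    have hz := x.zw_pos hγ i
    have a1 := mul_le_mul f1 (g2 i) (abs_nonneg _) (by positivity)
    have a2 := mul_le_mul g1 (f2 i) (abs_nonneg _) (by positivity)
    refine (abs_add_le _ _).trans ?_
    rw [abs_mul, abs_mul]
    refine (add_le_add a1 a2).trans (le_of_eq ?_)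
    ring

lemma SC.add (hγ : 0 < γ) {f g : Dat m k γ lam Λ → E m k → ℝ} {w : Dat m k γ lam Λ → ℝ}
    (hf : SC f w) (hg : SC g w) : SC (fun x q => f x q + g x q) w := by
  obtain ⟨C, hC, hf⟩ := hf
  obtain ⟨D, hD, hg⟩ := hg
  refine ⟨C + D, by positivity, fun x => ?_⟩
  obtain ⟨w0, fd, f1, f2⟩ := hf x
  obtain ⟨w0', gd, g1, g2⟩ := hg x
  refine ⟨w0, fd.add gd, ?_, fun i => ?_⟩
  · refine (abs_add_le _ _).trans ?_
    linarith
  · rw [Dc_add fd gd]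
    refine (abs_add_le _ _).trans ?_
    refine (add_le_add (f2 i) (g2 i)).trans (le_of_eq ?_)
    ring

lemma SC.const (hγ : 0 < γ) (c : ℝ) :
    SC (fun (_ : Dat m k γ lam Λ) _ => c) (fun _ => 1) := by
  refine ⟨|c|, abs_nonneg _, fun x => ⟨zero_le_one, by fun_prop, by simp, fun i => ?_⟩⟩
  have := x.zw_pos hγ i
  simp [Dc]
  positivity

lemma SC.congr_w {f : Dat m k γ lam Λ → E m k → ℝ} {w w' : Dat m k γ lam Λ → ℝ}
    (hf : SC f w) (h : ∀ x, w x = w' x) : SC f w' := by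
  have : w = w' := funext h
  rwa [← this]

lemma SC.const_mul (hγ : 0 < γ) (c : ℝ) {f : Dat m k γ lam Λ → E m k → ℝ} {w : Dat m k γ lam Λ → ℝ}
    (hf : SC f w) : SC (fun x q => c * f x q) w :=
  ((SC.const hγ c).mul hγ hf).congr_w (by simp)

lemma SC.mono (hγ : 0 < γ) {f : Dat m k γ lam Λ → E m k → ℝ} {w w' : Dat m k γ lam Λ → ℝ}
    (hf : SC f w) (h : ∀ x, w x ≤ w' x) : SC f w' := by
  obtain ⟨C, hC, hf⟩ := hf
  refine ⟨C, hC, fun x => ?_⟩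
  obtain ⟨w0, fd, f1, f2⟩ := hf x
  refine ⟨w0.trans (h x), fd, f1.trans ?_, fun i => (f2 i).trans ?_⟩
  · exact mul_le_mul_of_nonneg_left (h x) hC
  · have := x.zw_pos hγ i
    have := mul_le_mul_of_nonneg_left (h x) hC
    gcongr

lemma SC.zero (hγ : 0 < γ) {w : Dat m k γ lam Λ → ℝ} (hw : ∀ x, 0 ≤ w x) :
    SC (fun (_ : Dat m k γ lam Λ) _ => 0) w := by
  refine ⟨0, le_rfl, fun x => ⟨hw x, by fun_prop, by simp, fun i => ?_⟩⟩
  simp [Dc]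

lemma SC.sum (hγ : 0 < γ) {w : Dat m k γ lam Λ → ℝ} (hw : ∀ x, 0 ≤ w x) {ι : Type*}
    (s : Finset ι) {f : ι → Dat m k γ lam Λ → E m k → ℝ}
    (hf : ∀ a ∈ s, SC (f a) w) : SC (fun x q => ∑ a ∈ s, f a x q) w := by
  classical
  induction s using Finset.induction_on with
  | empty => simpa using SC.zero hγ hw
  | insert a s ha ih =>
    simp only [Finset.sum_insert ha]
    exact (hf a (by simp)).add hγ (ih fun b hb => hf b (by simp [hb]))

lemma SC.congr {f g : Dat m k γ lam Λ → E m k → ℝ} {w : Dat m k γ lam Λ → ℝ}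
    (hf : SC f w) (h : ∀ x, g x =ᶠ[𝓝 x.p] f x) : SC g w := by
  obtain ⟨C, hC, hf⟩ := hf
  refine ⟨C, hC, fun x => ?_⟩
  obtain ⟨w0, fd, f1, f2⟩ := hf x
  refine ⟨w0, fd.congr_of_eventuallyEq (h x), by rwa [(h x).eq_of_nhds], fun i => ?_⟩
  have : Dc (g x) x.p i = Dc (f x) x.p i := by simp [Dc, (h x).fderiv_eq]
  rw [this]; exact f2 i

lemma SC.inv (hγ : 0 < γ) {f : Dat m k γ lam Λ → E m k → ℝ} {w : Dat m k γ lam Λ → ℝ}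
    (hf : SC f w) (hw : ∀ x, 0 < w x) (c : ℝ) (hc : 0 < c) (hl : ∀ x, c * w x ≤ f x x.p) :
    SC (fun x q => (f x q)⁻¹) (fun x => (w x)⁻¹) := by
  obtain ⟨C, hC, hf⟩ := hf
  refine ⟨c⁻¹ + C * (c ^ 2)⁻¹, by positivity, fun x => ?_⟩
  obtain ⟨w0, fd, f1, f2⟩ := hf x
  have hwx := hw x
  have hfp : 0 < f x x.p := lt_of_lt_of_le (by positivity) (hl x)
  have key : (f x x.p)⁻¹ ≤ c⁻¹ * (w x)⁻¹ := by
    rw [← mul_inv]; exact inv_anti₀ (by positivity) (hl x)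
  refine ⟨by positivity, fd.inv hfp.ne', ?_, fun i => ?_⟩
  · rw [abs_of_pos (by positivity)]
    refine key.trans ?_
    have : 0 ≤ C * (c ^ 2)⁻¹ * (w x)⁻¹ := by positivity
    linarith
  · have hz := x.zw_pos hγ i
    have e : Dc (fun q => (f x q)⁻¹) x.p i = - (f x x.p)⁻¹ ^ 2 * Dc (f x) x.p i := by
      simp only [Dc]
      have := ((hasDerivAt_inv hfp.ne').comp_hasFDerivAt x.p fd.hasFDerivAt).fderiv
      have h0 : (fun q => (f x q)⁻¹) = (fun y : ℝ => y⁻¹) ∘ f x := rfl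
      rw [h0, this]; simp
    rw [e, abs_mul, abs_neg, abs_of_nonneg (by positivity)]
    have h2 : (f x x.p)⁻¹ ^ 2 ≤ (c⁻¹ * (w x)⁻¹) ^ 2 := by gcongr
    refine (mul_le_mul h2 (f2 i) (abs_nonneg _) (by positivity)).trans ?_
    have h3 : (c⁻¹ * (w x)⁻¹) ^ 2 * (C * w x / x.zw i) = C * (c ^ 2)⁻¹ * (w x)⁻¹ / x.zw i := by
      field_simp
    rw [h3]
    have : 0 ≤ c⁻¹ := by positivity
    gcongr
    linarith

lemma SC.rpow (hγ : 0 < γ) {f : Dat m k γ lam Λ → E m k → ℝ} {w : Dat m k γ lam Λ → ℝ}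
    (hf : SC f w) (hw : ∀ x, 0 < w x) (hl : ∀ x, f x x.p = w x) (a : ℝ) :
    SC (fun x q => (f x q) ^ a) (fun x => (w x) ^ a) := by
  obtain ⟨C, hC, hf⟩ := hf
  refine ⟨1 + |a| * C, by positivity, fun x => ?_⟩
  obtain ⟨w0, fd, f1, f2⟩ := hf x
  have hwx := hw x
  have hwa : 0 < w x ^ a := rpow_pos_of_pos hwx a
  have hfp : f x x.p ≠ 0 := by rw [hl x]; exact hwx.ne'
  refine ⟨hwa.le, fd.rpow_const (Or.inl hfp), ?_, fun i => ?_⟩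
  · show |f x x.p ^ a| ≤ (1 + |a| * C) * w x ^ a
    rw [hl x, abs_of_pos hwa]
    have : 0 ≤ |a| * C * w x ^ a := by positivity
    linarith
  · have hz := x.zw_pos hγ i
    have e : Dc (fun q => (f x q) ^ a) x.p i = (a * w x ^ (a - 1)) * Dc (f x) x.p i := by
      simp only [Dc]
      have := (fd.hasFDerivAt.rpow_const (p := a) (Or.inl hfp)).fderiv
      rw [this]; simp [hl x]
    have hw1 : 0 < w x ^ (a - 1) := rpow_pos_of_pos hwx _
    rw [e, abs_mul, abs_mul, abs_of_pos hw1]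
    refine (mul_le_mul_of_nonneg_left (f2 i) (by positivity)).trans ?_
    have h3 : |a| * w x ^ (a - 1) * (C * w x / x.zw i) = |a| * C * w x ^ a / x.zw i := by
      rw [rpow_sub_one hwx.ne']; field_simp
    rw [h3]
    gcongr
    linarith

lemma SC.sub (hγ : 0 < γ) {f g : Dat m k γ lam Λ → E m k → ℝ} {w : Dat m k γ lam Λ → ℝ}
    (hf : SC f w) (hg : SC g w) : SC (fun x q => f x q - g x q) w := by
  have := hf.add hγ (hg.const_mul hγ (-1))
  simpa [sub_eq_add_neg] using this

/-! base symbols -/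

lemma abs_co_le (hγ : 0 < γ) (x : Dat m k γ lam Λ) (i : Fin (m + k)) :
    |co i x.p| ≤ x.zw i := by
  unfold Dat.zw
  split_ifs with h
  · rw [co_of_lt h, ← x.Z_eq hγ]
    exact PiLp.norm_apply_le x.p.1 _
  · rw [co_of_ge h, ← x.Rg1_eq hγ]
    refine (PiLp.norm_apply_le x.p.2 _).trans ?_
    have := norm_snd_le_rho hγ x.p
    nlinarith [norm_nonneg x.p.2]

lemma sc_co (hγ : 0 < γ) (i : Fin (m + k)) :
    SC (fun (_ : Dat m k γ lam Λ) q => co i q) (fun x => x.zw i) := by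
  refine ⟨1, zero_le_one, fun x => ⟨(x.zw_pos hγ i).le, (co i).differentiableAt, ?_, fun j => ?_⟩⟩
  · simpa using abs_co_le hγ x i
  · have : Dc (fun q : E m k => co i q) x.p j = if i = j then 1 else 0 := by
      simp only [Dc]
      rw [(co i).fderiv]; exact co_bas i j
    rw [this]
    have h1 := x.zw_pos hγ i
    have h2 := x.zw_pos hγ j
    split_ifs with h
    · subst h; simp [h1.ne']
    · simp; positivity

lemma Dc_normfst {p : E m k} (hp : p.1 ≠ 0) (i : Fin (m + k)) :
    Dc (fun q : E m k => ‖q.1‖) p i = (if (i : ℕ) < m then co i p else 0) / ‖p.1‖ := by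
  have h1 := (hasStrictFDerivAt_norm_sq p.1).hasFDerivAt.comp p (hasFDerivAt_fst (𝕜 := ℝ) (p := p))
  have h2 : HasFDerivAt (fun q : E m k => ‖q.1‖) (fderiv ℝ (fun q : E m k => ‖q.1‖) p) p :=
    ((contDiffAt_normfst (n := 1) hp).differentiableAt one_ne_zero).hasFDerivAt
  have h3 := h2.pow 2
  have h4 := congrArg (fun L => L (bas i)) (h1.unique h3)
  have hp' := norm_pos_iff.2 hp
  simp only [ContinuousLinearMap.comp_apply, ContinuousLinearMap.coe_fst', innerSL_apply_apply,
    _root_.smul_apply, inner_fst_bas] at h4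
  simp at h4
  rw [eq_div_iff hp'.ne', Dc]
  split_ifs at h4 ⊢ <;> nlinarith

lemma sc_norm (hγ : 0 < γ) :
    SC (fun (_ : Dat m k γ lam Λ) (q : E m k) => ‖q.1‖) (fun x => x.T * x.R) := by
  refine ⟨1, zero_le_one, fun x => ?_⟩
  have hR := x.R_pos hγ
  have hT := x.T_pos hγ
  refine ⟨by positivity, (contDiffAt_normfst (n := 1) x.hz).differentiableAt one_ne_zero, ?_, fun i => ?_⟩
  · rw [abs_norm, x.Z_eq hγ]; simp
  · rw [Dc_normfst x.hz, x.Z_eq hγ]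
    have hc := abs_co_le hγ x i
    unfold Dat.zw at hc ⊢
    split_ifs with h
    · rw [if_pos h] at hc
      rw [abs_div, abs_of_pos (by positivity : 0 < x.T * x.R)]
      gcongr
      linarith
    · have := x.P_pos hγ
      simp; positivity

lemma abs_rr_le (hγ : 0 < γ) (x : Dat m k γ lam Λ) (i : Fin (m + k)) :
    |rr γ i x.p| ≤ (1 + γ) * x.rw i := by
  have hR := x.R_pos hγ
  have hT := x.T_pos hγ
  have hS := x.S_pos hγ
  have hP := x.P_pos hγ
  have hc := abs_co_le hγ x i
  unfold rr Dat.rw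
  rw [x.Rneg_eq hγ, abs_mul, abs_mul, abs_of_pos (by positivity : 0 < 1 / (x.P ^ 2 * x.R))]
  unfold Dat.zw at hc
  split_ifs with h
  · rw [if_pos h] at hc
    rw [x.Z2g_eq hγ, abs_of_pos (by positivity)]
    calc _ ≤ 1 / (x.P ^ 2 * x.R) * (x.S ^ 2 * x.P ^ 2 * (x.T * x.R)) := by gcongr
      _ = x.S ^ 2 * x.T := by field_simp
      _ ≤ _ := by nlinarith [mul_pos hγ (mul_pos (pow_pos hS 2) hT)]
  · rw [if_neg h] at hc
    rw [abs_of_pos (by linarith)]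
    calc _ ≤ 1 / (x.P ^ 2 * x.R) * ((γ + 1) * (x.P * x.R)) := by gcongr
      _ = _ := by field_simp; ring

lemma sc_rho (hγ : 0 < γ) :
    SC (fun (_ : Dat m k γ lam Λ) => rho γ) (fun x => x.R) := by
  refine ⟨1 + γ, by positivity, fun x => ?_⟩
  have hR := x.R_pos hγ
  refine ⟨by positivity, (contDiffAt_rho (n := 1) hγ x.hz).differentiableAt one_ne_zero, ?_, fun i => ?_⟩
  · show |x.R| ≤ _
    rw [abs_of_pos hR]; nlinarith
  · rw [Dc_rho hγ (ne_zero_of_fst x.hz), mul_div_assoc]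
    refine (abs_rr_le hγ x i).trans (mul_le_mul_of_nonneg_left ?_ (by positivity))
    have hT := x.T_pos hγ
    have hS := x.S_pos hγ
    have hP := x.P_pos hγ
    have hT' := x.T_le hγ
    have hS' := x.S_le hγ
    unfold Dat.zw Dat.rw
    split_ifs with h
    · rw [le_div_iff₀ (by positivity)]
      have : x.S ^ 2 * x.T * x.T ≤ 1 := by
        have : x.S ^ 2 ≤ 1 := by nlinarith
        have : x.T * x.T ≤ 1 := by nlinarith
        nlinarith
      nlinarith
    · apply le_of_eq; field_simp

lemma sc_norm_rpow (hγ : 0 < γ) (a : ℝ) :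
    SC (fun (_ : Dat m k γ lam Λ) (q : E m k) => ‖q.1‖ ^ a) (fun x => (x.T * x.R) ^ a) :=
  (sc_norm hγ).rpow hγ (fun x => mul_pos (x.T_pos hγ) (x.R_pos hγ)) (fun x => x.Z_eq hγ) a

lemma sc_rho_rpow (hγ : 0 < γ) (a : ℝ) :
    SC (fun (_ : Dat m k γ lam Λ) (q : E m k) => rho γ q ^ a) (fun x => x.R ^ a) :=
  (sc_rho hγ).rpow hγ (fun x => x.R_pos hγ) (fun x => rfl) a

lemma sc_dd (hγ : 0 < γ) (i : Fin (m + k)) :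
    SC (fun (_ : Dat m k γ lam Λ) => dd γ i) (fun x => x.dw i) := by
  unfold dd Dat.dw
  split_ifs with h
  · exact SC.const hγ 1
  · exact (sc_norm_rpow hγ γ).congr_w fun x => by rw [← x.Z_eq hγ, x.Zg_eq hγ]

lemma sc_rr (hγ : 0 < γ) (i : Fin (m + k)) :
    SC (fun (_ : Dat m k γ lam Λ) => rr γ i) (fun x => x.rw i) := by
  unfold rr Dat.rw
  split_ifs with h
  · refine ((sc_rho_rpow hγ _).mul hγ ((sc_norm_rpow hγ _).mul hγ (sc_co hγ i))).congr_w fun x => ?_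
    have hR := x.R_pos hγ
    have hP := x.P_pos hγ
    rw [← x.Z_eq hγ, x.Z2g_eq hγ]
    have := x.Rneg_eq hγ
    unfold Dat.zw
    rw [if_pos h, Dat.R, this]
    change _ / (_ * x.R) * (_ * (_ * x.R)) = _
    field_simp
  · refine ((sc_rho_rpow hγ _).mul hγ ((sc_co hγ i).const_mul hγ (γ + 1))).congr_w fun x => ?_
    have hR := x.R_pos hγ
    have hP := x.P_pos hγ
    have := x.Rneg_eq hγ
    unfold Dat.zw
    rw [if_neg h, Dat.R, this]
    change _ / (_ * x.R) * (_ * x.R) = _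
    field_simp

lemma sc_psi (hγ : 0 < γ) :
    SC (fun (_ : Dat m k γ lam Λ) => psi γ) (fun x => x.S ^ 2) := by
  have := (sc_norm_rpow (m := m) (k := k) (lam := lam) (Λ := Λ) hγ (2 * γ)).mul hγ (sc_rho_rpow hγ (-(2 * γ)))
  refine (this.congr fun x => ?_).congr_w fun x => ?_
  · refine Eventually.of_forall fun q => ?_
    simp only [psi]
    rw [rpow_neg (rho_nonneg _ _)]; rfl
  · have hP := x.P_pos hγ
    rw [← x.Z_eq hγ, x.Z2g_eq hγ, Dat.R, rpow_neg (rho_nonneg _ _), x.R2g_eq hγ]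
    field_simp

lemma Dat.psi_half (hγ : 0 < γ) (x : Dat m k γ lam Λ) : psi γ x.p ^ ((1 : ℝ) / 2) = x.S := by
  rw [x.psi_eq hγ, ← rpow_natCast, ← rpow_mul (x.S_pos hγ).le]; norm_num

lemma Dat.psi_gam (hγ : 0 < γ) (x : Dat m k γ lam Λ) : psi γ x.p ^ (1 / (2 * γ)) = x.T := by
  rw [x.psi_eq hγ, ← rpow_natCast, ← rpow_mul (x.S_pos hγ).le]
  change (x.T ^ γ) ^ _ = _
  rw [← rpow_mul (x.T_pos hγ).le]
  have : γ * (((2 : ℕ) : ℝ) * (1 / (2 * γ))) = 1 := by push_cast; field_simp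
  rw [this, rpow_one]

lemma Dat.psi_pos (hγ : 0 < γ) (x : Dat m k γ lam Λ) : 0 < psi γ x.p := by
  rw [x.psi_eq hγ]; exact pow_pos (x.S_pos hγ) 2

lemma sc_b (hγ : 0 < γ) (hΛ : 0 < Λ) (i j : Fin (m + k)) :
    SC (fun (x : Dat m k γ lam Λ) q => (x.A q - 1) i j) (fun x => x.bw i j) := by
  refine ⟨Λ, hΛ.le, fun x => ⟨(x.bw_pos hγ i j).le, ?_, ?_, fun l => ?_⟩⟩
  · have := (x.hC i j).differentiable one_ne_zero
    show DifferentiableAt ℝ (fun q => x.A q i j - (1 : Matrix (Fin (m+k)) (Fin (m+k)) ℝ) i j) x.p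
    exact (this.sub_const _) x.p
  · have h := (x.hH x.p x.hρ).1 i j
    have e : psi γ x.p ^ ((1 : ℝ) / 2 + 1 / (2 * γ)) = x.S * x.T := by
      rw [rpow_add (x.psi_pos hγ), x.psi_half hγ, x.psi_gam hγ]
    rw [e] at h
    show _ ≤ Λ * x.bw i j
    unfold Dat.bw
    refine h.trans (le_of_eq ?_)
    split_ifs
    · rfl
    · show _ = Λ * (x.S * x.T * rho γ x.p)
      ring
  · have h := (x.hH x.p x.hρ).2 l i j
    have e : psi γ x.p ^ ((1 : ℝ) + 1 / (2 * γ)) = x.S ^ 2 * x.T := by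
      rw [rpow_add (x.psi_pos hγ), rpow_one, x.psi_eq hγ, ← x.psi_eq hγ, x.psi_gam hγ, x.psi_eq hγ]
    rw [e, x.psi_half hγ, Xd_eq, abs_mul] at h
    have hR := x.R_pos hγ
    have hT := x.T_pos hγ
    have hS := x.S_pos hγ
    have hP := x.P_pos hγ
    have hT' := x.T_le hγ
    have hS' := x.S_le hγ
    set Dl := |Dc (fun q => (x.A q - 1) i j) x.p l| with hDl
    show Dl ≤ Λ * x.bw i j / x.zw l
    unfold Dat.bw Dat.zw
    unfold dd at h
    by_cases hl : (l : ℕ) < m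
    · rw [if_pos hl, abs_one, one_mul] at h
      rw [if_pos hl]
      by_cases hij : (i : ℕ) < m ∧ (j : ℕ) < m
      · rw [if_pos ⟨hl, hij⟩] at h
        rw [if_pos hij, le_div_iff₀ (by positivity)]
        have : Dl * (x.T * x.R) ≤ Λ * (1 * x.R) := by gcongr
        linarith
      · rw [if_neg (by tauto), if_neg (by omega)] at h
        rw [if_neg hij, le_div_iff₀ (by positivity)]
        calc Dl * (x.T * x.R) ≤ Λ * x.S * (x.T * x.R) := by gcongr
          _ = _ := by ring
    · rw [if_neg hl, x.Zg_eq hγ, abs_of_pos (by positivity), if_neg (by tauto)] at h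
      rw [if_neg hl]
      by_cases hij : (i : ℕ) < m ∧ (j : ℕ) < m
      · rw [if_neg (by omega)] at h
        rw [if_pos hij, le_div_iff₀ (by positivity)]
        have h2 : x.S * (x.P * Dl) ≤ x.S * Λ := by linarith
        have h3 := le_of_mul_le_mul_left h2 hS
        nlinarith
      · rw [if_pos (by omega)] at h
        rw [if_neg hij, le_div_iff₀ (by positivity)]
        have h2 : x.S * (x.P * Dl) ≤ x.S * (Λ * (x.S * x.T)) := by nlinarith
        have h3 := le_of_mul_le_mul_left h2 hS
        nlinarith

end BG
end

section
open scoped Topology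
namespace BG
variable {m k : ℕ}
variable {γ lam Λ : ℝ}

/-- perturbation of the Euclidean-frame coefficients -/
def Bc (γ : ℝ) (A : E m k → Matrix (Fin (m + k)) (Fin (m + k)) ℝ) (i j : Fin (m + k))
    (p : E m k) : ℝ := dd γ i p * dd γ j p * (A p - 1) i j

/-- σ = μ - ψ -/
def sg (γ : ℝ) (A : E m k → Matrix (Fin (m + k)) (Fin (m + k)) ℝ) (p : E m k) : ℝ :=
  ∑ j, rr γ j p * ∑ i, Bc γ A j i p * rr γ i p

/-- dilation weights -/
def cz (γ : ℝ) (j : Fin (m + k)) : ℝ := if (j : ℕ) < m then 1 else γ + 1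

/-- components of the error F - Z -/
def Er (γ : ℝ) (A : E m k → Matrix (Fin (m + k)) (Fin (m + k)) ℝ) (j : Fin (m + k))
    (p : E m k) : ℝ :=
  (mu γ A p)⁻¹ * (rho γ p * (∑ i, Bc γ A j i p * rr γ i p) - sg γ A p * (cz γ j * co j p))

lemma sum_co_lt (p : E m k) :
    ∑ j : Fin (m + k), (if (j : ℕ) < m then co j p else 0) ^ 2 = ‖p.1‖ ^ 2 := by
  rw [Fin.sum_univ_add, EuclideanSpace.norm_sq_eq]
  simp [co_castAdd]

lemma sum_co_ge (p : E m k) :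
    ∑ j : Fin (m + k), (if (j : ℕ) < m then 0 else co j p) ^ 2 = ‖p.2‖ ^ 2 := by
  rw [Fin.sum_univ_add, EuclideanSpace.norm_sq_eq]
  simp [co_natAdd]

lemma cA_eq (A : E m k → Matrix (Fin (m + k)) (Fin (m + k)) ℝ) (i j : Fin (m + k)) (p : E m k) :
    cA γ A i j p = (if i = j then dd γ i p ^ 2 else 0) + Bc γ A i j p := by
  have : (A p - 1) i j = A p i j - (if i = j then 1 else 0) := by
    show A p i j - (1 : Matrix (Fin (m + k)) (Fin (m + k)) ℝ) i j = _
    rw [Matrix.one_apply]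
  rw [cA, Bc, this]
  split_ifs with h
  · subst h; ring
  · ring

lemma sum_dd_rr (hγ : 0 < γ) {p : E m k} (hp : p.1 ≠ 0) :
    ∑ i, dd γ i p ^ 2 * rr γ i p ^ 2 = psi γ p := by
  have hz := norm_pos_iff.2 hp
  have hr := rho_pos hγ (ne_zero_of_fst hp)
  have h1 : ∀ i : Fin (m + k), dd γ i p ^ 2 * rr γ i p ^ 2 = (rho γ p ^ (-(2 * γ + 1))) ^ 2 *
      (‖p.1‖ ^ (2 * γ) * (‖p.1‖ ^ (2 * γ) * (if (i : ℕ) < m then co i p else 0) ^ 2 +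
        (γ + 1) ^ 2 * (if (i : ℕ) < m then 0 else co i p) ^ 2)) := by
    intro i
    have e : ‖p.1‖ ^ (2 * γ) = (‖p.1‖ ^ γ) ^ 2 := by
      rw [← rpow_natCast, ← rpow_mul hz.le]; congr 1; push_cast; ring
    unfold dd rr
    split_ifs
    · ring
    · rw [e]; ring
  simp only [h1]
  rw [← Finset.mul_sum, ← Finset.mul_sum, Finset.sum_add_distrib, ← Finset.mul_sum,
    ← Finset.mul_sum, sum_co_lt, sum_co_ge]
  have h2 : ‖p.1‖ ^ (2 * γ) * ‖p.1‖ ^ 2 = ‖p.1‖ ^ (2 * (γ + 1)) := by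
    rw [← rpow_natCast, ← rpow_add hz]; congr 1; push_cast; ring
  rw [h2, ← rho_rpow hγ p, psi]
  have h3 : (rho γ p ^ (-(2 * γ + 1))) ^ 2 * rho γ p ^ (2 * (γ + 1)) = (rho γ p ^ (2 * γ))⁻¹ := by
    rw [← rpow_natCast, ← rpow_mul hr.le, ← rpow_add hr, ← rpow_neg hr.le]; congr 1; push_cast; ring
  rw [div_eq_mul_inv, ← h3]; ring

lemma mu_eq_sum (hγ : 0 < γ) (A : E m k → Matrix (Fin (m + k)) (Fin (m + k)) ℝ)
    {p : E m k} (hp : p.1 ≠ 0) : mu γ A p = ∑ i, ∑ j, cA γ A i j p * rr γ i p * rr γ j p := by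
  rw [mu, quadA_eq]
  simp only [Dc_rho hγ (ne_zero_of_fst hp)]

lemma mu_eq (hγ : 0 < γ) (A : E m k → Matrix (Fin (m + k)) (Fin (m + k)) ℝ)
    {p : E m k} (hp : p.1 ≠ 0) : mu γ A p = psi γ p + sg γ A p := by
  rw [mu_eq_sum hγ A hp, ← sum_dd_rr hγ hp, sg, ← Finset.sum_add_distrib]
  refine Finset.sum_congr rfl fun i _ => ?_
  simp only [cA_eq, add_mul, Finset.sum_add_distrib, ite_mul, zero_mul, Finset.sum_ite_eq,
    Finset.mem_univ, if_true, Finset.mul_sum]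
  congr 1
  · ring
  · exact Finset.sum_congr rfl fun j _ => by ring

lemma ellip {A : E m k → Matrix (Fin (m + k)) (Fin (m + k)) ℝ} (hE : Elliptic lam A)
    (p : E m k) (ξ : Fin (m + k) → ℝ) :
    lam * ∑ i, dd γ i p ^ 2 * ξ i ^ 2 ≤ ∑ i, ∑ j, cA γ A i j p * ξ i * ξ j ∧
    ∑ i, ∑ j, cA γ A i j p * ξ i * ξ j ≤ lam⁻¹ * ∑ i, dd γ i p ^ 2 * ξ i ^ 2 := by
  have h := hE p (fun i => dd γ i p * ξ i)
  have e : ∑ i, ∑ j, cA γ A i j p * ξ i * ξ j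
      = ∑ i, ∑ j, A p i j * (dd γ i p * ξ i) * (dd γ j p * ξ j) :=
    Finset.sum_congr rfl fun i _ => Finset.sum_congr rfl fun j _ => by rw [cA]; ring
  rw [e]
  simpa only [mul_pow] using h

lemma mu_bounds (hγ : 0 < γ) {A : E m k → Matrix (Fin (m + k)) (Fin (m + k)) ℝ}
    (hE : Elliptic lam A) {p : E m k} (hp : p.1 ≠ 0) :
    lam * psi γ p ≤ mu γ A p ∧ mu γ A p ≤ lam⁻¹ * psi γ p := by
  rw [mu_eq_sum hγ A hp, ← sum_dd_rr hγ hp]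
  exact ellip hE p _

lemma psi_pos {p : E m k} (hγ : 0 < γ) (hp : p.1 ≠ 0) : 0 < psi γ p :=
  div_pos (rpow_pos_of_pos (norm_pos_iff.2 hp) _) (rpow_pos_of_pos (rho_pos hγ (ne_zero_of_fst hp)) _)

lemma mu_pos (hγ : 0 < γ) (hlam : 0 < lam) {A : E m k → Matrix (Fin (m + k)) (Fin (m + k)) ℝ}
    (hE : Elliptic lam A) {p : E m k} (hp : p.1 ≠ 0) : 0 < mu γ A p :=
  lt_of_lt_of_le (mul_pos hlam (psi_pos hγ hp)) (mu_bounds hγ hE hp).1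

/-- ρ dd_j² rr_j = ψ zc_j -/
lemma rho_dd_rr (hγ : 0 < γ) {p : E m k} (hp : p.1 ≠ 0) (j : Fin (m + k)) :
    rho γ p * (dd γ j p ^ 2 * rr γ j p) = psi γ p * (cz γ j * co j p) := by
  have hz := norm_pos_iff.2 hp
  have hr := rho_pos hγ (ne_zero_of_fst hp)
  have e : ‖p.1‖ ^ (2 * γ) = (‖p.1‖ ^ γ) ^ 2 := by
    rw [← rpow_natCast, ← rpow_mul hz.le]; congr 1; push_cast; ring
  have h3 : rho γ p * rho γ p ^ (-(2 * γ + 1)) = (rho γ p ^ (2 * γ))⁻¹ := by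
    rw [← rpow_neg hr.le]
    conv_lhs => rw [← rpow_one (rho γ p), ← rpow_mul hr.le, ← rpow_add hr]
    congr 1; ring
  rw [psi, div_eq_mul_inv, ← h3]
  unfold dd rr cz
  split_ifs
  · ring
  · rw [e]; ring

lemma co_Ff (hγ : 0 < γ) (hlam : 0 < lam) {A : E m k → Matrix (Fin (m + k)) (Fin (m + k)) ℝ}
    (hE : Elliptic lam A) {p : E m k} (hp : p.1 ≠ 0) (j : Fin (m + k)) :
    co j (Ff γ A p) = cz γ j * co j p + Er γ A j p := by
  have hmu := mu_pos hγ hlam hE hp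
  have h1 : ∑ i, cA γ A j i p * rr γ i p = dd γ j p ^ 2 * rr γ j p + ∑ i, Bc γ A j i p * rr γ i p := by
    simp only [cA_eq, add_mul, Finset.sum_add_distrib, ite_mul, zero_mul, Finset.sum_ite_eq,
      Finset.mem_univ, if_true]
  rw [Ff, map_smul, co_Yv]
  simp only [Dc_rho hγ (ne_zero_of_fst hp), smul_eq_mul]
  rw [h1, Er]
  have h2 := rho_dd_rr hγ hp j
  have h3 := mu_eq hγ A hp
  field_simp
  rw [mul_add, h2, h3]; ring

/-! symbol estimates -/

section

lemma Dat.bw_le (hγ : 0 < γ) (x : Dat m k γ lam Λ) (i j) : x.bw i j ≤ x.R := by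
  have hR := x.R_pos hγ; have hS := x.S_pos hγ; have hT := x.T_pos hγ
  have hS' := x.S_le hγ; have hT' := x.T_le hγ
  unfold Dat.bw; split_ifs
  · exact le_rfl
  · have : x.S * x.T ≤ 1 := by nlinarith
    nlinarith

lemma Dat.dw_rw_bw (hγ : 0 < γ) (x : Dat m k γ lam Λ) (i j) :
    x.dw i * x.rw i * x.bw j i ≤ x.S ^ 2 * x.T * x.R := by
  have hR := x.R_pos hγ; have hS := x.S_pos hγ; have hT := x.T_pos hγ; have hP := x.P_pos hγ
  by_cases h : (i : ℕ) < m
  · have := x.bw_le hγ j i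
    simp only [Dat.dw, Dat.rw, if_pos h, one_mul]
    gcongr
  · simp only [Dat.dw, Dat.rw, Dat.bw, if_neg h, h, and_false, if_false]
    apply le_of_eq; field_simp

lemma Dat.dw_rw (hγ : 0 < γ) (x : Dat m k γ lam Λ) (i) : x.dw i * x.rw i ≤ x.S := by
  have hR := x.R_pos hγ; have hS := x.S_pos hγ; have hT := x.T_pos hγ; have hP := x.P_pos hγ
  have hS' := x.S_le hγ; have hT' := x.T_le hγ
  by_cases h : (i : ℕ) < m
  · simp only [Dat.dw, Dat.rw, if_pos h, one_mul]
    have : x.S * x.T ≤ 1 := by nlinarith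
    nlinarith
  · simp only [Dat.dw, Dat.rw, if_neg h]
    apply le_of_eq; field_simp

lemma Dat.S_zw (hγ : 0 < γ) (x : Dat m k γ lam Λ) (i) : x.S * x.zw i ≤ x.dw i * x.R := by
  have hR := x.R_pos hγ; have hS := x.S_pos hγ; have hT := x.T_pos hγ; have hP := x.P_pos hγ
  have hS' := x.S_le hγ; have hT' := x.T_le hγ
  by_cases h : (i : ℕ) < m
  · simp only [Dat.dw, Dat.zw, if_pos h, one_mul]
    have : x.S * x.T ≤ 1 := by nlinarith
    nlinarith
  · simp only [Dat.dw, Dat.zw, if_neg h]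
    apply le_of_eq; ring

lemma Dat.dw_TR (hγ : 0 < γ) (x : Dat m k γ lam Λ) (i) : x.dw i * (x.T * x.R) ≤ x.zw i := by
  have hR := x.R_pos hγ; have hS := x.S_pos hγ; have hT := x.T_pos hγ; have hP := x.P_pos hγ
  have hS' := x.S_le hγ; have hT' := x.T_le hγ
  by_cases h : (i : ℕ) < m
  · simp only [Dat.dw, Dat.zw, if_pos h, one_mul]; exact le_rfl
  · simp only [Dat.dw, Dat.zw, if_neg h]
    have : x.S * x.T ≤ 1 := by nlinarith
    nlinarith [mul_pos hP hR]

lemma sc_Bc (hγ : 0 < γ) (hΛ : 0 < Λ) (i j : Fin (m + k)) :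
    SC (fun (x : Dat m k γ lam Λ) => Bc γ x.A i j) (fun x => x.dw i * x.dw j * x.bw i j) :=
  ((sc_dd hγ i).mul hγ (sc_dd hγ j)).mul hγ (sc_b hγ hΛ i j)

lemma sc_Bcrr (hγ : 0 < γ) (hΛ : 0 < Λ) (j : Fin (m + k)) :
    SC (fun (x : Dat m k γ lam Λ) q => ∑ i, Bc γ x.A j i q * rr γ i q)
      (fun x => x.dw j * (x.S ^ 2 * x.T * x.R)) := by
  refine SC.sum hγ (fun x => ?_) _ fun i _ => ?_
  · have hR := x.R_pos hγ; have hS := x.S_pos hγ; have hT := x.T_pos hγ; have := x.dw_pos hγ j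
    positivity
  · refine ((sc_Bc hγ hΛ j i).mul hγ (sc_rr hγ i)).mono hγ fun x => ?_
    have h1 := x.dw_rw_bw hγ i j
    have h2 := x.dw_pos hγ j
    calc x.dw j * x.dw i * x.bw j i * x.rw i = x.dw j * (x.dw i * x.rw i * x.bw j i) := by ring
      _ ≤ _ := by gcongr

lemma sc_sg (hγ : 0 < γ) (hΛ : 0 < Λ) :
    SC (fun (x : Dat m k γ lam Λ) => sg γ x.A) (fun x => x.S ^ 3 * x.T * x.R) := by
  refine SC.sum hγ (fun x => ?_) _ fun j _ => ?_
  · have hR := x.R_pos hγ; have hS := x.S_pos hγ; have hT := x.T_pos hγ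
    positivity
  · refine ((sc_rr hγ j).mul hγ (sc_Bcrr hγ hΛ j)).mono hγ fun x => ?_
    have hR := x.R_pos hγ; have hS := x.S_pos hγ; have hT := x.T_pos hγ
    have h1 := x.dw_rw hγ j
    calc x.rw j * (x.dw j * (x.S ^ 2 * x.T * x.R)) = x.dw j * x.rw j * (x.S ^ 2 * x.T * x.R) := by ring
      _ ≤ x.S * (x.S ^ 2 * x.T * x.R) := by gcongr
      _ = _ := by ring

lemma sc_mu (hγ : 0 < γ) (hΛ : 0 < Λ) :
    SC (fun (x : Dat m k γ lam Λ) => mu γ x.A) (fun x => x.S ^ 2) := by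
  refine SC.congr ((sc_psi hγ).add hγ ((sc_sg hγ hΛ).mono hγ fun x => ?_)) fun x => ?_
  · have hR := x.R_pos hγ; have hS := x.S_pos hγ; have hT := x.T_pos hγ
    have hS' := x.S_le hγ; have hT' := x.T_le hγ
    have hR' := x.R_lt
    have h1 : x.T * x.R ≤ 1 := by nlinarith
    have h2 : x.S * (x.T * x.R) ≤ 1 := by nlinarith [mul_pos hT hR]
    calc x.S ^ 3 * x.T * x.R = x.S ^ 2 * (x.S * (x.T * x.R)) := by ring
      _ ≤ x.S ^ 2 * 1 := by gcongr
      _ = _ := by ring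
  · filter_upwards [eventually_fst_ne x.hz] with q hq using mu_eq hγ x.A hq

lemma sc_muinv (hγ : 0 < γ) (hlam : 0 < lam) (hΛ : 0 < Λ) :
    SC (fun (x : Dat m k γ lam Λ) q => (mu γ x.A q)⁻¹) (fun x => (x.S ^ 2)⁻¹) :=
  (sc_mu hγ hΛ).inv hγ (fun x => pow_pos (x.S_pos hγ) 2) lam hlam fun x => by
    rw [← x.psi_eq hγ]; exact (mu_bounds hγ x.hE x.hz).1

lemma sc_Er (hγ : 0 < γ) (hlam : 0 < lam) (hΛ : 0 < Λ) (j : Fin (m + k)) :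
    SC (fun (x : Dat m k γ lam Λ) => Er γ x.A j) (fun x => x.dw j * (x.T * x.R) * x.R) := by
  have h1 := ((sc_rho hγ).mul hγ (sc_Bcrr (lam := lam) hγ hΛ j)).mono (w' := fun x =>
    x.S ^ 2 * (x.dw j * (x.T * x.R) * x.R)) hγ fun x => le_of_eq (by ring)
  have h2 := ((sc_sg hγ hΛ).mul hγ ((sc_co (lam := lam) hγ j).const_mul hγ (cz γ j))).mono (w' := fun x =>
    x.S ^ 2 * (x.dw j * (x.T * x.R) * x.R)) hγ fun x => ?_
  · refine ((sc_muinv hγ hlam hΛ).mul hγ (h1.sub hγ h2)).congr_w fun x => ?_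
    have hS := x.S_pos hγ
    field_simp
  · have hR := x.R_pos hγ; have hS := x.S_pos hγ; have hT := x.T_pos hγ
    have := x.S_zw hγ j
    calc x.S ^ 3 * x.T * x.R * x.zw j = x.S ^ 2 * (x.T * x.R) * (x.S * x.zw j) := by ring
      _ ≤ x.S ^ 2 * (x.T * x.R) * (x.dw j * x.R) := by gcongr
      _ = _ := by ring
end

end BG
end

section
open scoped Topology
namespace BG
variable {m k : ℕ}
variable {γ lam Λ : ℝ}

/-! ### Regularity off `{z = 0}` -/

lemma contDiffAt_cA {A : E m k → Matrix (Fin (m + k)) (Fin (m + k)) ℝ} (hC : C1coeff A)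
    (i j : Fin (m + k)) {p : E m k} (hp : p.1 ≠ 0) : ContDiffAt ℝ 1 (cA γ A i j) p :=
  ((contDiffAt_dd γ i hp).mul (contDiffAt_dd γ j hp)).mul (hC i j).contDiffAt

lemma contDiffAt_Dc {v : E m k → ℝ} {p : E m k} (hv : ContDiffAt ℝ 2 v p) (j : Fin (m + k)) :
    ContDiffAt ℝ 1 (fun q => Dc v q j) p :=
  (hv.fderiv_right (m := 1) (by norm_num)).clm_apply contDiffAt_const

lemma contDiffAt_Yv {A : E m k → Matrix (Fin (m + k)) (Fin (m + k)) ℝ} (hC : C1coeff A)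
    {v : E m k → ℝ} {p : E m k} (hp : p.1 ≠ 0) (hv : ContDiffAt ℝ 2 v p) :
    ContDiffAt ℝ 1 (Yv γ A v) p := by
  unfold Yv
  refine ContDiffAt.sum fun i _ => ?_
  exact (ContDiffAt.sum fun j _ => (contDiffAt_cA hC i j hp).mul (contDiffAt_Dc hv j)).smul contDiffAt_const

lemma contDiffAt_quadA {A : E m k → Matrix (Fin (m + k)) (Fin (m + k)) ℝ} (hC : C1coeff A)
    {v : E m k → ℝ} {p : E m k} (hp : p.1 ≠ 0) (hv : ContDiffAt ℝ 2 v p) :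
    ContDiffAt ℝ 1 (quadA γ A v) p := by
  have : quadA γ A v = fun p => ∑ i, ∑ j, cA γ A i j p * Dc v p i * Dc v p j := funext (quadA_eq γ A v)
  rw [this]
  exact ContDiffAt.sum fun i _ => ContDiffAt.sum fun j _ =>
    ((contDiffAt_cA hC i j hp).mul (contDiffAt_Dc hv i)).mul (contDiffAt_Dc hv j)

lemma contDiffAt_mu (hγ : 0 < γ) {A : E m k → Matrix (Fin (m + k)) (Fin (m + k)) ℝ} (hC : C1coeff A)
    {p : E m k} (hp : p.1 ≠ 0) : ContDiffAt ℝ 1 (mu γ A) p :=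
  contDiffAt_quadA hC hp (contDiffAt_rho hγ hp)

lemma contDiffAt_Ff (hγ : 0 < γ) (hlam : 0 < lam)
    {A : E m k → Matrix (Fin (m + k)) (Fin (m + k)) ℝ} (hC : C1coeff A)
    (hE : Elliptic lam A) {p : E m k} (hp : p.1 ≠ 0) : ContDiffAt ℝ 1 (Ff γ A) p :=
  ((contDiffAt_rho hγ hp).div (contDiffAt_mu hγ hC hp) (mu_pos hγ hlam hE hp).ne').smul
    (contDiffAt_Yv hC hp (contDiffAt_rho hγ hp))

lemma F_rho (hγ : 0 < γ) (hlam : 0 < lam)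
    {A : E m k → Matrix (Fin (m + k)) (Fin (m + k)) ℝ}
    (hE : Elliptic lam A) {p : E m k} (hp : p.1 ≠ 0) : fderiv ℝ (rho γ) p (Ff γ A p) = rho γ p := by
  have := mu_pos hγ hlam hE hp
  rw [Ff, map_smul, fderiv_Yv_self, smul_eq_mul]
  change rho γ p / mu γ A p * mu γ A p = _
  field_simp

/-! ### Uniform constants -/

lemma SC.unif {ι : Type*} [Fintype ι] {f : ι → Dat m k γ lam Λ → E m k → ℝ}
    {w : ι → Dat m k γ lam Λ → ℝ} (hγ : 0 < γ) (h : ∀ a, SC (f a) (w a)) :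
    ∃ C : ℝ, 0 ≤ C ∧ ∀ a x, 0 ≤ w a x ∧ DifferentiableAt ℝ (f a x) x.p ∧
      |f a x x.p| ≤ C * w a x ∧ ∀ i, |Dc (f a x) x.p i| ≤ C * w a x / x.zw i := by
  choose C hC h using h
  refine ⟨∑ a, C a, Finset.sum_nonneg fun a _ => hC a, fun a x => ?_⟩
  obtain ⟨w0, fd, f1, f2⟩ := h a x
  have hle : C a ≤ ∑ a, C a := Finset.single_le_sum (fun a _ => hC a) (Finset.mem_univ a)
  refine ⟨w0, fd, f1.trans (by gcongr), fun i => (f2 i).trans ?_⟩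
  have := x.zw_pos hγ i
  gcongr

lemma F_comp (hγ : 0 < γ) (hlam : 0 < lam) (hΛ : 0 < Λ) :
    ∃ C : ℝ, 0 ≤ C ∧ ∀ (x : Dat m k γ lam Λ) (j : Fin (m + k)),
      |co j (Ff γ x.A x.p)| ≤ C * x.zw j ∧ |Er γ x.A j x.p| ≤ C * (x.dw j * (x.T * x.R) * x.R) ∧
      DifferentiableAt ℝ (Er γ x.A j) x.p ∧
      ∀ l, |Dc (Er γ x.A j) x.p l| ≤ C * (x.dw j * (x.T * x.R) * x.R) / x.zw l := by
  obtain ⟨C, hC, h⟩ := SC.unif hγ (fun j : Fin (m + k) => sc_Er (m := m) (k := k) hγ hlam hΛ j)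
  refine ⟨C + (γ + 1), by positivity, fun x j => ?_⟩
  obtain ⟨w0, fd, f1, f2⟩ := h j x
  have hle : C ≤ C + (γ + 1) := by linarith
  refine ⟨?_, f1.trans (by gcongr), fd, fun l => (f2 l).trans ?_⟩
  · rw [co_Ff hγ hlam x.hE x.hz]
    refine (abs_add_le _ _).trans ?_
    have h1 : |cz γ j * co j x.p| ≤ (γ + 1) * x.zw j := by
      rw [abs_mul]
      refine mul_le_mul ?_ (abs_co_le hγ x j) (abs_nonneg _) (by positivity)
      unfold cz; split_ifs
      · simp; exact hγ.le
      · rw [abs_of_pos (by linarith)]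
    have h2 : C * (x.dw j * (x.T * x.R) * x.R) ≤ C * (x.zw j * 1) := by
      have := x.dw_TR hγ j
      have hz := x.zw_pos hγ j
      have hR := x.R_pos hγ
      have := x.R_lt
      gcongr
    linarith
  · have := x.zw_pos hγ l
    gcongr

/-- derivative along `F` of a symbol -/
lemma SC.F_bound (hγ : 0 < γ) (hlam : 0 < lam) (hΛ : 0 < Λ) {f : Dat m k γ lam Λ → E m k → ℝ}
    {w : Dat m k γ lam Λ → ℝ} (hf : SC f w) :
    ∃ C : ℝ, 0 ≤ C ∧ ∀ x : Dat m k γ lam Λ, |fderiv ℝ (f x) x.p (Ff γ x.A x.p)| ≤ C * w x := by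
  obtain ⟨C, hC, hF⟩ := F_comp (m := m) (k := k) hγ hlam hΛ
  obtain ⟨D, hD, hf⟩ := hf
  refine ⟨∑ _i : Fin (m + k), C * D, Finset.sum_nonneg fun _ _ => by positivity, fun x => ?_⟩
  obtain ⟨w0, fd, f1, f2⟩ := hf x
  rw [fderiv_eq_sum, Finset.sum_mul]
  refine (Finset.abs_sum_le_sum_abs _ _).trans (Finset.sum_le_sum fun i _ => ?_)
  rw [abs_mul]
  have hz := x.zw_pos hγ i
  refine (mul_le_mul (hF x i).1 (f2 i) (abs_nonneg _) (by positivity)).trans (le_of_eq ?_)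
  field_simp

lemma F_norm (hγ : 0 < γ) (hlam : 0 < lam) (hΛ : 0 < Λ) :
    ∃ C : ℝ, 0 ≤ C ∧ ∀ x : Dat m k γ lam Λ,
      |fderiv ℝ (fun q : E m k => ‖q.1‖) x.p (Ff γ x.A x.p) - ‖x.p.1‖| ≤ C * x.R * ‖x.p.1‖ := by
  obtain ⟨C, hC, hF⟩ := F_comp (m := m) (k := k) hγ hlam hΛ
  obtain ⟨D, hD, hf⟩ := sc_norm (m := m) (k := k) (lam := lam) (Λ := Λ) hγ
  refine ⟨∑ _i : Fin (m + k), C * D, Finset.sum_nonneg fun _ _ => by positivity, fun x => ?_⟩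
  obtain ⟨w0, fd, f1, f2⟩ := hf x
  have hzp := x.Z_pos
  have e : fderiv ℝ (fun q : E m k => ‖q.1‖) x.p (Ff γ x.A x.p) - ‖x.p.1‖
      = ∑ j, Er γ x.A j x.p * Dc (fun q : E m k => ‖q.1‖) x.p j := by
    rw [fderiv_eq_sum]
    simp only [co_Ff hγ hlam x.hE x.hz, add_mul, Finset.sum_add_distrib]
    have : ∑ j, cz γ j * co j x.p * Dc (fun q : E m k => ‖q.1‖) x.p j = ‖x.p.1‖ := by
      have h1 : ∀ j, cz γ j * co j x.p * Dc (fun q : E m k => ‖q.1‖) x.p j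
          = (if (j : ℕ) < m then co j x.p else 0) ^ 2 * ‖x.p.1‖⁻¹ := by
        intro j
        rw [Dc_normfst x.hz]; unfold cz
        split_ifs
        · field_simp
        · simp
      simp only [h1]
      rw [← Finset.sum_mul, sum_co_lt]; field_simp
    rw [this]; ring
  rw [e, Finset.sum_mul, Finset.sum_mul]
  refine (Finset.abs_sum_le_sum_abs _ _).trans (Finset.sum_le_sum fun i _ => ?_)
  rw [abs_mul]
  have hz := x.zw_pos hγ i
  have hd := x.dw_pos hγ i
  have hR := x.R_pos hγ; have hT := x.T_pos hγ
  refine (mul_le_mul (hF x i).2.1 (f2 i) (abs_nonneg _) (by positivity)).trans ?_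
  rw [x.Z_eq hγ, ← mul_div_assoc, div_le_iff₀ hz]
  calc C * (x.dw i * (x.T * x.R) * x.R) * (D * (x.T * x.R))
      = C * D * x.R * (x.T * x.R) * (x.dw i * (x.T * x.R)) := by ring
    _ ≤ C * D * x.R * (x.T * x.R) * x.zw i := by
      have := x.dw_TR hγ i
      gcongr

lemma F_norm_rpow (hγ : 0 < γ) (hlam : 0 < lam) (hΛ : 0 < Λ) (a : ℝ) :
    ∃ C : ℝ, 0 ≤ C ∧ ∀ x : Dat m k γ lam Λ,
      |fderiv ℝ (fun q : E m k => ‖q.1‖ ^ a) x.p (Ff γ x.A x.p) - a * ‖x.p.1‖ ^ a|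
        ≤ C * x.R * ‖x.p.1‖ ^ a := by
  obtain ⟨C, hC, h⟩ := F_norm (m := m) (k := k) hγ hlam hΛ
  refine ⟨|a| * C, by positivity, fun x => ?_⟩
  have hz := x.Z_pos
  have fd : DifferentiableAt ℝ (fun q : E m k => ‖q.1‖) x.p :=
    (contDiffAt_normfst (n := 1) x.hz).differentiableAt one_ne_zero
  have e := (fd.hasFDerivAt.rpow_const (p := a) (Or.inl hz.ne')).fderiv
  rw [e]
  simp only [_root_.smul_apply, smul_eq_mul]
  have h1 : ‖x.p.1‖ ^ a = ‖x.p.1‖ ^ (a - 1) * ‖x.p.1‖ := by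
    rw [rpow_sub_one hz.ne']; field_simp
  have h2 : 0 < ‖x.p.1‖ ^ (a - 1) := rpow_pos_of_pos hz _
  rw [h1]
  have h3 : ∀ d : ℝ, a * ‖x.p.1‖ ^ (a - 1) * d - a * (‖x.p.1‖ ^ (a - 1) * ‖x.p.1‖)
    = a * ‖x.p.1‖ ^ (a - 1) * (d - ‖x.p.1‖) := fun d => by ring
  rw [h3, abs_mul, abs_mul, abs_of_pos h2]
  calc _ ≤ |a| * ‖x.p.1‖ ^ (a - 1) * (C * x.R * ‖x.p.1‖) := by
        gcongr; exact h x
    _ = _ := by ring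

lemma F_mu (hγ : 0 < γ) (hlam : 0 < lam) (hΛ : 0 < Λ) :
    ∃ C : ℝ, 0 ≤ C ∧ ∀ x : Dat m k γ lam Λ,
      |fderiv ℝ (mu γ x.A) x.p (Ff γ x.A x.p)| ≤ C * rho γ x.p * mu γ x.A x.p := by
  obtain ⟨C, hC, h1⟩ := F_norm_rpow (m := m) (k := k) hγ hlam hΛ (2 * γ)
  obtain ⟨D, hD, h2⟩ := (sc_sg (m := m) (k := k) hγ hΛ).F_bound hγ hlam hΛ
  refine ⟨(C + D) * lam⁻¹, by positivity, fun x => ?_⟩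
  have hz := x.Z_pos
  have hr : 0 < rho γ x.p := x.R_pos hγ
  have hR := x.R_pos hγ; have hS := x.S_pos hγ; have hT := x.T_pos hγ
  have hS' := x.S_le hγ; have hT' := x.T_le hγ
  have fdψ : DifferentiableAt ℝ (psi γ) x.p := ((sc_psi (m := m) (k := k) (lam := lam) (Λ := Λ) hγ).choose_spec.2 x).2.1
  have fdσ : DifferentiableAt ℝ (sg γ x.A) x.p := ((sc_sg (m := m) (k := k) (lam := lam) (Λ := Λ) hγ hΛ).choose_spec.2 x).2.1
  have e1 : fderiv ℝ (mu γ x.A) x.p = fderiv ℝ (psi γ) x.p + fderiv ℝ (sg γ x.A) x.p := by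
    rw [← fderiv_add fdψ fdσ]
    apply Filter.EventuallyEq.fderiv_eq
    filter_upwards [eventually_fst_ne x.hz] with q hq using mu_eq hγ x.A hq
  have fdρ : DifferentiableAt ℝ (rho γ) x.p := (contDiffAt_rho (n := 1) hγ x.hz).differentiableAt one_ne_zero
  have fdn : DifferentiableAt ℝ (fun q : E m k => ‖q.1‖ ^ (2 * γ)) x.p :=
    (contDiffAt_normfst_rpow (n := 1) _ x.hz).differentiableAt one_ne_zero
  have e2 : psi γ = fun q : E m k => ‖q.1‖ ^ (2 * γ) * rho γ q ^ (-(2 * γ)) := by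
    funext q; simp only [psi]; rw [rpow_neg (rho_nonneg _ _)]; rfl
  have hρd := fdρ.hasFDerivAt.rpow_const (p := -(2 * γ)) (Or.inl hr.ne')
  have e3 : fderiv ℝ (psi γ) x.p (Ff γ x.A x.p) = rho γ x.p ^ (-(2 * γ)) *
      (fderiv ℝ (fun q : E m k => ‖q.1‖ ^ (2 * γ)) x.p (Ff γ x.A x.p) - 2 * γ * ‖x.p.1‖ ^ (2 * γ)) := by
    rw [e2, fderiv_fun_mul fdn hρd.differentiableAt, hρd.fderiv]
    simp only [_root_.smul_apply, _root_.add_apply, smul_eq_mul]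
    rw [F_rho hγ hlam x.hE x.hz, rpow_sub_one hr.ne']; field_simp; ring
  have h3 : |fderiv ℝ (psi γ) x.p (Ff γ x.A x.p)| ≤ C * x.R * psi γ x.p := by
    have hp : 0 < rho γ x.p ^ (-(2 * γ)) := rpow_pos_of_pos hr _
    rw [e3, abs_mul, abs_of_pos hp]
    calc _ ≤ rho γ x.p ^ (-(2 * γ)) * (C * x.R * ‖x.p.1‖ ^ (2 * γ)) := by
          gcongr; exact h1 x
      _ = _ := by rw [e2]; ring
  have h4 : |fderiv ℝ (sg γ x.A) x.p (Ff γ x.A x.p)| ≤ D * x.R * psi γ x.p := by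
    refine (h2 x).trans ?_
    rw [x.psi_eq hγ]
    have : x.S * x.T ≤ 1 := by nlinarith
    calc D * (x.S ^ 3 * x.T * x.R) = D * x.R * x.S ^ 2 * (x.S * x.T) := by ring
      _ ≤ D * x.R * x.S ^ 2 * 1 := by gcongr
      _ = _ := by ring
  have h5 := (mu_bounds hγ x.hE x.hz).1
  have h6 : psi γ x.p ≤ lam⁻¹ * mu γ x.A x.p := by
    rw [inv_mul_eq_div, le_div_iff₀ hlam]; linarith
  rw [e1, _root_.add_apply]
  refine (abs_add_le _ _).trans ((add_le_add h3 h4).trans ?_)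
  show _ ≤ (C + D) * lam⁻¹ * x.R * mu γ x.A x.p
  calc _ = (C + D) * x.R * psi γ x.p := by ring
    _ ≤ (C + D) * x.R * (lam⁻¹ * mu γ x.A x.p) := by gcongr
    _ = _ := by ring

lemma Dc_coF (hγ : 0 < γ) (hlam : 0 < lam) (hΛ : 0 < Λ) (x : Dat m k γ lam Λ) (j l : Fin (m + k)) :
    Dc (fun q => co j (Ff γ x.A q)) x.p l = (if j = l then cz γ j else 0) + Dc (Er γ x.A j) x.p l := by
  obtain ⟨C, hC, hF⟩ := F_comp (m := m) (k := k) hγ hlam hΛ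
  have fd := (hF x j).2.2.1
  have e : (fun q => co j (Ff γ x.A q)) =ᶠ[𝓝 x.p] fun q => cz γ j * co j q + Er γ x.A j q := by
    filter_upwards [eventually_fst_ne x.hz] with q hq using co_Ff hγ hlam x.hE hq j
  have fc : DifferentiableAt ℝ (fun q : E m k => cz γ j * co j q) x.p :=
    (co j).differentiableAt.const_mul _
  have : Dc (fun q => co j (Ff γ x.A q)) x.p l = Dc (fun q => cz γ j * co j q + Er γ x.A j q) x.p l := by
    simp only [Dc, e.fderiv_eq]
  rw [this, Dc_add fc fd]
  congr 1
  simp only [Dc]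
  rw [fderiv_const_mul (co j).differentiableAt, (co j).fderiv]
  simp [co_bas]

lemma Div_F (hγ : 0 < γ) (hlam : 0 < lam) (hΛ : 0 < Λ) :
    ∃ C : ℝ, 0 ≤ C ∧ ∀ x : Dat m k γ lam Λ,
      |Div (Ff γ x.A) x.p - (m + (γ + 1) * k)| ≤ C * rho γ x.p := by
  obtain ⟨C, hC, hF⟩ := F_comp (m := m) (k := k) hγ hlam hΛ
  refine ⟨∑ _i : Fin (m + k), C, Finset.sum_nonneg fun _ _ => by positivity, fun x => ?_⟩
  have fd := (contDiffAt_Ff hγ hlam x.hC x.hE x.hz).differentiableAt one_ne_zero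
  have e : Div (Ff γ x.A) x.p = (m + (γ + 1) * k) + ∑ i, Dc (Er γ x.A i) x.p i := by
    unfold Div
    have : ∀ i, co i (fderiv ℝ (Ff γ x.A) x.p (bas i)) = cz γ i + Dc (Er γ x.A i) x.p i := by
      intro i
      rw [co_fderiv fd]
      have := Dc_coF hγ hlam hΛ x i i
      rw [if_pos rfl] at this
      exact this
    simp only [this, Finset.sum_add_distrib]
    congr 1
    rw [Fin.sum_univ_add]
    simp [cz]; ring
  rw [e, add_sub_cancel_left, Finset.sum_mul]
  refine (Finset.abs_sum_le_sum_abs _ _).trans (Finset.sum_le_sum fun i _ => ?_)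
  refine ((hF x i).2.2.2 i).trans ?_
  have hz := x.zw_pos hγ i
  rw [div_le_iff₀ hz]
  have := x.dw_TR hγ i
  have hR := x.R_pos hγ
  show _ ≤ C * x.R * x.zw i
  calc C * (x.dw i * (x.T * x.R) * x.R) ≤ C * (x.zw i * x.R) := by gcongr
    _ = _ := by ring

lemma dd_eq_dw (hγ : 0 < γ) (x : Dat m k γ lam Λ) (i) : dd γ i x.p = x.dw i := by
  unfold dd Dat.dw; rw [x.Zg_eq hγ]

/-- The matrix of the tensor T(ξ). -/
def Mt (γ : ℝ) (A : E m k → Matrix (Fin (m + k)) (Fin (m + k)) ℝ) (p : E m k)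
    (i j : Fin (m + k)) : ℝ :=
  1 / 2 * fderiv ℝ (cA γ A i j) p (Ff γ A p)
    - ∑ l, cA γ A i l p * Dc (fun q => co j (Ff γ A q)) p l + cA γ A i j p

lemma F_dd_sq (hγ : 0 < γ) (hlam : 0 < lam) (hΛ : 0 < Λ) :
    ∃ C : ℝ, 0 ≤ C ∧ ∀ (x : Dat m k γ lam Λ) (i : Fin (m + k)),
    |1 / 2 * fderiv ℝ (fun q => dd γ i q ^ 2) x.p (Ff γ x.A x.p) + dd γ i x.p ^ 2 * (1 - cz γ i)|
      ≤ C * x.R * dd γ i x.p ^ 2 := by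
  obtain ⟨C, hC, h1⟩ := F_norm_rpow (m := m) (k := k) hγ hlam hΛ (2 * γ)
  refine ⟨C, hC, fun x i => ?_⟩
  have hR := x.R_pos hγ
  unfold dd cz
  split_ifs
  · simp; positivity
  · have e : ∀ q : E m k, (‖q.1‖ ^ γ) ^ 2 = ‖q.1‖ ^ (2 * γ) := fun q => by
      rw [← rpow_natCast, ← rpow_mul (norm_nonneg _)]; congr 1; push_cast; ring
    simp only [e]
    have h := h1 x
    have : ∀ a b : ℝ, 1 / 2 * a + b * (1 - (γ + 1)) = 1 / 2 * (a - 2 * γ * b) := fun a b => by ring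
    rw [this, abs_mul]
    have h0 := abs_nonneg (fderiv ℝ (fun q : E m k => ‖q.1‖ ^ (2 * γ)) x.p (Ff γ x.A x.p) - 2 * γ * ‖x.p.1‖ ^ (2 * γ))
    have : |(1 / 2 : ℝ)| = 1 / 2 := by norm_num
    rw [this]; linarith

lemma Mt_entry (hγ : 0 < γ) (hlam : 0 < lam) (hΛ : 0 < Λ) :
    ∃ C : ℝ, 0 ≤ C ∧ ∀ (x : Dat m k γ lam Λ) (i j : Fin (m + k)),
      |Mt γ x.A x.p i j| ≤ C * x.R * (x.dw i * x.dw j) := by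
  obtain ⟨C1, hC1, hF⟩ := F_comp (m := m) (k := k) hγ hlam hΛ
  obtain ⟨C2, hC2, hd⟩ := F_dd_sq (m := m) (k := k) hγ hlam hΛ
  obtain ⟨C3, hC3, hB⟩ := SC.unif hγ (fun a : Fin (m + k) × Fin (m + k) => sc_Bc (m := m) (k := k) (lam := lam) hγ hΛ a.1 a.2)
  have hFB : ∀ a : Fin (m + k) × Fin (m + k), ∃ C : ℝ, 0 ≤ C ∧ ∀ x : Dat m k γ lam Λ,
    |fderiv ℝ (Bc γ x.A a.1 a.2) x.p (Ff γ x.A x.p)| ≤ C * (x.dw a.1 * x.dw a.2 * x.bw a.1 a.2) :=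
    fun a => (sc_Bc (m := m) (k := k) hγ hΛ a.1 a.2).F_bound hγ hlam hΛ
  choose C4 hC4 hFB using hFB
  have hC4s : 0 ≤ ∑ a, C4 a := Finset.sum_nonneg fun a _ => hC4 a
  have hN : 0 ≤ ∑ _l : Fin (m + k), C3 * C1 := Finset.sum_nonneg fun _ _ => by positivity
  refine ⟨C2 + C1 + (∑ a, C4 a + (∑ _l : Fin (m + k), C3 * C1) + C3 * (γ + 1)), by positivity, fun x i j => ?_⟩
  have hR := x.R_pos hγ
  have hR1 := x.R_lt
  have hdi := x.dw_pos hγ i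
  have hdj := x.dw_pos hγ j
  have hzi := x.zw_pos hγ i
  have hdd := dd_eq_dw hγ x
  set W := x.R * (x.dw i * x.dw j) with hW
  have hW0 : 0 < W := by positivity
  -- decomposition
  have fdB : DifferentiableAt ℝ (Bc γ x.A i j) x.p := (hB (i, j) x).2.1
  have fdd : DifferentiableAt ℝ (fun q : E m k => dd γ i q ^ 2) x.p :=
    ((contDiffAt_dd (n := 1) γ i x.hz).differentiableAt one_ne_zero).pow 2
  have e1 : fderiv ℝ (cA γ x.A i j) x.p (Ff γ x.A x.p)
      = (if i = j then fderiv ℝ (fun q : E m k => dd γ i q ^ 2) x.p (Ff γ x.A x.p) else 0)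
        + fderiv ℝ (Bc γ x.A i j) x.p (Ff γ x.A x.p) := by
    have e0 : cA γ x.A i j = fun p => (if i = j then dd γ i p ^ 2 else 0) + Bc γ x.A i j p :=
      funext fun p => cA_eq x.A i j p
    rw [e0]
    split_ifs
    · rw [fderiv_fun_add fdd fdB]; rfl
    · simp
  have e2 : ∑ l, cA γ x.A i l x.p * Dc (fun q => co j (Ff γ x.A q)) x.p l
      = (if i = j then dd γ i x.p ^ 2 * cz γ i else 0) + dd γ i x.p ^ 2 * Dc (Er γ x.A j) x.p i
        + Bc γ x.A i j x.p * cz γ j + ∑ l, Bc γ x.A i l x.p * Dc (Er γ x.A j) x.p l := by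
    simp only [Dc_coF hγ hlam hΛ, cA_eq, add_mul, mul_add, Finset.sum_add_distrib, ite_mul, zero_mul,
      mul_ite, mul_zero, Finset.sum_ite_eq, Finset.mem_univ, if_true]
    by_cases hij : i = j
    · subst hij; simp; ring
    · have hij' : ¬ j = i := fun h => hij h.symm
      simp [hij, hij']; ring
  have e3 : Mt γ x.A x.p i j =
      (if i = j then (1 / 2 * fderiv ℝ (fun q => dd γ i q ^ 2) x.p (Ff γ x.A x.p) + dd γ i x.p ^ 2 * (1 - cz γ i)) else 0)
      - dd γ i x.p ^ 2 * Dc (Er γ x.A j) x.p i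
      + (1 / 2 * fderiv ℝ (Bc γ x.A i j) x.p (Ff γ x.A x.p)
        - ∑ l, Bc γ x.A i l x.p * Dc (Er γ x.A j) x.p l
        + Bc γ x.A i j x.p * (1 - cz γ j)) := by
    rw [Mt, e1, e2, cA_eq]
    split_ifs <;> ring
  have b1 : |if i = j then (1 / 2 * fderiv ℝ (fun q => dd γ i q ^ 2) x.p (Ff γ x.A x.p) + dd γ i x.p ^ 2 * (1 - cz γ i)) else 0|
      ≤ C2 * W := by
    split_ifs with hij
    · subst hij
      refine (hd x i).trans (le_of_eq ?_)
      rw [hdd, hW]; ring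
    · simp; positivity
  have b2 : |dd γ i x.p ^ 2 * Dc (Er γ x.A j) x.p i| ≤ C1 * W := by
    rw [hdd, abs_mul, abs_of_pos (by positivity)]
    calc _ ≤ x.dw i ^ 2 * (C1 * (x.dw j * (x.T * x.R) * x.R) / x.zw i) := by
          gcongr; exact (hF x j).2.2.2 i
      _ ≤ C1 * W := by
          rw [← mul_div_assoc, div_le_iff₀ hzi]
          calc _ = C1 * W * (x.dw i * (x.T * x.R)) := by rw [hW]; ring
            _ ≤ _ := by
              have := x.dw_TR hγ i
              gcongr
  have hbw := x.bw_le hγ i j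
  have b3 : |1 / 2 * fderiv ℝ (Bc γ x.A i j) x.p (Ff γ x.A x.p)| ≤ (∑ a, C4 a) * W := by
    have h1 := hFB (i, j) x
    have h2 : C4 (i, j) ≤ ∑ a, C4 a := Finset.single_le_sum (fun a _ => hC4 a) (Finset.mem_univ _)
    rw [abs_mul]
    have : |(1 / 2 : ℝ)| = 1 / 2 := by norm_num
    rw [this]
    have h3 : C4 (i, j) * (x.dw i * x.dw j * x.bw i j) ≤ (∑ a, C4 a) * W := by
      rw [hW, mul_comm x.R]
      have := x.bw_pos hγ i j
      gcongr
    have := abs_nonneg (fderiv ℝ (Bc γ x.A i j) x.p (Ff γ x.A x.p))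
    simp only at h1
    linarith
  have b4 : |∑ l, Bc γ x.A i l x.p * Dc (Er γ x.A j) x.p l| ≤ (∑ _l : Fin (m + k), C3 * C1) * W := by
    rw [Finset.sum_mul]
    refine (Finset.abs_sum_le_sum_abs _ _).trans (Finset.sum_le_sum fun l _ => ?_)
    rw [abs_mul]
    have hzl := x.zw_pos hγ l
    have hdl := x.dw_pos hγ l
    have hbl := x.bw_pos hγ i l
    refine (mul_le_mul (hB (i, l) x).2.2.1 ((hF x j).2.2.2 l) (abs_nonneg _) (by positivity)).trans ?_
    rw [← mul_div_assoc, div_le_iff₀ hzl]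
    calc C3 * (x.dw i * x.dw l * x.bw i l) * (C1 * (x.dw j * (x.T * x.R) * x.R))
        = C3 * C1 * W * (x.bw i l) * (x.dw l * (x.T * x.R)) := by rw [hW]; ring
      _ ≤ C3 * C1 * W * 1 * x.zw l := by
        have h1 := x.dw_TR hγ l
        have h2 : x.bw i l ≤ 1 := (x.bw_le hγ i l).trans hR1.le
        have h3 : 0 ≤ x.dw l * (x.T * x.R) := by have := x.T_pos hγ; positivity
        gcongr
      _ = _ := by ring
  have b5 : |Bc γ x.A i j x.p * (1 - cz γ j)| ≤ C3 * (γ + 1) * W := by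
    rw [abs_mul]
    have h1 : |1 - cz γ j| ≤ γ + 1 := by
      unfold cz; split_ifs
      · simp; linarith
      · rw [abs_le]; constructor <;> linarith
    have h2 : C3 * (x.dw i * x.dw j * x.bw i j) ≤ C3 * W := by
      rw [hW, mul_comm x.R]
      have := x.bw_pos hγ i j
      gcongr
    calc _ ≤ C3 * W * (γ + 1) := mul_le_mul ((hB (i, j) x).2.2.1.trans h2) h1 (abs_nonneg _) (by positivity)
      _ = _ := by ring
  rw [e3]
  refine (abs_add_le _ _).trans ?_
  refine (add_le_add (abs_sub _ _) (abs_add_le _ _)).trans ?_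
  have b6 := abs_sub (1 / 2 * fderiv ℝ (Bc γ x.A i j) x.p (Ff γ x.A x.p)) (∑ l, Bc γ x.A i l x.p * Dc (Er γ x.A j) x.p l)
  rw [mul_assoc, ← hW]
  linarith

lemma Mt_form (hγ : 0 < γ) (hlam : 0 < lam) (hΛ : 0 < Λ) :
    ∃ C : ℝ, 0 ≤ C ∧ ∀ (x : Dat m k γ lam Λ) (ξ : Fin (m + k) → ℝ),
      |∑ i, ∑ j, Mt γ x.A x.p i j * ξ i * ξ j| ≤
        C * rho γ x.p * ∑ i, ∑ j, cA γ x.A i j x.p * ξ i * ξ j := by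
  obtain ⟨C, hC, h⟩ := Mt_entry (m := m) (k := k) hγ hlam hΛ
  refine ⟨C * (m + k) * lam⁻¹, by positivity, fun x ξ => ?_⟩
  have hR := x.R_pos hγ
  have h1 : |∑ i, ∑ j, Mt γ x.A x.p i j * ξ i * ξ j| ≤ C * x.R * (∑ i, x.dw i * |ξ i|) ^ 2 := by
    refine (Finset.abs_sum_le_sum_abs _ _).trans ?_
    rw [sq, Finset.sum_mul_sum, Finset.mul_sum]
    refine Finset.sum_le_sum fun i _ => (Finset.abs_sum_le_sum_abs _ _).trans ?_
    rw [Finset.mul_sum]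
    refine Finset.sum_le_sum fun j _ => ?_
    rw [abs_mul, abs_mul]
    calc _ ≤ C * x.R * (x.dw i * x.dw j) * |ξ i| * |ξ j| := by gcongr; exact h x i j
      _ = _ := by ring
  have h2 : (∑ i, x.dw i * |ξ i|) ^ 2 ≤ (m + k) * ∑ i, (x.dw i * |ξ i|) ^ 2 := by
    have := sq_sum_le_card_mul_sum_sq (s := (Finset.univ : Finset (Fin (m + k)))) (f := fun i => x.dw i * |ξ i|)
    simpa using this
  have h3 : ∑ i, (x.dw i * |ξ i|) ^ 2 = ∑ i, dd γ i x.p ^ 2 * ξ i ^ 2 :=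
    Finset.sum_congr rfl fun i _ => by rw [dd_eq_dw hγ, mul_pow, sq_abs]
  have h4 := (ellip (γ := γ) x.hE x.p ξ).1
  have h5 : ∑ i, dd γ i x.p ^ 2 * ξ i ^ 2 ≤ lam⁻¹ * ∑ i, ∑ j, cA γ x.A i j x.p * ξ i * ξ j := by
    rw [inv_mul_eq_div, le_div_iff₀ hlam]; linarith
  show _ ≤ C * (m + k) * lam⁻¹ * x.R * _
  calc _ ≤ C * x.R * (∑ i, x.dw i * |ξ i|) ^ 2 := h1
    _ ≤ C * x.R * ((m + k) * (lam⁻¹ * ∑ i, ∑ j, cA γ x.A i j x.p * ξ i * ξ j)) := by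
      gcongr
      refine h2.trans ?_
      rw [h3]; gcongr
    _ = _ := by ring

end BG
end

section
open scoped Topology
namespace BG
variable {m k : ℕ}
variable {γ lam Λ : ℝ}

/-- Pointwise geometric estimates with a universal constant. -/
structure Geo (γ C : ℝ) (A : E m k → Matrix (Fin (m + k)) (Fin (m + k)) ℝ) : Prop where
  hDiv : ∀ p : E m k, p.1 ≠ 0 → rho γ p < 1 → |Div (Ff γ A) p - (m + (γ + 1) * k)| ≤ C * rho γ p
  hmu : ∀ p : E m k, p.1 ≠ 0 → rho γ p < 1 →
    |fderiv ℝ (mu γ A) p (Ff γ A p)| ≤ C * rho γ p * mu γ A p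
  hM : ∀ p : E m k, p.1 ≠ 0 → rho γ p < 1 → ∀ ξ : Fin (m + k) → ℝ,
    |∑ i, ∑ j, Mt γ A p i j * ξ i * ξ j| ≤ C * rho γ p * ∑ i, ∑ j, cA γ A i j p * ξ i * ξ j
  hco : ∀ p : E m k, p.1 ≠ 0 → rho γ p < 1 → ∀ j, |co j (Ff γ A p)| ≤ C
  hco1 : ∀ p : E m k, p.1 ≠ 0 → rho γ p < 1 → ∀ j : Fin (m + k), (j : ℕ) < m →
    |co j (Ff γ A p)| ≤ C * ‖p.1‖
  hEr : ∀ p : E m k, p.1 ≠ 0 → rho γ p < 1 → ∀ j : Fin (m + k),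
    |co j (Ff γ A p) - cz γ j * co j p| ≤ C * ‖p.1‖
  hb : ∀ p : E m k, p.1 ≠ 0 → rho γ p < 1 → ∀ i j : Fin (m + k), (i : ℕ) < m → ¬ (j : ℕ) < m →
    |A p i j| ≤ C * ‖p.1‖

lemma geo_exists (hγ : 0 < γ) (hlam : 0 < lam) (hΛ : 0 < Λ) :
    ∃ C : ℝ, 1 ≤ C ∧ ∀ A : E m k → Matrix (Fin (m + k)) (Fin (m + k)) ℝ,
      C1coeff A → Symm A → Elliptic lam A → HypH γ Λ A → Geo γ C A := by
  obtain ⟨C1, h1, k1⟩ := Div_F (m := m) (k := k) hγ hlam hΛ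
  obtain ⟨C2, h2, k2⟩ := F_mu (m := m) (k := k) hγ hlam hΛ
  obtain ⟨C3, h3, k3⟩ := Mt_form (m := m) (k := k) hγ hlam hΛ
  obtain ⟨C4, h4, k4⟩ := F_comp (m := m) (k := k) hγ hlam hΛ
  refine ⟨1 + C1 + C2 + C3 + C4 + Λ, by linarith, fun A hC hS hE hH => ?_⟩
  refine ⟨?_, ?_, ?_, ?_, ?_, ?_, ?_⟩ <;> intro p hp hp1 <;>
    set x : Dat m k γ lam Λ := ⟨A, hC, hS, hE, hH, p, hp, hp1⟩ with hx
  · refine (k1 x).trans ?_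
    have := rho_nonneg γ p
    show C1 * rho γ p ≤ _
    gcongr; linarith
  · refine (k2 x).trans ?_
    have := rho_nonneg γ p
    have := (mu_pos hγ hlam hE hp).le
    show C2 * rho γ p * mu γ A p ≤ _
    gcongr; linarith
  · intro ξ
    refine (k3 x ξ).trans ?_
    have := rho_nonneg γ p
    have h0 : 0 ≤ ∑ i, ∑ j, cA γ A i j p * ξ i * ξ j :=
      le_trans (mul_nonneg hlam.le (Finset.sum_nonneg fun i _ => by positivity)) (ellip hE p ξ).1
    show C3 * rho γ p * ∑ i, ∑ j, cA γ A i j p * ξ i * ξ j ≤ _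
    gcongr; linarith
  · intro j
    refine (k4 x j).1.trans ?_
    have hR := x.R_pos hγ; have hT := x.T_pos hγ; have hR' := x.R_lt; have hT' := x.T_le hγ
    have hP := x.P_pos hγ
    have hP' : x.P ≤ 1 := rpow_le_one hR.le hR'.le hγ.le
    have : x.zw j ≤ 1 := by unfold Dat.zw; split_ifs <;> nlinarith
    have := x.zw_pos hγ j
    nlinarith
  · intro j hj
    refine (k4 x j).1.trans ?_
    have : x.zw j = ‖p.1‖ := by
      unfold Dat.zw; rw [if_pos hj, ← x.Z_eq hγ]
    rw [this]; gcongr; linarith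
  · intro j
    have e := co_Ff hγ hlam hE hp j
    rw [e, add_sub_cancel_left]
    refine (k4 x j).2.1.trans ?_
    have hz := x.Z_eq hγ
    have hR := x.R_pos hγ; have hT := x.T_pos hγ; have hR' := x.R_lt; have hT' := x.T_le hγ
    have hP := x.P_pos hγ; have hS := x.S_pos hγ; have hS' := x.S_le hγ
    have hP' : x.P ≤ 1 := rpow_le_one hR.le hR'.le hγ.le
    have hd : x.dw j ≤ 1 := by unfold Dat.dw; split_ifs <;> nlinarith
    have hd0 := x.dw_pos hγ j
    rw [← hz]
    have : x.dw j * ‖x.p.1‖ * x.R ≤ 1 * ‖x.p.1‖ * 1 := by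
      gcongr
    calc C4 * (x.dw j * ‖x.p.1‖ * x.R) ≤ C4 * ‖p.1‖ := by
          apply mul_le_mul_of_nonneg_left _ h4; simpa using this
      _ ≤ _ := by gcongr; linarith
  · intro i j hi hj
    have hA := (hH p hp1).1 i j
    rw [if_neg (by tauto)] at hA
    have hij : i ≠ j := by rintro rfl; exact hj hi
    have e0 : (A p - 1) i j = A p i j := by
      show A p i j - (1 : Matrix (Fin (m + k)) (Fin (m + k)) ℝ) i j = _
      rw [Matrix.one_apply_ne hij, sub_zero]
    rw [e0] at hA
    have e : psi γ x.p ^ ((1 : ℝ) / 2 + 1 / (2 * γ)) = x.S * x.T := by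
      rw [rpow_add (x.psi_pos hγ), x.psi_half hγ, x.psi_gam hγ]
    have e' : psi γ p ^ ((1 : ℝ) / 2 + 1 / (2 * γ)) = x.S * x.T := e
    rw [e'] at hA
    refine hA.trans ?_
    have hz : ‖p.1‖ = x.T * rho γ p := x.Z_eq hγ
    have hS := x.S_pos hγ; have hS' := x.S_le hγ
    calc Λ * (x.S * x.T) * rho γ p = Λ * x.S * ‖p.1‖ := by rw [hz]; ring
      _ ≤ Λ * 1 * ‖p.1‖ := by gcongr
      _ ≤ _ := by gcongr; linarith

/-! ### Derivations -/

/-- F v as a function -/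
def Fd (γ : ℝ) (A : E m k → Matrix (Fin (m + k)) (Fin (m + k)) ℝ) (v : E m k → ℝ) (p : E m k) : ℝ :=
  fderiv ℝ v p (Ff γ A p)

/-- θ = μ/ρ² -/
def th (γ : ℝ) (A : E m k → Matrix (Fin (m + k)) (Fin (m + k)) ℝ) (p : E m k) : ℝ :=
  mu γ A p / rho γ p ^ 2

/-- homogeneous dimension -/
def QQ (m k : ℕ) (γ : ℝ) : ℝ := m + (γ + 1) * k

/-- ε₂ -/
def e2 (γ : ℝ) (A : E m k → Matrix (Fin (m + k)) (Fin (m + k)) ℝ) (p : E m k) : ℝ :=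
  Div (Ff γ A) p - QQ m k γ

/-- ε₁ -/
def e1 (γ : ℝ) (A : E m k → Matrix (Fin (m + k)) (Fin (m + k)) ℝ) (p : E m k) : ℝ :=
  Fd γ A (mu γ A) p / mu γ A p + e2 γ A p

section
variable {A : E m k → Matrix (Fin (m + k)) (Fin (m + k)) ℝ}

lemma th_pos (hγ : 0 < γ) (hlam : 0 < lam) (hE : Elliptic lam A) {p : E m k} (hp : p.1 ≠ 0) :
    0 < th γ A p :=
  div_pos (mu_pos hγ hlam hE hp) (pow_pos (rho_pos hγ (ne_zero_of_fst hp)) 2)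

lemma Dc_dd_self (i : Fin (m + k)) {p : E m k} (hp : p.1 ≠ 0) : Dc (dd γ i) p i = 0 := by
  unfold dd
  by_cases h : (i : ℕ) < m
  · simp [h, Dc]
  · simp only [h, if_false]
    have fd : DifferentiableAt ℝ (fun q : E m k => ‖q.1‖) p :=
      (contDiffAt_normfst (n := 1) hp).differentiableAt one_ne_zero
    have e := (fd.hasFDerivAt.rpow_const (p := γ) (Or.inl (norm_ne_zero_iff.2 hp))).fderiv
    have := Dc_normfst hp i
    rw [if_neg h, zero_div] at this
    simp only [Dc] at this ⊢
    rw [e]; simp [this]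

lemma Dc_sum {ι : Type*} (s : Finset ι) {f : ι → E m k → ℝ} {p : E m k}
    (hf : ∀ a ∈ s, DifferentiableAt ℝ (f a) p) (i : Fin (m + k)) :
    Dc (fun q => ∑ a ∈ s, f a q) p i = ∑ a ∈ s, Dc (f a) p i := by
  simp only [Dc]
  rw [fderiv_fun_sum hf]; simp

lemma Lop_eq (hC : C1coeff A) {p : E m k} (hp : p.1 ≠ 0) {v : E m k → ℝ}
    (hv : ContDiffAt ℝ 2 v p) : Lop γ A v p = Div (Yv γ A v) p := by
  have fY := (contDiffAt_Yv (γ := γ) hC hp hv).differentiableAt one_ne_zero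
  have fdd : ∀ i, DifferentiableAt ℝ (dd γ i) p := fun i =>
    (contDiffAt_dd (n := 1) γ i hp).differentiableAt one_ne_zero
  have fDc : ∀ j, DifferentiableAt ℝ (fun q => Dc v q j) p := fun j =>
    (contDiffAt_Dc hv j).differentiableAt one_ne_zero
  have fA : ∀ i j, DifferentiableAt ℝ (fun q => A q i j) p := fun i j =>
    ((hC i j).differentiable one_ne_zero) p
  have fcA : ∀ i j, DifferentiableAt ℝ (cA γ A i j) p := fun i j =>
    (contDiffAt_cA hC i j hp).differentiableAt one_ne_zero
  unfold Lop Div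
  refine Finset.sum_congr rfl fun i _ => ?_
  rw [co_fderiv fY]
  simp only [co_Yv]
  change _ = Dc (fun q => ∑ j, cA γ A i j q * Dc v q j) p i
  rw [Dc_sum (f := fun j q => cA γ A i j q * Dc v q j) _ fun j _ => (fcA i j).mul (fDc j)]
  refine Finset.sum_congr rfl fun j _ => ?_
  rw [Xd_eq]
  simp only [Xd_eq]
  have e : (fun q => cA γ A i j q * Dc v q j) = fun q => dd γ i q * (A q i j * (dd γ j q * Dc v q j)) := by
    funext q; rw [cA]; ring
  have f3 : DifferentiableAt ℝ (fun q => A q i j * (dd γ j q * Dc v q j)) p :=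
    (fA i j).mul ((fdd j).mul (fDc j))
  rw [e, Dc_mul (fdd i) f3, Dc_dd_self i hp]
  ring

lemma Yv_rho (hγ : 0 < γ) (hlam : 0 < lam) (hE : Elliptic lam A) {p : E m k} (hp : p.1 ≠ 0) :
    Yv γ A (rho γ) p = (rho γ p * th γ A p) • Ff γ A p := by
  have h1 := mu_pos hγ hlam hE hp
  have h2 := rho_pos hγ (ne_zero_of_fst hp)
  rw [Ff, th, smul_smul]
  have : rho γ p * (mu γ A p / rho γ p ^ 2) * (rho γ p / mu γ A p) = 1 := by field_simp
  rw [this, one_smul]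

lemma rho_Y (hγ : 0 < γ) (hlam : 0 < lam) (hS : Symm A) (hE : Elliptic lam A) {p : E m k}
    (hp : p.1 ≠ 0) (v : E m k → ℝ) :
    fderiv ℝ (rho γ) p (Yv γ A v p) = rho γ p * th γ A p * Fd γ A v p := by
  rw [fderiv_Yv_comm hS, Yv_rho hγ hlam hE hp, map_smul]; rfl

lemma hasFDerivAt_radial (hγ : 0 < γ) {p : E m k} (hp : p.1 ≠ 0) {h : ℝ → ℝ} {h' : ℝ}
    (hh : HasDerivAt h h' (rho γ p)) :
    HasFDerivAt (fun q => h (rho γ q)) (h' • fderiv ℝ (rho γ) p) p :=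
  hh.comp_hasFDerivAt p ((contDiffAt_rho (n := 1) hγ hp).differentiableAt one_ne_zero).hasFDerivAt

lemma Fd_radial (hγ : 0 < γ) (hlam : 0 < lam) (hE : Elliptic lam A) {p : E m k} (hp : p.1 ≠ 0)
    {h : ℝ → ℝ} {h' : ℝ} (hh : HasDerivAt h h' (rho γ p)) :
    Fd γ A (fun q => h (rho γ q)) p = h' * rho γ p := by
  rw [Fd, (hasFDerivAt_radial hγ hp hh).fderiv, _root_.smul_apply, F_rho hγ hlam hE hp]; rfl

lemma radial_Y (hγ : 0 < γ) (hlam : 0 < lam) (hS : Symm A) (hE : Elliptic lam A) {p : E m k}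
    (hp : p.1 ≠ 0) {h : ℝ → ℝ} {h' : ℝ} (hh : HasDerivAt h h' (rho γ p)) (v : E m k → ℝ) :
    fderiv ℝ (fun q => h (rho γ q)) p (Yv γ A v p) = h' * (rho γ p * th γ A p * Fd γ A v p) := by
  rw [(hasFDerivAt_radial hγ hp hh).fderiv, _root_.smul_apply, rho_Y hγ hlam hS hE hp]; rfl

lemma Fd_mul {f g : E m k → ℝ} {p : E m k} (hf : DifferentiableAt ℝ f p)
    (hg : DifferentiableAt ℝ g p) :
    Fd γ A (fun q => f q * g q) p = f p * Fd γ A g p + g p * Fd γ A f p := by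
  simp [Fd, fderiv_fun_mul hf hg]

lemma quadA_nonneg (hlam : 0 < lam) (hE : Elliptic lam A) (v : E m k → ℝ) (p : E m k) :
    0 ≤ quadA γ A v p := by
  rw [quadA_eq]
  exact le_trans (mul_nonneg hlam.le (Finset.sum_nonneg fun i _ => by positivity)) (ellip hE p _).1

/-- Cauchy–Schwarz: θ (Fv)² ≤ q(v). -/
lemma th_Fd_sq (hγ : 0 < γ) (hlam : 0 < lam) (hS : Symm A) (hE : Elliptic lam A) {p : E m k}
    (hp : p.1 ≠ 0) (v : E m k → ℝ) : th γ A p * Fd γ A v p ^ 2 ≤ quadA γ A v p := by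
  have hmu := mu_pos hγ hlam hE hp
  have hr := rho_pos hγ (ne_zero_of_fst hp)
  set t : ℝ := - (rho γ p * th γ A p * Fd γ A v p) / mu γ A p with ht
  have h0 : 0 ≤ ∑ i, ∑ j, cA γ A i j p * (Dc v p i + t * Dc (rho γ) p i) * (Dc v p j + t * Dc (rho γ) p j) :=
    le_trans (mul_nonneg hlam.le (Finset.sum_nonneg fun i _ => by positivity)) (ellip hE p _).1
  have e : ∑ i, ∑ j, cA γ A i j p * (Dc v p i + t * Dc (rho γ) p i) * (Dc v p j + t * Dc (rho γ) p j)
      = quadA γ A v p + t * fderiv ℝ (rho γ) p (Yv γ A v p) + t * fderiv ℝ v p (Yv γ A (rho γ) p)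
        + t ^ 2 * mu γ A p := by
    rw [mu, quadA_eq, quadA_eq, fderiv_Yv, fderiv_Yv]
    simp only [Finset.mul_sum, ← Finset.sum_add_distrib]
    refine Finset.sum_congr rfl fun i _ => Finset.sum_congr rfl fun j _ => by ring
  rw [e, fderiv_Yv_comm hS (rho γ) v, rho_Y hγ hlam hS hE hp] at h0
  have e2 : quadA γ A v p + t * (rho γ p * th γ A p * Fd γ A v p) + t * (rho γ p * th γ A p * Fd γ A v p)
      + t ^ 2 * mu γ A p = quadA γ A v p - th γ A p * Fd γ A v p ^ 2 := by
    rw [ht, th]; field_simp; ring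
  linarith

lemma differentiableAt_th (hγ : 0 < γ) (hC : C1coeff A) {p : E m k} (hp : p.1 ≠ 0) :
    DifferentiableAt ℝ (th γ A) p :=
  ((contDiffAt_mu hγ hC hp).differentiableAt one_ne_zero).mul
    ((((contDiffAt_rho (n := 1) hγ hp).differentiableAt one_ne_zero).pow 2).inv
      (pow_ne_zero _ (rho_pos hγ (ne_zero_of_fst hp)).ne'))

lemma Fd_th (hγ : 0 < γ) (hlam : 0 < lam) (hC : C1coeff A) (hE : Elliptic lam A) {p : E m k}
    (hp : p.1 ≠ 0) :
    Fd γ A (th γ A) p = th γ A p * (e1 γ A p - e2 γ A p - 2) := by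
  have hmu := mu_pos hγ hlam hE hp
  have hr := rho_pos hγ (ne_zero_of_fst hp)
  have e0 : th γ A = fun q => mu γ A q * (fun r : ℝ => (r ^ 2)⁻¹) (rho γ q) := rfl
  have hd : HasDerivAt (fun r : ℝ => (r ^ 2)⁻¹) (-(2 * rho γ p) / (rho γ p ^ 2) ^ 2) (rho γ p) := by
    have := ((hasDerivAt_id (rho γ p)).fun_pow 2).fun_inv (pow_ne_zero 2 hr.ne')
    simpa using this
  rw [e0, Fd_mul ((contDiffAt_mu hγ hC hp).differentiableAt one_ne_zero)
    (hasFDerivAt_radial hγ hp hd).differentiableAt, Fd_radial hγ hlam hE hp hd, e1]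
  field_simp
  ring

/-- divergence of (G(ρ) θ v²) F -/
lemma Div_D2 (hγ : 0 < γ) (hlam : 0 < lam) (hC : C1coeff A) (hE : Elliptic lam A) {p : E m k}
    (hp : p.1 ≠ 0) {G : ℝ → ℝ} {G' : ℝ} (hG : HasDerivAt G G' (rho γ p)) {v : E m k → ℝ}
    (hv : DifferentiableAt ℝ v p) :
    Div (fun q => (G (rho γ q) * (th γ A q * v q ^ 2)) • Ff γ A q) p =
      th γ A p * ((rho γ p * G' + G (rho γ p) * (QQ m k γ - 2 + e1 γ A p)) * v p ^ 2
        + 2 * G (rho γ p) * v p * Fd γ A v p) := by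
  have fG := (hasFDerivAt_radial hγ hp hG).differentiableAt
  have fth := differentiableAt_th (A := A) hγ hC hp
  have fF := (contDiffAt_Ff hγ hlam hC hE hp).differentiableAt one_ne_zero
  have hvv : (fun q => v q ^ 2) = fun q => v q * v q := by funext q; ring
  have f2 : DifferentiableAt ℝ (fun q => th γ A q * v q ^ 2) p := fth.mul (hv.pow 2)
  rw [Div_smul (fG.fun_mul f2) fF]
  change _ + Fd γ A (fun q => G (rho γ q) * (th γ A q * v q ^ 2)) p = _
  rw [Fd_mul fG f2, Fd_mul fth (hv.fun_pow 2), hvv, Fd_mul hv hv, Fd_th hγ hlam hC hE hp,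
    Fd_radial hγ hlam hE hp hG]
  have : Div (Ff γ A) p = QQ m k γ + e2 γ A p := by rw [e2]; ring
  rw [this]; ring

/-- divergence of (G(ρ) V v²) F -/
lemma Div_D3 (hγ : 0 < γ) (hlam : 0 < lam) (hC : C1coeff A) (hE : Elliptic lam A) {p : E m k}
    (hp : p.1 ≠ 0) {G : ℝ → ℝ} {G' : ℝ} (hG : HasDerivAt G G' (rho γ p)) {v V : E m k → ℝ}
    (hv : DifferentiableAt ℝ v p) (hV : DifferentiableAt ℝ V p) :
    Div (fun q => (G (rho γ q) * (V q * v q ^ 2)) • Ff γ A q) p =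
      (rho γ p * G' * V p + G (rho γ p) * Fd γ A V p + G (rho γ p) * V p * (QQ m k γ + e2 γ A p)) * v p ^ 2
        + 2 * G (rho γ p) * V p * v p * Fd γ A v p := by
  have fG := (hasFDerivAt_radial hγ hp hG).differentiableAt
  have fF := (contDiffAt_Ff hγ hlam hC hE hp).differentiableAt one_ne_zero
  have hvv : (fun q => v q ^ 2) = fun q => v q * v q := by funext q; ring
  have f2 : DifferentiableAt ℝ (fun q => V q * v q ^ 2) p := hV.mul (hv.pow 2)
  rw [Div_smul (fG.fun_mul f2) fF]
  change _ + Fd γ A (fun q => G (rho γ q) * (V q * v q ^ 2)) p = _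
  rw [Fd_mul fG f2, Fd_mul hV (hv.fun_pow 2), hvv, Fd_mul hv hv, Fd_radial hγ hlam hE hp hG]
  have : Div (Ff γ A) p = QQ m k γ + e2 γ A p := by rw [e2]; ring
  rw [this]; ring

/-- divergence of (h(ρ) v) Y_v -/
lemma Div_D4 (hγ : 0 < γ) (hlam : 0 < lam) (hC : C1coeff A) (hS : Symm A) (hE : Elliptic lam A) {p : E m k}
    (hp : p.1 ≠ 0) {h : ℝ → ℝ} {h' : ℝ} (hh : HasDerivAt h h' (rho γ p)) {v : E m k → ℝ}
    (hv : ContDiffAt ℝ 2 v p) :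
    Div (fun q => (h (rho γ q) * v q) • Yv γ A v q) p =
      h (rho γ p) * v p * Div (Yv γ A v) p + h (rho γ p) * quadA γ A v p
        + v p * (h' * (rho γ p * th γ A p * Fd γ A v p)) := by
  have fh := (hasFDerivAt_radial hγ hp hh).differentiableAt
  have fv := hv.differentiableAt two_ne_zero
  have fY := (contDiffAt_Yv (γ := γ) hC hp hv).differentiableAt one_ne_zero
  rw [Div_smul (fh.fun_mul fv) fY, fderiv_fun_mul fh fv]
  simp only [_root_.add_apply, _root_.smul_apply, smul_eq_mul]
  rw [fderiv_Yv_self, radial_Y hγ hlam hS hE hp hh]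
  ring

/-- Y of a product -/
lemma Yv_mul (hγ : 0 < γ) (hlam : 0 < lam) (hE : Elliptic lam A) {p : E m k}
    (hp : p.1 ≠ 0) {f : ℝ → ℝ} {f' : ℝ} (hf : HasDerivAt f f' (rho γ p)) {u : E m k → ℝ}
    (hu : DifferentiableAt ℝ u p) :
    Yv γ A (fun q => f (rho γ q) * u q) p = f (rho γ p) • Yv γ A u p
      + (u p * (f' * (rho γ p * th γ A p))) • Ff γ A p := by
  have ff := hasFDerivAt_radial hγ hp hf
  have e : ∀ j, Dc (fun q => f (rho γ q) * u q) p j = f (rho γ p) * Dc u p j + u p * (f' * Dc (rho γ) p j) := by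
    intro j
    rw [Dc_mul ff.differentiableAt hu]
    congr 2
    rw [Dc, ff.fderiv]; rfl
  rw [mul_smul, mul_smul, ← Yv_rho hγ hlam hE hp]
  unfold Yv
  simp only [Finset.smul_sum, ← Finset.sum_add_distrib, smul_smul, ← add_smul]
  refine Finset.sum_congr rfl fun i _ => ?_
  congr 1
  simp only [e, Finset.mul_sum, ← Finset.sum_add_distrib]
  refine Finset.sum_congr rfl fun j _ => by ring

lemma Fd_prod (hγ : 0 < γ) (hlam : 0 < lam) (hE : Elliptic lam A) {p : E m k}
    (hp : p.1 ≠ 0) {f : ℝ → ℝ} {f' : ℝ} (hf : HasDerivAt f f' (rho γ p)) {u : E m k → ℝ}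
    (hu : DifferentiableAt ℝ u p) :
    Fd γ A (fun q => f (rho γ q) * u q) p = f (rho γ p) * Fd γ A u p + u p * (f' * rho γ p) := by
  rw [Fd_mul (hasFDerivAt_radial hγ hp hf).differentiableAt hu, Fd_radial hγ hlam hE hp hf]

/-- 𝓛 of a product -/
lemma Div_Yv_mul (hγ : 0 < γ) (hlam : 0 < lam) (hC : C1coeff A) (hS : Symm A) (hE : Elliptic lam A)
    {p : E m k} (hp : p.1 ≠ 0) {f f' : ℝ → ℝ} {f'' : ℝ}
    (hf : ∀ s, 0 < s → HasDerivAt f (f' s) s)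
    (hf' : HasDerivAt f' f'' (rho γ p)) {u : E m k → ℝ} (hu : ContDiffAt ℝ 2 u p) :
    Div (Yv γ A (fun q => f (rho γ q) * u q)) p = f (rho γ p) * Div (Yv γ A u) p
      + 2 * f' (rho γ p) * rho γ p * th γ A p * Fd γ A u p
      + u p * th γ A p * (rho γ p ^ 2 * f'' + rho γ p * f' (rho γ p) * (QQ m k γ - 1 + e1 γ A p)) := by
  have hr := rho_pos hγ (ne_zero_of_fst hp)
  have fu := hu.differentiableAt two_ne_zero
  have e : Yv γ A (fun q => f (rho γ q) * u q) =ᶠ[𝓝 p] fun q => f (rho γ q) • Yv γ A u q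
      + ((fun s => f' s * s) (rho γ q) * (th γ A q * u q)) • Ff γ A q := by
    have h1 : ∀ᶠ q in 𝓝 p, DifferentiableAt ℝ u q :=
      (hu.eventually (by simp)).mono fun q hq => hq.differentiableAt two_ne_zero
    filter_upwards [eventually_fst_ne hp, h1] with q hq hq1
    rw [Yv_mul hγ hlam hE hq (hf _ (rho_pos hγ (ne_zero_of_fst hq))) hq1]
    congr 2; ring
  have fF := (contDiffAt_Ff hγ hlam hC hE hp).differentiableAt one_ne_zero
  have fY := (contDiffAt_Yv (γ := γ) hC hp hu).differentiableAt one_ne_zero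
  have hfp := hf _ hr
  have ff := (hasFDerivAt_radial hγ hp hfp).differentiableAt
  have hG : HasDerivAt (fun s => f' s * s) (f'' * rho γ p + f' (rho γ p)) (rho γ p) := by
    have := hf'.fun_mul (hasDerivAt_id (rho γ p)); simpa using this
  have fG := (hasFDerivAt_radial hγ hp hG).differentiableAt
  have fth := differentiableAt_th (A := A) hγ hC hp
  have f2 : DifferentiableAt ℝ (fun q => th γ A q * u q) p := fth.mul fu
  rw [Div_congr e, Div_add (ff.fun_smul fY) ((fG.fun_mul f2).fun_smul fF), Div_smul ff fY, Div_smul (fG.fun_mul f2) fF,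
    radial_Y hγ hlam hS hE hp hfp]
  change _ + (_ + Fd γ A (fun q => (fun s => f' s * s) (rho γ q) * (th γ A q * u q)) p) = _
  rw [Fd_mul fG f2, Fd_mul fth fu, Fd_radial hγ hlam hE hp hG, Fd_th hγ hlam hC hE hp]
  have : Div (Ff γ A) p = QQ m k γ + e2 γ A p := by rw [e2]; ring
  rw [this]; ring

end
end BG
end

section
open scoped Topology
namespace BG
variable {m k : ℕ}
variable {γ lam Λ : ℝ}
section
variable {A : E m k → Matrix (Fin (m + k)) (Fin (m + k)) ℝ}

lemma contDiffAt_Fd (hγ : 0 < γ) (hlam : 0 < lam) (hC : C1coeff A) (hE : Elliptic lam A)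
    {p : E m k} (hp : p.1 ≠ 0) {v : E m k → ℝ} (hv : ContDiffAt ℝ 2 v p) :
    ContDiffAt ℝ 1 (Fd γ A v) p :=
  (hv.fderiv_right (m := 1) (by norm_num)).clm_apply (contDiffAt_Ff hγ hlam hC hE hp)

/-- The quadratic form T. -/
def Tq (γ : ℝ) (A : E m k → Matrix (Fin (m + k)) (Fin (m + k)) ℝ) (v : E m k → ℝ) (p : E m k) : ℝ :=
  ∑ i, ∑ j, Mt γ A p i j * Dc v p i * Dc v p j

/-- Second derivatives. -/
def Hs (v : E m k → ℝ) (p : E m k) (i j : Fin (m + k)) : ℝ := fderiv ℝ (fderiv ℝ v) p (bas i) (bas j)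

lemma Dc_Dc {v : E m k → ℝ} {p : E m k} (hv : ContDiffAt ℝ 2 v p) (j : Fin (m + k)) (w : E m k) :
    fderiv ℝ (fun q => Dc v q j) p w = ∑ l, co l w * Hs v p l j := by
  have h1 : DifferentiableAt ℝ (fderiv ℝ v) p :=
    (hv.fderiv_right (m := 1) (by norm_num)).differentiableAt one_ne_zero
  have h2 : HasFDerivAt (fun q => Dc v q j) ((fderiv ℝ (fderiv ℝ v) p).flip (bas j)) p := by
    have := h1.hasFDerivAt.clm_apply (hasFDerivAt_const (bas j : E m k) p)
    refine this.congr_fderiv ?_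
    ext <;> simp
  rw [h2.fderiv, clm_eq_sum]; rfl

lemma Hs_symm {v : E m k → ℝ} {p : E m k} (hv : ContDiffAt ℝ 2 v p) (i j : Fin (m + k)) :
    Hs v p i j = Hs v p j i :=
  (hv.isSymmSndFDerivAt (by simp)).eq _ _

lemma Rellich_core (hγ : 0 < γ) (hlam : 0 < lam) (hC : C1coeff A) (hS : Symm A) (hE : Elliptic lam A)
    {p : E m k} (hp : p.1 ≠ 0) {v : E m k → ℝ} (hv : ContDiffAt ℝ 2 v p) :
    2 * fderiv ℝ (Fd γ A v) p (Yv γ A v p) - fderiv ℝ (quadA γ A v) p (Ff γ A p)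
      = 2 * quadA γ A v p - 2 * Tq γ A v p := by
  have fF := (contDiffAt_Ff hγ hlam hC hE hp).differentiableAt one_ne_zero
  have fco : ∀ j, DifferentiableAt ℝ (fun q => co j (Ff γ A q)) p := fun j =>
    (co j).differentiableAt.comp p fF
  have fDc : ∀ j, DifferentiableAt ℝ (fun q => Dc v q j) p := fun j =>
    (contDiffAt_Dc hv j).differentiableAt one_ne_zero
  have fcA : ∀ i j, DifferentiableAt ℝ (cA γ A i j) p := fun i j =>
    (contDiffAt_cA hC i j hp).differentiableAt one_ne_zero
  have e1 : Fd γ A v = fun q => ∑ j, co j (Ff γ A q) * Dc v q j := by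
    funext q; exact fderiv_eq_sum v q _
  have e2 : quadA γ A v = fun q => ∑ i, ∑ j, cA γ A i j q * Dc v q i * Dc v q j :=
    funext (quadA_eq γ A v)
  have d1 : fderiv ℝ (Fd γ A v) p (Yv γ A v p) =
      ∑ i, ∑ j, (∑ l, cA γ A i l p * Dc (fun q => co j (Ff γ A q)) p l) * Dc v p i * Dc v p j
      + ∑ j, ∑ l, co j (Ff γ A p) * co l (Yv γ A v p) * Hs v p l j := by
    rw [e1, fderiv_fun_sum fun j _ => (fco j).fun_mul (fDc j)]
    rw [_root_.sum_apply]
    have : ∀ j, (fderiv ℝ (fun q => co j (Ff γ A q) * Dc v q j) p) (Yv γ A v p) =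
        (∑ i, (∑ l, cA γ A i l p * Dc (fun q => co j (Ff γ A q)) p l) * Dc v p i * Dc v p j)
        + ∑ l, co j (Ff γ A p) * co l (Yv γ A v p) * Hs v p l j := by
      intro j
      rw [fderiv_fun_mul (fco j) (fDc j)]
      simp only [_root_.add_apply, _root_.smul_apply, smul_eq_mul]
      rw [Dc_Dc hv, fderiv_eq_sum _ p (Yv γ A v p)]
      rw [add_comm]
      congr 1
      · simp only [co_Yv, Finset.mul_sum, Finset.sum_mul]
        rw [Finset.sum_comm]
        refine Finset.sum_congr rfl fun i _ => Finset.sum_congr rfl fun l _ => ?_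
        rw [cA_symm hS l i]; ring
      · rw [Finset.mul_sum]
        exact Finset.sum_congr rfl fun l _ => by ring
    simp only [this, Finset.sum_add_distrib]
    congr 1
    rw [Finset.sum_comm]
  have d2 : fderiv ℝ (quadA γ A v) p (Ff γ A p) =
      ∑ i, ∑ j, fderiv ℝ (cA γ A i j) p (Ff γ A p) * Dc v p i * Dc v p j
      + 2 * ∑ j, ∑ l, co j (Ff γ A p) * co l (Yv γ A v p) * Hs v p l j := by
    have f3 : ∀ i j, DifferentiableAt ℝ (fun q => cA γ A i j q * Dc v q i * Dc v q j) p :=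
      fun i j => ((fcA i j).fun_mul (fDc i)).fun_mul (fDc j)
    rw [e2, fderiv_fun_sum fun i _ => DifferentiableAt.fun_sum fun j _ => f3 i j]
    rw [_root_.sum_apply]
    have : ∀ i j, (fderiv ℝ (fun q => cA γ A i j q * Dc v q i * Dc v q j) p) (Ff γ A p) =
        fderiv ℝ (cA γ A i j) p (Ff γ A p) * Dc v p i * Dc v p j
        + (∑ l, co l (Ff γ A p) * (cA γ A i j p * Dc v p j) * Hs v p l i
          + ∑ l, co l (Ff γ A p) * (cA γ A i j p * Dc v p i) * Hs v p l j) := by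
      intro i j
      rw [fderiv_fun_mul ((fcA i j).fun_mul (fDc i)) (fDc j), fderiv_fun_mul (fcA i j) (fDc i)]
      simp only [_root_.add_apply, _root_.smul_apply, smul_eq_mul]
      rw [Dc_Dc hv, Dc_Dc hv]
      have a1 : ∀ (c : ℝ) (i : Fin (m + k)), ∑ l, co l (Ff γ A p) * c * Hs v p l i
          = c * ∑ l, co l (Ff γ A p) * Hs v p l i := by
        intro c i; rw [Finset.mul_sum]; exact Finset.sum_congr rfl fun l _ => by ring
      rw [a1, a1]; ring
    have h4 : ∀ i, (fderiv ℝ (fun q => ∑ j, cA γ A i j q * Dc v q i * Dc v q j) p) (Ff γ A p) =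
        ∑ j, (fderiv ℝ (cA γ A i j) p (Ff γ A p) * Dc v p i * Dc v p j
        + (∑ l, co l (Ff γ A p) * (cA γ A i j p * Dc v p j) * Hs v p l i
          + ∑ l, co l (Ff γ A p) * (cA γ A i j p * Dc v p i) * Hs v p l j)) := by
      intro i
      rw [fderiv_fun_sum fun j _ => f3 i j, _root_.sum_apply]
      exact Finset.sum_congr rfl fun j _ => this i j
    simp only [h4, Finset.sum_add_distrib]
    congr 1
    have b1 : ∑ i, ∑ j, ∑ l, co l (Ff γ A p) * (cA γ A i j p * Dc v p j) * Hs v p l i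
        = ∑ j, ∑ l, co j (Ff γ A p) * co l (Yv γ A v p) * Hs v p l j := by
      simp only [co_Yv, Finset.mul_sum, Finset.sum_mul]
      rw [Finset.sum_congr rfl fun i _ => Finset.sum_comm, Finset.sum_comm]
      refine Finset.sum_congr rfl fun l _ => Finset.sum_congr rfl fun i _ =>
        Finset.sum_congr rfl fun j _ => ?_
      rw [Hs_symm hv l i]
    have b2 : ∑ i, ∑ j, ∑ l, co l (Ff γ A p) * (cA γ A i j p * Dc v p i) * Hs v p l j
        = ∑ i, ∑ j, ∑ l, co l (Ff γ A p) * (cA γ A i j p * Dc v p j) * Hs v p l i := by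
      rw [Finset.sum_comm]
      refine Finset.sum_congr rfl fun j _ => Finset.sum_congr rfl fun i _ =>
        Finset.sum_congr rfl fun l _ => ?_
      rw [cA_symm hS i j]
    rw [b2, b1]; ring
  rw [d1, d2, Tq, quadA_eq]
  have : ∀ i j, Mt γ A p i j * Dc v p i * Dc v p j =
      1 / 2 * (fderiv ℝ (cA γ A i j) p (Ff γ A p) * Dc v p i * Dc v p j)
      - (∑ l, cA γ A i l p * Dc (fun q => co j (Ff γ A q)) p l) * Dc v p i * Dc v p j
      + cA γ A i j p * Dc v p i * Dc v p j := by
    intro i j; rw [Mt]; ring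
  simp only [this, Finset.sum_add_distrib, Finset.sum_sub_distrib, ← Finset.mul_sum]
  ring

/-- Rellich identity -/
lemma Div_D1 (hγ : 0 < γ) (hlam : 0 < lam) (hC : C1coeff A) (hS : Symm A) (hE : Elliptic lam A)
    {p : E m k} (hp : p.1 ≠ 0) {η : ℝ → ℝ} {η' : ℝ} (hη : HasDerivAt η η' (rho γ p))
    {v : E m k → ℝ} (hv : ContDiffAt ℝ 2 v p) :
    Div (fun q => (2 * (η (rho γ q) * Fd γ A v q)) • Yv γ A v q
        - (η (rho γ q) * quadA γ A v q) • Ff γ A q) p =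
      2 * η (rho γ p) * Fd γ A v p * Div (Yv γ A v) p
      - (rho γ p * η' + η (rho γ p) * (QQ m k γ - 2 + e2 γ A p)) * quadA γ A v p
      + 2 * η' * rho γ p * th γ A p * Fd γ A v p ^ 2 - 2 * η (rho γ p) * Tq γ A v p := by
  have fη := (hasFDerivAt_radial hγ hp hη).differentiableAt
  have fF := (contDiffAt_Ff hγ hlam hC hE hp).differentiableAt one_ne_zero
  have fX := (contDiffAt_Fd hγ hlam hC hE hp hv).differentiableAt one_ne_zero
  have fY := (contDiffAt_Yv (γ := γ) hC hp hv).differentiableAt one_ne_zero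
  have fq := (contDiffAt_quadA (γ := γ) hC hp hv).differentiableAt one_ne_zero
  have f1 := (fη.fun_mul fX)
  rw [Div_sub ((f1.const_mul 2).fun_smul fY) ((fη.fun_mul fq).fun_smul fF),
    Div_smul (f1.const_mul 2) fY, Div_smul (fη.fun_mul fq) fF]
  rw [fderiv_const_mul f1, fderiv_fun_mul fη fX, fderiv_fun_mul fη fq]
  simp only [_root_.add_apply, _root_.smul_apply, smul_eq_mul]
  rw [radial_Y hγ hlam hS hE hp hη]
  have h1 := Fd_radial (A := A) hγ hlam hE hp hη
  have h2 := Rellich_core hγ hlam hC hS hE hp hv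
  have h3 : Div (Ff γ A) p = QQ m k γ + e2 γ A p := by rw [e2]; ring
  rw [Fd] at h1
  rw [h1, h3]
  linear_combination η (rho γ p) * h2

lemma Tq_bound {C : ℝ} (hG : Geo γ C A) {p : E m k} (hp : p.1 ≠ 0) (hp1 : rho γ p < 1)
    (v : E m k → ℝ) : |Tq γ A v p| ≤ C * rho γ p * quadA γ A v p := by
  rw [quadA_eq]; exact hG.hM p hp hp1 _

lemma e2_bound {C : ℝ} (hG : Geo γ C A) {p : E m k} (hp : p.1 ≠ 0) (hp1 : rho γ p < 1) :
    |e2 γ A p| ≤ C * rho γ p := hG.hDiv p hp hp1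

lemma e1_bound {C : ℝ} (hγ : 0 < γ) (hlam : 0 < lam) (hE : Elliptic lam A) (hG : Geo γ C A)
    {p : E m k} (hp : p.1 ≠ 0) (hp1 : rho γ p < 1) :
    |e1 γ A p| ≤ 2 * C * rho γ p := by
  have h1 := e2_bound hG hp hp1
  have h2 := hG.hmu p hp hp1
  have h3 := mu_pos hγ hlam hE hp
  have h4 : |Fd γ A (mu γ A) p / mu γ A p| ≤ C * rho γ p := by
    rw [abs_div, abs_of_pos h3, div_le_iff₀ h3]; exact h2
  have := abs_add_le (Fd γ A (mu γ A) p / mu γ A p) (e2 γ A p)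
  rw [e1]; linarith

end
end BG
end

section
open scoped Topology
namespace BG
variable {m k : ℕ}
variable {γ lam Λ : ℝ}

set_option maxHeartbeats 2000000 in
/-- The scalar core of the Carleman estimate. -/
lemma scal {ρ α C Q K g κ ε₁ ε₂ X q T ℓ v V W : ℝ} (hρ : 0 < ρ) (hρ1 : ρ ≤ 1) (hC : 1 ≤ C)
    (hL : 10 * C * ρ ≤ 1 / 10) (hQ : 2 ≤ Q) (hK : 0 ≤ K)
    (hg : g = α * (1 - 10 * C * ρ)) (hκ : κ = g ^ 2 - α * (10 * C) * ρ + (Q - 2) * g)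
    (h1 : |ε₁| ≤ 2 * C * ρ) (h2 : |ε₂| ≤ C * ρ) (hq : 0 ≤ q) (hT : |T| ≤ C * ρ * q)
    (hV : |V| ≤ K) (hW : |W| ≤ K)
    (a1 : 10 * (Q + 1) ≤ α) (a2 : 10 * C ≤ α) (a3 : (86 * C) ^ 2 ≤ α)
    (a4 : 60 * C * K ≤ α ^ 2) :
    4 * g * X * ℓ + 2 * α * (10 * C) * ρ * q - 2 * g * ε₂ * q
      - 4 * (α * (10 * C) * ρ + (Q - 2) * g) * X ^ 2 - 4 * g * T
      + (2 * (-(α * (10 * C) * ρ) * (3 * g ^ 2 + g - α * (10 * C) * ρ + 2 * (Q - 2) * g)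
          + g * κ * ε₁) * v ^ 2 + 4 * g * κ * v * X)
      + (2 * ρ ^ 2 * (-(α * (10 * C) * ρ) * V + g * W + g * V * (2 + ε₂)) * v ^ 2
          + 4 * g * ρ ^ 2 * V * v * X)
      - 2 * α * (13 * C) * ρ * (v * ℓ + q + (3 - Q) * v * X)
    ≤ 3 / 2 * (ℓ + 2 * g * X + v * (κ + g * ε₁) + ρ ^ 2 * V * v) ^ 2 - α ^ 3 * ρ * v ^ 2 := by
  have hα : 0 < α := by linarith
  have hg1 : g ≤ α := by rw [hg]; linarith [mul_pos hα (mul_pos (by linarith : 0 < C) hρ)]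
  have hg2 : 9 / 10 * α ≤ g := by rw [hg]; linarith [mul_le_mul_of_nonneg_left hL hα.le]
  have hg0 : 0 < g := by linarith
  obtain ⟨h1a, h1b⟩ := abs_le.1 h1
  obtain ⟨h2a, h2b⟩ := abs_le.1 h2
  obtain ⟨hTa, hTb⟩ := abs_le.1 hT
  obtain ⟨hVa, hVb⟩ := abs_le.1 hV
  obtain ⟨hWa, hWb⟩ := abs_le.1 hW
  have hCρ : 0 < C * ρ := by positivity
  set P := ℓ + 2 * g * X + v * (κ + g * ε₁) + ρ ^ 2 * V * v with hP
  have hℓ : ℓ = P - 2 * g * X - v * (κ + g * ε₁) - ρ ^ 2 * V * v := by rw [hP]; ring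
  -- q terms
  have t1 : 2 * α * (10 * C) * ρ * q - 2 * g * ε₂ * q - 4 * g * T - 2 * α * (13 * C) * ρ * q ≤ 0 := by
    have i1 : -(g * ε₂ * q) ≤ α * (C * ρ) * q := by
      have j1 : g * -ε₂ ≤ g * (C * ρ) := by gcongr; linarith
      have j2 : g * (C * ρ) ≤ α * (C * ρ) := by gcongr
      have := mul_le_mul_of_nonneg_right (j1.trans j2) hq
      linarith
    have i2 : -(g * T) ≤ α * (C * ρ * q) := by
      have j0 : 0 ≤ C * ρ * q := by positivity
      have j1 : g * -T ≤ g * (C * ρ * q) := by gcongr; linarith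
      have j2 : g * (C * ρ * q) ≤ α * (C * ρ * q) := by gcongr
      linarith
    linarith
  have t2 : 0 ≤ 4 * (α * (10 * C) * ρ + (Q - 2) * g) * X ^ 2 := by
    have : 0 ≤ (Q - 2) * g := mul_nonneg (by linarith) hg0.le
    positivity
  -- kappa bound
  have hgg : g ^ 2 ≤ α ^ 2 := pow_le_pow_left₀ hg0.le hg1 2
  have hκ1 : κ ≤ 12 / 10 * α ^ 2 := by
    have i1 : (Q - 2) * g ≤ (α / 10) * α := mul_le_mul (by linarith) hg1 hg0.le (by linarith)
    have i2 : 0 ≤ α * (10 * C) * ρ := by positivity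
    rw [hκ]; linarith [sq_nonneg α]
  have hκ2 : 0 ≤ κ := by
    rw [hκ]
    have i1 : 0 ≤ (Q - 2) * g := mul_nonneg (by linarith) hg0.le
    have i2 : α * (10 * C * ρ) ≤ α * (1 / 10) := by gcongr
    have i3 : (9 / 10 * α) ^ 2 ≤ g ^ 2 := pow_le_pow_left₀ (by positivity) hg2 2
    have i4 : α * 1 ≤ α * α := by gcongr; linarith
    linarith
  -- vX terms
  have hα3 : 1 ≤ α := by linarith
  have t3 : |-(4 * g ^ 2 * ε₁) + 2 * α * (13 * C) * ρ * (2 * g - (3 - Q))| ≤ 86 * C * ρ * α ^ 2 := by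
    have i1 : |g ^ 2 * ε₁| ≤ α ^ 2 * (2 * C * ρ) := by
      rw [abs_mul, abs_of_nonneg (sq_nonneg g)]
      gcongr
    obtain ⟨i1a, i1b⟩ := abs_le.1 i1
    have i2 : 2 * g - (3 - Q) ≤ 3 * α := by linarith
    have i3 : 0 ≤ 2 * g - (3 - Q) := by linarith
    have i4 : 2 * α * (13 * C) * ρ * (2 * g - (3 - Q)) ≤ 2 * α * (13 * C) * ρ * (3 * α) := by gcongr
    have i5 : 0 ≤ 2 * α * (13 * C) * ρ * (2 * g - (3 - Q)) := by positivity
    rw [abs_le]; constructor <;> linarith [mul_pos (pow_pos hα 2) hCρ]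
  have t4 : (-(4 * g ^ 2 * ε₁) + 2 * α * (13 * C) * ρ * (2 * g - (3 - Q))) * (v * X)
      ≤ 4 * g ^ 2 * X ^ 2 + α ^ 3 * ρ * v ^ 2 := by
    set c := -(4 * g ^ 2 * ε₁) + 2 * α * (13 * C) * ρ * (2 * g - (3 - Q)) with hc
    have i0 : c ^ 2 ≤ (86 * C * ρ * α ^ 2) ^ 2 := by
      rw [← sq_abs c]; gcongr
    have i1 : c * (v * X) ≤ 4 * g ^ 2 * X ^ 2 + c ^ 2 * v ^ 2 / (16 * g ^ 2) := by
      have : 4 * g ^ 2 * X ^ 2 + c ^ 2 * v ^ 2 / (16 * g ^ 2) - c * (v * X)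
          = (2 * g * X - c * v / (4 * g)) ^ 2 := by field_simp; ring
      linarith [sq_nonneg (2 * g * X - c * v / (4 * g))]
    have i2 : c ^ 2 / (16 * g ^ 2) ≤ α ^ 3 * ρ := by
      rw [div_le_iff₀ (by positivity)]
      have j1 : α ^ 2 ≤ 16 * g ^ 2 := by
        have := pow_le_pow_left₀ (by positivity) hg2 2
        linarith [sq_nonneg α]
      calc c ^ 2 ≤ (86 * C * ρ * α ^ 2) ^ 2 := i0
        _ = (86 * C) ^ 2 * (ρ * ρ) * α ^ 4 := by ring
        _ ≤ α * (ρ * 1) * α ^ 4 := by gcongr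
        _ = α ^ 3 * ρ * α ^ 2 := by ring
        _ ≤ α ^ 3 * ρ * (16 * g ^ 2) := by gcongr
    calc _ ≤ _ := i1
      _ = 4 * g ^ 2 * X ^ 2 + c ^ 2 / (16 * g ^ 2) * v ^ 2 := by ring
      _ ≤ _ := by gcongr
  have t5 : -(2 * α * (13 * C) * ρ * v * P) ≤ 1 / 2 * P ^ 2 + α ^ 3 * ρ * v ^ 2 := by
    have i1 : 1 / 2 * (2 * α * (13 * C) * ρ) ^ 2 ≤ α ^ 3 * ρ := by
      calc 1 / 2 * (2 * α * (13 * C) * ρ) ^ 2 = 338 * C ^ 2 * α ^ 2 * (ρ * ρ) := by ring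
        _ ≤ α * α ^ 2 * (ρ * 1) := by gcongr; linarith [sq_nonneg C]
        _ = _ := by ring
    have i2 : 1 / 2 * (2 * α * (13 * C) * ρ) ^ 2 * v ^ 2 ≤ α ^ 3 * ρ * v ^ 2 := by gcongr
    linarith [sq_nonneg (P + 2 * α * (13 * C) * ρ * v)]
  have t6 : 2 * g * κ * ε₁ ≤ 48 / 10 * C * α ^ 3 * ρ := by
    calc 2 * g * κ * ε₁ ≤ 2 * g * κ * (2 * C * ρ) := by gcongr
      _ ≤ 2 * α * (12 / 10 * α ^ 2) * (2 * C * ρ) := by gcongr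
      _ = _ := by ring
  have t7 : 2 * α * (13 * C) * ρ * (κ + g * ε₁) ≤ 28 / 10 * (13 * C) * α ^ 3 * ρ := by
    have i1 : κ + g * ε₁ ≤ 14 / 10 * α ^ 2 := by
      have : g * ε₁ ≤ α * (2 * C * ρ) := by
        calc g * ε₁ ≤ g * (2 * C * ρ) := by gcongr
          _ ≤ _ := by gcongr
      have j3 : α * (C * ρ) ≤ α * (1 / 100) := by gcongr; linarith
      have j4 : α * 1 ≤ α * α := by gcongr
      linarith
    calc _ ≤ 2 * α * (13 * C) * ρ * (14 / 10 * α ^ 2) := by gcongr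
      _ = _ := by ring
  have t8 : 2 * (-(α * (10 * C) * ρ) * (3 * g ^ 2 + g - α * (10 * C) * ρ + 2 * (Q - 2) * g))
      ≤ -(48 * C * α ^ 3 * ρ) := by
    have i0 : 0 ≤ (Q - 2) * g := mul_nonneg (by linarith) hg0.le
    have i1 : 24 / 10 * α ^ 2 ≤ 3 * g ^ 2 + g - α * (10 * C) * ρ + 2 * (Q - 2) * g := by
      have j3 : α * (C * ρ) ≤ α * (1 / 100) := by gcongr; linarith
      have := pow_le_pow_left₀ (by positivity) hg2 2
      linarith
    have : α * (10 * C) * ρ * (24 / 10 * α ^ 2) ≤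
      α * (10 * C) * ρ * (3 * g ^ 2 + g - α * (10 * C) * ρ + 2 * (Q - 2) * g) := by gcongr
    linarith
  have t9 : 2 * ρ ^ 2 * (-(α * (10 * C) * ρ) * V + g * W + g * V * (2 + ε₂))
      + 2 * α * (13 * C) * ρ * (ρ ^ 2 * V) ≤ α ^ 3 * ρ := by
    have i1 : -(α * (10 * C) * ρ) * V ≤ α * (10 * C) * K := by
      have j1 : ρ * -V ≤ ρ * K := by gcongr; linarith
      have j2 : ρ * K ≤ 1 * K := by gcongr
      have h := mul_le_mul_of_nonneg_left (j1.trans j2) (by positivity : 0 ≤ α * (10 * C))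
      linarith
    have i2 : g * W ≤ α * K := by
      calc g * W ≤ g * K := by gcongr
        _ ≤ _ := by gcongr
    have hab : 2 + ε₂ ≤ 3 * C := by linarith
    have hab0 : 0 ≤ 2 + ε₂ := by linarith
    have i3 : g * V * (2 + ε₂) ≤ α * K * (3 * C) := by
      calc g * V * (2 + ε₂) ≤ g * K * (2 + ε₂) := by gcongr
        _ ≤ _ := by gcongr
    have i4 : α * (13 * C) * ρ * V ≤ α * (13 * C) * 1 * K := by
      calc _ ≤ α * (13 * C) * ρ * K := by gcongr
        _ ≤ _ := by gcongr
    have i5 : -(α * (10 * C) * ρ) * V + g * W + g * V * (2 + ε₂) + α * (13 * C) * ρ * V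
        ≤ 1 / 2 * α ^ 3 := by
      have : α * K ≤ α * K * C := by
        have := mul_le_mul_of_nonneg_left hC (by positivity : 0 ≤ α * K)
        linarith
      have := mul_le_mul_of_nonneg_left a4 hα.le
      linarith
    have i6 : ρ ^ 2 ≤ ρ := by
      have := mul_le_mul_of_nonneg_left hρ1 hρ.le
      linarith
    calc _ = ρ ^ 2 * (2 * (-(α * (10 * C) * ρ) * V + g * W + g * V * (2 + ε₂) + α * (13 * C) * ρ * V)) := by ring
      _ ≤ ρ ^ 2 * α ^ 3 := by gcongr; linarith
      _ ≤ ρ * α ^ 3 := by gcongr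
      _ = _ := by ring
  have t10 : 4 * g * X * P ≤ P ^ 2 + 4 * g ^ 2 * X ^ 2 := by linarith [sq_nonneg (P - 2 * g * X)]
  have t11 : 2 * (-(α * (10 * C) * ρ) * (3 * g ^ 2 + g - α * (10 * C) * ρ + 2 * (Q - 2) * g))
      + 2 * g * κ * ε₁ + 2 * α * (13 * C) * ρ * (κ + g * ε₁)
      + (2 * ρ ^ 2 * (-(α * (10 * C) * ρ) * V + g * W + g * V * (2 + ε₂))
        + 2 * α * (13 * C) * ρ * (ρ ^ 2 * V)) ≤ - 3 * (α ^ 3 * ρ) := by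
    have : α ^ 3 * ρ ≤ C * α ^ 3 * ρ := by
      have := mul_le_mul_of_nonneg_left hC (by positivity : 0 ≤ α ^ 3 * ρ)
      linarith
    have : 0 < α ^ 3 * ρ := by positivity
    linarith
  have t12 := mul_le_mul_of_nonneg_right t11 (sq_nonneg v)
  rw [hℓ]
  linarith
end BG
end

section
open scoped Topology
namespace BG
variable {m k : ℕ}
variable {γ lam Λ : ℝ}

/-- ω -/
def om (Q s : ℝ) : ℝ := s ^ (2 - Q)
/-- g -/
def gg (C α s : ℝ) : ℝ := α * (1 - 10 * C * s)
/-- κ -/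
def kap (C α Q s : ℝ) : ℝ := gg C α s ^ 2 - α * (10 * C) * s + (Q - 2) * gg C α s
/-- twice g ω -/
def et (C α Q s : ℝ) : ℝ := 2 * (gg C α s * om Q s)
/-- twice g κ ω -/
def Gt (C α Q s : ℝ) : ℝ := 2 * (gg C α s * kap C α Q s * om Q s)
/-- h -/
def ht (C α Q s : ℝ) : ℝ := 26 * α * C * (s * om Q s)

lemma om_pos {Q s : ℝ} (hs : 0 < s) : 0 < om Q s := rpow_pos_of_pos hs _

lemma hd_om {Q s : ℝ} (hs : 0 < s) : HasDerivAt (om Q) ((2 - Q) * om Q s / s) s := by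
  have := hasDerivAt_rpow_const (x := s) (p := 2 - Q) (Or.inl hs.ne')
  refine HasDerivAt.congr_deriv (f := om Q) this ?_
  rw [om, rpow_sub_one hs.ne', mul_div_assoc]

lemma hd_gg {C α s : ℝ} : HasDerivAt (gg C α) (-(α * (10 * C))) s := by
  have := (((hasDerivAt_id s).const_mul (10 * C)).const_sub 1).const_mul α
  refine HasDerivAt.congr_deriv (f := gg C α) this ?_; ring

lemma hd_kap {C α Q s : ℝ} : HasDerivAt (kap C α Q)
    (2 * gg C α s * (-(α * (10 * C))) - α * (10 * C) + (Q - 2) * (-(α * (10 * C)))) s := by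
  have h := hd_gg (C := C) (α := α) (s := s)
  have := ((h.fun_pow 2).fun_sub ((hasDerivAt_id s).const_mul (α * (10 * C)))).fun_add (h.const_mul (Q - 2))
  refine HasDerivAt.congr_deriv (f := kap C α Q) this ?_; simp

lemma hd_et {C α Q s : ℝ} (hs : 0 < s) : HasDerivAt (et C α Q)
    (2 * (-(α * (10 * C)) * om Q s + gg C α s * ((2 - Q) * om Q s / s))) s :=
  (hd_gg.fun_mul (hd_om hs)).const_mul 2

lemma hd_Gt {C α Q s : ℝ} (hs : 0 < s) : HasDerivAt (Gt C α Q)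
    (2 * ((-(α * (10 * C)) * kap C α Q s + gg C α s *
      (2 * gg C α s * (-(α * (10 * C))) - α * (10 * C) + (Q - 2) * (-(α * (10 * C))))) * om Q s
      + gg C α s * kap C α Q s * ((2 - Q) * om Q s / s))) s :=
  ((hd_gg.fun_mul hd_kap).fun_mul (hd_om hs)).const_mul 2

lemma hd_ht {C α Q s : ℝ} (hs : 0 < s) : HasDerivAt (ht C α Q)
    (26 * α * C * ((3 - Q) * om Q s)) s := by
  have := ((hasDerivAt_id s).fun_mul (hd_om (Q := Q) hs)).const_mul (26 * α * C)
  refine HasDerivAt.congr_deriv (f := ht C α Q) this ?_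
  simp only [id]; field_simp; ring

section
variable {A : E m k → Matrix (Fin (m + k)) (Fin (m + k)) ℝ}

/-- Rellich part -/
def W1 (γ : ℝ) (A : E m k → Matrix (Fin (m + k)) (Fin (m + k)) ℝ) (η : ℝ → ℝ)
    (v : E m k → ℝ) (q : E m k) : E m k :=
  (2 * (η (rho γ q) * Fd γ A v q)) • Yv γ A v q - (η (rho γ q) * quadA γ A v q) • Ff γ A q

/-- (G(ρ) θ v²) F -/
def W2 (γ : ℝ) (A : E m k → Matrix (Fin (m + k)) (Fin (m + k)) ℝ) (G : ℝ → ℝ)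
    (w v : E m k → ℝ) (q : E m k) : E m k :=
  (G (rho γ q) * (w q * v q ^ 2)) • Ff γ A q

/-- (h(ρ) v) Y -/
def W4 (γ : ℝ) (A : E m k → Matrix (Fin (m + k)) (Fin (m + k)) ℝ) (h : ℝ → ℝ)
    (v : E m k → ℝ) (q : E m k) : E m k :=
  (h (rho γ q) * v q) • Yv γ A v q

/-- The Carleman field. -/
def CW (γ : ℝ) (A : E m k → Matrix (Fin (m + k)) (Fin (m + k)) ℝ) (C α : ℝ)
    (V v : E m k → ℝ) (q : E m k) : E m k :=
  W1 γ A (et C α (QQ m k γ)) v q + W2 γ A (Gt C α (QQ m k γ)) (th γ A) v q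
    + W2 γ A (et C α (QQ m k γ)) V v q - W4 γ A (ht C α (QQ m k γ)) v q

lemma diff_W1 (hγ : 0 < γ) (hlam : 0 < lam) (hC : C1coeff A) (hE : Elliptic lam A)
    {p : E m k} (hp : p.1 ≠ 0) {η : ℝ → ℝ} {η' : ℝ} (hη : HasDerivAt η η' (rho γ p))
    {v : E m k → ℝ} (hv : ContDiffAt ℝ 2 v p) : DifferentiableAt ℝ (W1 γ A η v) p := by
  have fη := (hasFDerivAt_radial hγ hp hη).differentiableAt
  have fF := (contDiffAt_Ff hγ hlam hC hE hp).differentiableAt one_ne_zero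
  have fX := (contDiffAt_Fd hγ hlam hC hE hp hv).differentiableAt one_ne_zero
  have fY := (contDiffAt_Yv (γ := γ) hC hp hv).differentiableAt one_ne_zero
  have fq := (contDiffAt_quadA (γ := γ) hC hp hv).differentiableAt one_ne_zero
  exact (((fη.fun_mul fX).const_mul 2).fun_smul fY).fun_sub ((fη.fun_mul fq).fun_smul fF)

lemma diff_W2 (hγ : 0 < γ) (hlam : 0 < lam) (hC : C1coeff A) (hE : Elliptic lam A)
    {p : E m k} (hp : p.1 ≠ 0) {η : ℝ → ℝ} {η' : ℝ} (hη : HasDerivAt η η' (rho γ p))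
    {w v : E m k → ℝ} (hw : DifferentiableAt ℝ w p) (hv : DifferentiableAt ℝ v p) :
    DifferentiableAt ℝ (W2 γ A η w v) p := by
  have fη := (hasFDerivAt_radial hγ hp hη).differentiableAt
  have fF := (contDiffAt_Ff hγ hlam hC hE hp).differentiableAt one_ne_zero
  exact ((fη.fun_mul (hw.fun_mul (hv.fun_pow 2))).fun_smul fF)

lemma diff_W4 (hγ : 0 < γ) (hC : C1coeff A)
    {p : E m k} (hp : p.1 ≠ 0) {η : ℝ → ℝ} {η' : ℝ} (hη : HasDerivAt η η' (rho γ p))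
    {v : E m k → ℝ} (hv : ContDiffAt ℝ 2 v p) : DifferentiableAt ℝ (W4 γ A η v) p := by
  have fη := (hasFDerivAt_radial hγ hp hη).differentiableAt
  have fY := (contDiffAt_Yv (γ := γ) hC hp hv).differentiableAt one_ne_zero
  exact (fη.fun_mul (hv.differentiableAt two_ne_zero)).fun_smul fY

lemma diff_CW (hγ : 0 < γ) (hlam : 0 < lam) (hC : C1coeff A) (hE : Elliptic lam A)
    {p : E m k} (hp : p.1 ≠ 0) {C α : ℝ} {V v : E m k → ℝ} (hV : DifferentiableAt ℝ V p)
    (hv : ContDiffAt ℝ 2 v p) : DifferentiableAt ℝ (CW γ A C α V v) p := by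
  have hr := rho_pos hγ (ne_zero_of_fst hp)
  have fv := hv.differentiableAt two_ne_zero
  exact (((diff_W1 hγ hlam hC hE hp (hd_et hr) hv).fun_add
    (diff_W2 hγ hlam hC hE hp (hd_Gt hr) (differentiableAt_th hγ hC hp) fv)).fun_add
    (diff_W2 hγ hlam hC hE hp (hd_et hr) hV fv)).fun_sub (diff_W4 hγ hC hp (hd_ht hr) hv)

/-- The conjugated operator. -/
def Pv (γ : ℝ) (A : E m k → Matrix (Fin (m + k)) (Fin (m + k)) ℝ) (C α : ℝ)
    (V v : E m k → ℝ) (p : E m k) : ℝ :=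
  Div (Yv γ A v) p + 2 * gg C α (rho γ p) * th γ A p * Fd γ A v p
    + th γ A p * v p * (kap C α (QQ m k γ) (rho γ p) + gg C α (rho γ p) * e1 γ A p) + V p * v p

lemma carleman_pt (hγ : 0 < γ) (hlam : 0 < lam) (hC : C1coeff A) (hS : Symm A) (hE : Elliptic lam A)
    {C α K : ℝ} (hG : Geo γ C A) (hC1 : 1 ≤ C) (hQ : 2 ≤ QQ m k γ)
    {p : E m k} (hp : p.1 ≠ 0) (hp1 : 10 * C * rho γ p ≤ 1 / 10)
    {V v : E m k → ℝ} (hV : DifferentiableAt ℝ V p) (hv : ContDiffAt ℝ 2 v p) (hK : 0 ≤ K)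
    (hVK : |V p| ≤ K * (th γ A p * rho γ p ^ 2)) (hFVK : |Fd γ A V p| ≤ K * (th γ A p * rho γ p ^ 2))
    (a1 : 10 * (QQ m k γ + 1) ≤ α) (a2 : 10 * C ≤ α) (a3 : (86 * C) ^ 2 ≤ α)
    (a4 : 60 * C * K ≤ α ^ 2) :
    Div (CW γ A C α V v) p ≤ 3 / 2 * (om (QQ m k γ) (rho γ p) / th γ A p * Pv γ A C α V v p ^ 2)
      - α ^ 3 * rho γ p * (om (QQ m k γ) (rho γ p) * th γ A p) * v p ^ 2 := by
  have hr := rho_pos hγ (ne_zero_of_fst hp)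
  have hr1 : rho γ p < 1 := by nlinarith
  have hth := th_pos hγ hlam hE hp
  have hom := om_pos (Q := QQ m k γ) hr
  have fv := hv.differentiableAt two_ne_zero
  have f1 := diff_W1 hγ hlam hC hE hp (hd_et (C := C) (α := α) (Q := QQ m k γ) hr) hv
  have f2 := diff_W2 hγ hlam hC hE hp (hd_Gt (C := C) (α := α) (Q := QQ m k γ) hr) (differentiableAt_th hγ hC hp) fv
  have f3 := diff_W2 hγ hlam hC hE hp (hd_et (C := C) (α := α) (Q := QQ m k γ) hr) hV fv
  have f4 := diff_W4 hγ hC hp (hd_ht (C := C) (α := α) (Q := QQ m k γ) hr) hv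
  have e1' : Div (CW γ A C α V v) p = Div (W1 γ A (et C α (QQ m k γ)) v) p
      + Div (W2 γ A (Gt C α (QQ m k γ)) (th γ A) v) p + Div (W2 γ A (et C α (QQ m k γ)) V v) p
      - Div (W4 γ A (ht C α (QQ m k γ)) v) p := by
    unfold CW
    rw [Div_sub ((f1.fun_add f2).fun_add f3) f4, Div_add (f1.fun_add f2) f3, Div_add f1 f2]
  have d1 := Div_D1 hγ hlam hC hS hE hp (hd_et (C := C) (α := α) (Q := QQ m k γ) hr) hv
  have d2 := Div_D2 hγ hlam hC hE hp (hd_Gt (C := C) (α := α) (Q := QQ m k γ) hr) fv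
  have d3 := Div_D3 hγ hlam hC hE hp (hd_et (C := C) (α := α) (Q := QQ m k γ) hr) fv hV
  have d4 := Div_D4 hγ hlam hC hS hE hp (hd_ht (C := C) (α := α) (Q := QQ m k γ) hr) hv
  have d1' : Div (W1 γ A (et C α (QQ m k γ)) v) p = _ := d1
  have d2' : Div (W2 γ A (Gt C α (QQ m k γ)) (th γ A) v) p = _ := d2
  have d3' : Div (W2 γ A (et C α (QQ m k γ)) V v) p = _ := d3
  have d4' : Div (W4 γ A (ht C α (QQ m k γ)) v) p = _ := d4
  rw [e1', d1', d2', d3', d4', Pv]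
  clear e1' d1' d2' d3' d4' d1 d2 d3 d4 f1 f2 f3 f4
  have b1 := e1_bound hγ hlam hE hG hp hr1
  have b2 := e2_bound hG hp hr1
  have bT := Tq_bound hG hp hr1 v
  have bq := quadA_nonneg (γ := γ) hlam hE v p
  generalize e1 γ A p = ε₁ at *
  generalize e2 γ A p = ε₂ at *
  generalize Fd γ A v p = X at *
  have hg : gg C α (rho γ p) = α * (1 - 10 * C * rho γ p) := rfl
  have hκ : kap C α (QQ m k γ) (rho γ p) = gg C α (rho γ p) ^ 2 - α * (10 * C) * rho γ p
    + (QQ m k γ - 2) * gg C α (rho γ p) := rfl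
  rw [et, Gt, ht]
  generalize rho γ p = ρ at *
  obtain ⟨q, hq⟩ : ∃ q, quadA γ A v p = th γ A p * q := ⟨_, (mul_div_cancel₀ _ hth.ne').symm⟩
  obtain ⟨ℓ, hℓ⟩ : ∃ q, Div (Yv γ A v) p = th γ A p * q := ⟨_, (mul_div_cancel₀ _ hth.ne').symm⟩
  obtain ⟨T, hT⟩ : ∃ q, Tq γ A v p = th γ A p * q := ⟨_, (mul_div_cancel₀ _ hth.ne').symm⟩
  have hne : th γ A p * ρ ^ 2 ≠ 0 := by positivity
  obtain ⟨V', hV'⟩ : ∃ q, V p = th γ A p * ρ ^ 2 * q := ⟨_, (mul_div_cancel₀ _ hne).symm⟩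
  obtain ⟨W', hW'⟩ : ∃ q, Fd γ A V p = th γ A p * ρ ^ 2 * q := ⟨_, (mul_div_cancel₀ _ hne).symm⟩
  rw [hq] at bT bq
  rw [hV', abs_mul, abs_of_pos (by positivity : 0 < th γ A p * ρ ^ 2), mul_comm, mul_le_mul_iff_left₀ (by positivity)] at hVK
  rw [hW', abs_mul, abs_of_pos (by positivity : 0 < th γ A p * ρ ^ 2), mul_comm, mul_le_mul_iff_left₀ (by positivity)] at hFVK
  rw [hT, abs_mul, abs_of_pos hth, show C * ρ * (th γ A p * q) = th γ A p * (C * ρ * q) by ring,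
    mul_le_mul_iff_right₀ hth] at bT
  have bq' : 0 ≤ q := by
    by_contra h; push Not at h; nlinarith
  have key := scal (X := X) (ℓ := ℓ) (v := v p) hr hr1.le hC1 hp1 hQ hK hg hκ b1 b2 bq' bT hVK hFVK a1 a2 a3 a4
  rw [hq, hℓ, hT, hV', hW']
  generalize th γ A p = θ at *
  generalize gg C α ρ = g at *
  generalize om (QQ m k γ) ρ = ω at *
  generalize QQ m k γ = Q at *
  generalize kap C α Q ρ = κ at *
  generalize v p = y at *
  have key2 := mul_le_mul_of_nonneg_left key (mul_pos hom hth).le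
  refine le_trans (le_of_eq ?_) (key2.trans (le_of_eq ?_))
  · rw [hκ]; field_simp; ring
  · field_simp
end
end BG
end

section
open scoped Topology
namespace BG
variable {m k : ℕ}
variable {γ lam Λ : ℝ}

/-- The Carleman weight e^{-φ}. -/
def wt (C α s : ℝ) : ℝ := exp (-(α * (log s - 10 * C * s)))

lemma wt_pos (C α s : ℝ) : 0 < wt C α s := exp_pos _

lemma hd_wt {C α s : ℝ} (hs : 0 < s) : HasDerivAt (wt C α) (-(gg C α s / s) * wt C α s) s := by
  have h1 := (((hasDerivAt_log hs.ne').fun_sub ((hasDerivAt_id s).const_mul (10 * C))).const_mul α).fun_neg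
  refine HasDerivAt.congr_deriv (f := wt C α) h1.exp ?_
  rw [gg, wt]; simp only [id]; field_simp

/-- Cutoff data -/
structure Cut (ζ ζ' ζ'' : ℝ → ℝ) : Prop where
  h1 : ∀ s, 0 < s → HasDerivAt ζ (ζ' s) s
  h2 : ∀ s, 0 < s → HasDerivAt ζ' (ζ'' s) s

def ff (C α : ℝ) (ζ : ℝ → ℝ) (s : ℝ) : ℝ := wt C α s * ζ s
/-- f' -/
def ff' (C α : ℝ) (ζ ζ' : ℝ → ℝ) (s : ℝ) : ℝ := wt C α s * (ζ' s - gg C α s / s * ζ s)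
/-- f'' -/
def ff'' (C α : ℝ) (ζ ζ' ζ'' : ℝ → ℝ) (s : ℝ) : ℝ :=
  wt C α s * (ζ'' s - 2 * (gg C α s / s) * ζ' s
    + (gg C α s ^ 2 + α * (10 * C) * s + gg C α s) / s ^ 2 * ζ s)

lemma hd_ff {C α s : ℝ} (hs : 0 < s) {ζ ζ' ζ'' : ℝ → ℝ} (hc : Cut ζ ζ' ζ'') :
    HasDerivAt (ff C α ζ) (ff' C α ζ ζ' s) s := by
  refine ((hd_wt hs).fun_mul (hc.h1 s hs)).congr_deriv ?_
  rw [ff']; ring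

lemma hd_ff' {C α s : ℝ} (hs : 0 < s) {ζ ζ' ζ'' : ℝ → ℝ} (hc : Cut ζ ζ' ζ'') :
    HasDerivAt (ff' C α ζ ζ') (ff'' C α ζ ζ' ζ'' s) s := by
  refine ((hd_wt hs).fun_mul ((hc.h2 s hs).fun_sub
    (((hd_gg (C := C) (α := α) (s := s)).fun_div (hasDerivAt_id s) hs.ne').fun_mul (hc.h1 s hs)))).congr_deriv ?_
  rw [ff'']; simp only [id]; field_simp; ring

/-- N = ω e^{-2φ} (sζ')² -/
def NN (C α Q : ℝ) (ζ' : ℝ → ℝ) (s : ℝ) : ℝ := om Q s * wt C α s ^ 2 * (s * ζ' s) ^ 2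

/-- auxiliary coefficient -/
def cc (C α Q : ℝ) (ζ' ζ'' : ℝ → ℝ) (s : ℝ) : ℝ :=
  ((2 - Q) / 2 - gg C α s + 1) * (s * ζ' s) + s ^ 2 * ζ'' s

lemma hd_NN {C α Q s : ℝ} (hs : 0 < s) {ζ ζ' ζ'' : ℝ → ℝ} (hc : Cut ζ ζ' ζ'') :
    HasDerivAt (NN C α Q ζ') (2 * om Q s * wt C α s ^ 2 * (s * ζ' s) * cc C α Q ζ' ζ'' s / s) s := by
  refine (((hd_om hs).fun_mul ((hd_wt hs).fun_pow 2)).fun_mul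
    (((hasDerivAt_id s).fun_mul (hc.h2 s hs)).fun_pow 2)).congr_deriv ?_
  rw [cc]; simp only [id]; field_simp; push_cast; ring

section
variable {A : E m k → Matrix (Fin (m + k)) (Fin (m + k)) ℝ}

lemma Pv_prod (hγ : 0 < γ) (hlam : 0 < lam) (hC : C1coeff A) (hS : Symm A) (hE : Elliptic lam A)
    {C α : ℝ} {p : E m k} (hp : p.1 ≠ 0) {V u : E m k → ℝ} (hu : ContDiffAt ℝ 2 u p)
    (hsol : Div (Yv γ A u) p + V p * u p = 0) {ζ ζ' ζ'' : ℝ → ℝ} (hc : Cut ζ ζ' ζ'') :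
    Pv γ A C α V (fun q => ff C α ζ (rho γ q) * u q) p = wt C α (rho γ p) * th γ A p *
      (2 * (rho γ p * ζ' (rho γ p)) * Fd γ A u p
        + u p * (rho γ p ^ 2 * ζ'' (rho γ p) + rho γ p * ζ' (rho γ p) * (QQ m k γ - 1 + e1 γ A p))) := by
  have hr := rho_pos hγ (ne_zero_of_fst hp)
  have fu := hu.differentiableAt two_ne_zero
  rw [Pv, Div_Yv_mul hγ hlam hC hS hE hp (fun s hs => hd_ff hs hc) (hd_ff' hr hc) hu,
    Fd_prod hγ hlam hE hp (hd_ff hr hc) fu]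
  have e : Div (Yv γ A u) p = - (V p * u p) := by linarith
  rw [e, ff, ff', ff'', kap]
  field_simp
  ring

lemma contDiffAt_radial (hγ : 0 < γ) {p : E m k} (hp : p.1 ≠ 0) {h : ℝ → ℝ} {n : WithTop ℕ∞}
    (hh : ContDiffAt ℝ n h (rho γ p)) : ContDiffAt ℝ n (fun q => h (rho γ q)) p :=
  hh.comp p (contDiffAt_rho hγ hp)

lemma contDiffAt_wt {C α s : ℝ} (hs : 0 < s) {n : WithTop ℕ∞} : ContDiffAt ℝ n (wt C α) s := by
  unfold wt
  exact ((contDiffAt_const.mul ((contDiffAt_log.2 hs.ne').sub (contDiffAt_const.mul contDiffAt_id))).neg).exp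

/-- Total field -/
def WT (γ : ℝ) (A : E m k → Matrix (Fin (m + k)) (Fin (m + k)) ℝ) (C α : ℝ)
    (ζ ζ' : ℝ → ℝ) (V u : E m k → ℝ) (q : E m k) : E m k :=
  (24 : ℝ) • W4 γ A (NN C α (QQ m k γ) ζ') u q
    - CW γ A C α V (fun q => ff C α ζ (rho γ q) * u q) q

lemma final_pt (hγ : 0 < γ) (hlam : 0 < lam) (hC : C1coeff A) (hS : Symm A) (hE : Elliptic lam A)
    {C α K : ℝ} (hG : Geo γ C A) (hC1 : 1 ≤ C) (hQ : 2 ≤ QQ m k γ)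
    {p : E m k} (hp : p.1 ≠ 0) (hp1 : 10 * C * rho γ p ≤ 1 / 10)
    {V u : E m k → ℝ} (hV : DifferentiableAt ℝ V p) (hu : ContDiffAt ℝ 2 u p) (hK : 0 ≤ K)
    (hVK : |V p| ≤ K * (th γ A p * rho γ p ^ 2)) (hFVK : |Fd γ A V p| ≤ K * (th γ A p * rho γ p ^ 2))
    (hsol : Div (Yv γ A u) p + V p * u p = 0)
    (a1 : 10 * (QQ m k γ + 1) ≤ α) (a2 : 10 * C ≤ α) (a3 : (86 * C) ^ 2 ≤ α)
    (a4 : 60 * C * K ≤ α ^ 2) {ζ ζ' ζ'' : ℝ → ℝ} (hc : Cut ζ ζ' ζ'') (hζ : ContDiff ℝ 2 ζ) :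
    om (QQ m k γ) (rho γ p) * th γ A p * wt C α (rho γ p) ^ 2 * u p ^ 2 *
      (α ^ 3 * rho γ p * ζ (rho γ p) ^ 2 -
        (24 * K * rho γ p ^ 2 * (rho γ p * ζ' (rho γ p)) ^ 2
          + 48 * cc C α (QQ m k γ) ζ' ζ'' (rho γ p) ^ 2
          + 3 * (rho γ p ^ 2 * ζ'' (rho γ p) + rho γ p * ζ' (rho γ p) * (QQ m k γ - 1 + e1 γ A p)) ^ 2))
      ≤ Div (WT γ A C α ζ ζ' V u) p := by
  have hr := rho_pos hγ (ne_zero_of_fst hp)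
  have hth := th_pos hγ hlam hE hp
  have hom := om_pos (Q := QQ m k γ) hr
  have hv : ContDiffAt ℝ 2 (fun q => ff C α ζ (rho γ q) * u q) p :=
    (contDiffAt_radial hγ hp ((contDiffAt_wt hr).mul hζ.contDiffAt)).mul hu
  have hcar := carleman_pt hγ hlam hC hS hE hG hC1 hQ hp hp1 hV hv hK hVK hFVK a1 a2 a3 a4
  rw [Pv_prod hγ hlam hC hS hE hp hu hsol hc] at hcar
  have f1 := diff_CW (C := C) (α := α) hγ hlam hC hE hp hV hv
  have hN := hd_NN (C := C) (α := α) (Q := QQ m k γ) hr hc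
  have f2 := diff_W4 (A := A) hγ hC hp hN hu
  have d4 := Div_D4 hγ hlam hC hS hE hp hN hu
  have d4' : Div (W4 γ A (NN C α (QQ m k γ) ζ') u) p = _ := d4
  have e : Div (WT γ A C α ζ ζ' V u) p = 24 * Div (W4 γ A (NN C α (QQ m k γ) ζ') u) p
      - Div (CW γ A C α V (fun q => ff C α ζ (rho γ q) * u q)) p := by
    unfold WT
    rw [Div_sub (f2.fun_const_smul (24 : ℝ)) f1, Div_smul (f := fun _ => (24 : ℝ)) (by fun_prop) f2]
    simp
  rw [e, d4']
  have hcs := th_Fd_sq hγ hlam hS hE hp u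
  have eL : Div (Yv γ A u) p = - (V p * u p) := by linarith
  rw [eL]
  clear d4 d4' f1 f2 hN e eL hsol hv
  set B := rho γ p ^ 2 * ζ'' (rho γ p) + rho γ p * ζ' (rho γ p) * (QQ m k γ - 1 + e1 γ A p) with hB
  rw [NN]
  generalize cc C α (QQ m k γ) ζ' ζ'' (rho γ p) = c at *
  simp only [ff] at hcar
  generalize hDd : Div (CW γ A C α V fun q => wt C α (rho γ q) * ζ (rho γ q) * u q) p = DD at hcar
  have hDd' : Div (CW γ A C α V fun q => ff C α ζ (rho γ q) * u q) p = DD := hDd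
  rw [hDd']
  clear hDd hDd' hB
  generalize rho γ p = ρ at *
  generalize Fd γ A u p = X at *
  generalize th γ A p = θ at *
  generalize hω : om (QQ m k γ) ρ = ω at *
  generalize wt C α ρ = w at *
  generalize quadA γ A u p = q at *
  generalize u p = y at *
  generalize V p = V' at *
  obtain ⟨z, hz⟩ : ∃ z, ρ * ζ' ρ = z := ⟨_, rfl⟩
  rw [hz] at hcar ⊢
  have e1 : 3 / 2 * (ω / θ * (w * θ * (2 * z * X + y * B)) ^ 2) =
      3 / 2 * (ω * w ^ 2 * θ) * (2 * z * X + y * B) ^ 2 := by field_simp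
  rw [e1] at hcar
  have e2 : 2 * ω * w ^ 2 * z * c / ρ * (ρ * θ * X) = 2 * ω * w ^ 2 * z * c * θ * X := by field_simp
  have S0 : 0 ≤ ω * w ^ 2 := by positivity
  have S1 : 0 ≤ ω * w ^ 2 * θ := by positivity
  have g1 : (ω * w ^ 2 * θ) * (2 * z * X + y * B) ^ 2 ≤ (ω * w ^ 2 * θ) * (8 * z ^ 2 * X ^ 2 + 2 * y ^ 2 * B ^ 2) := by
    gcongr; linarith [sq_nonneg (2 * z * X - y * B)]
  have g2 : ω * w ^ 2 * z ^ 2 * (θ * X ^ 2) ≤ ω * w ^ 2 * z ^ 2 * q := by gcongr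
  have g3 : 0 ≤ (ω * w ^ 2 * θ) * (z * X + 2 * c * y) ^ 2 := by positivity
  have g4 : ω * w ^ 2 * z ^ 2 * y ^ 2 * V' ≤ ω * w ^ 2 * z ^ 2 * y ^ 2 * (K * (θ * ρ ^ 2)) := by
    have := (abs_le.1 hVK).2
    gcongr
  rw [e2]
  linarith
end
end BG
end

section
open scoped Topology
namespace BG
variable {m k : ℕ}
variable {γ lam Λ : ℝ}

/-! ### Smooth transition -/

lemma deriv_zero_of_const {f : ℝ → ℝ} (hf : ContDiff ℝ 1 f) {c d : ℝ} (h0 : ∀ x, x ≤ 0 → f x = c)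
    (h1 : ∀ x, 1 ≤ x → f x = d) : ∀ x, x ≤ 0 ∨ 1 ≤ x → deriv f x = 0 := by
  have hc : Continuous (deriv f) := hf.continuous_deriv le_rfl
  have A1 : ∀ x, x < 0 → deriv f x = 0 := by
    intro x hx
    have : f =ᶠ[𝓝 x] fun _ => c := by
      filter_upwards [Iio_mem_nhds hx] with y hy using h0 y (le_of_lt hy)
    rw [this.deriv_eq]; simp
  have A2 : ∀ x, 1 < x → deriv f x = 0 := by
    intro x hx
    have : f =ᶠ[𝓝 x] fun _ => d := by
      filter_upwards [Ioi_mem_nhds hx] with y hy using h1 y (le_of_lt hy)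
    rw [this.deriv_eq]; simp
  have cl : IsClosed {x | deriv f x = 0} := isClosed_eq hc continuous_const
  rintro x (hx | hx)
  · have : closure (Iio (0 : ℝ)) ⊆ {x | deriv f x = 0} := closure_minimal (fun y hy => A1 y hy) cl
    rw [closure_Iio] at this; exact this hx
  · have : closure (Ioi (1 : ℝ)) ⊆ {x | deriv f x = 0} := closure_minimal (fun y hy => A2 y hy) cl
    rw [closure_Ioi] at this; exact this hx

/-- first derivative of smoothTransition -/
def T1 : ℝ → ℝ := deriv Real.smoothTransition
/-- second derivative -/
def T2 : ℝ → ℝ := deriv T1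

lemma contDiff_T0 : ContDiff ℝ 3 Real.smoothTransition := Real.smoothTransition.contDiff
lemma contDiff_T1 : ContDiff ℝ 2 T1 := (contDiff_succ_iff_deriv (n := 2) |>.1 (contDiff_T0.of_le (by norm_num))).2.2
lemma contDiff_T2 : ContDiff ℝ 1 T2 := (contDiff_succ_iff_deriv (n := 1) |>.1 (contDiff_T1.of_le (by norm_num))).2.2

lemma T1_zero : ∀ x, x ≤ 0 ∨ 1 ≤ x → T1 x = 0 :=
  deriv_zero_of_const (contDiff_T0.of_le (by norm_num)) (c := 0) (d := 1)
    (fun _ hx => Real.smoothTransition.zero_of_nonpos hx)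
    (fun _ hx => Real.smoothTransition.one_of_one_le hx)

lemma T2_zero : ∀ x, x ≤ 0 ∨ 1 ≤ x → T2 x = 0 :=
  deriv_zero_of_const (contDiff_T1.of_le (by norm_num)) (c := 0) (d := 0)
    (fun x hx => T1_zero x (Or.inl hx)) (fun x hx => T1_zero x (Or.inr hx))

lemma hd_T0 (x : ℝ) : HasDerivAt Real.smoothTransition (T1 x) x :=
  (contDiff_T0.differentiable (by norm_num) x).hasDerivAt
lemma hd_T1 (x : ℝ) : HasDerivAt T1 (T2 x) x :=
  (contDiff_T1.differentiable (by norm_num) x).hasDerivAt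

lemma T_bound : ∃ M : ℝ, 1 ≤ M ∧ ∀ x, |T1 x| ≤ M ∧ |T2 x| ≤ M := by
  have c1 : HasCompactSupport T1 := HasCompactSupport.intro (isCompact_Icc (a := (0 : ℝ)) (b := 1))
    fun x hx => T1_zero x (by simp only [mem_Icc, not_and_or, not_le] at hx; exact hx.imp le_of_lt le_of_lt)
  have c2 : HasCompactSupport T2 := HasCompactSupport.intro (isCompact_Icc (a := (0 : ℝ)) (b := 1))
    fun x hx => T2_zero x (by simp only [mem_Icc, not_and_or, not_le] at hx; exact hx.imp le_of_lt le_of_lt)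
  obtain ⟨M1, h1⟩ := c1.exists_bound_of_continuous contDiff_T1.continuous
  obtain ⟨M2, h2⟩ := c2.exists_bound_of_continuous contDiff_T2.continuous
  refine ⟨1 + |M1| + |M2|, by linarith [abs_nonneg M1, abs_nonneg M2], fun x => ⟨?_, ?_⟩⟩
  · have := h1 x; rw [Real.norm_eq_abs] at this
    linarith [le_abs_self M1, abs_nonneg M2]
  · have := h2 x; rw [Real.norm_eq_abs] at this
    linarith [le_abs_self M2, abs_nonneg M1]

/-! ### Integration by parts -/

lemma continuous_Div {W : E m k → E m k} (h : ContDiff ℝ 1 W) : Continuous (Div W) := by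
  unfold Div
  exact continuous_finsetSum _ fun i _ =>
    (co i).continuous.comp ((h.continuous_fderiv one_ne_zero).clm_apply continuous_const)

lemma Div_zero_of_notMem {W : E m k → E m k} {p : E m k} (hp : p ∉ tsupport W) : Div W p = 0 := by
  have : W =ᶠ[𝓝 p] fun _ => 0 := notMem_tsupport_iff_eventuallyEq.1 hp
  rw [Div_congr this]; simp [Div]

lemma hasCompactSupport_Div {W : E m k → E m k} (hc : HasCompactSupport W) :
    HasCompactSupport (Div W) :=
  HasCompactSupport.intro hc.isCompact fun _ hp => Div_zero_of_notMem hp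

lemma integrable_Div {W : E m k → E m k} (h : ContDiff ℝ 1 W) (hc : HasCompactSupport W) :
    Integrable (Div W) :=
  (continuous_Div h).integrable_of_hasCompactSupport (hasCompactSupport_Div hc)

instance instHaarE : (volume : Measure (E m k)).IsAddHaarMeasure :=
  inferInstanceAs ((volume : Measure (EuclideanSpace ℝ (Fin m))).prod
    (volume : Measure (EuclideanSpace ℝ (Fin k)))).IsAddHaarMeasure

lemma integral_fderiv_zero {f : E m k → ℝ} (h : ContDiff ℝ 1 f) (hc : HasCompactSupport f) (v : E m k) :
    ∫ p, fderiv ℝ f p v = 0 := by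
  have hd := h.differentiable one_ne_zero
  have hcd : Continuous fun p => fderiv ℝ f p v := (h.continuous_fderiv one_ne_zero).clm_apply continuous_const
  have hcc : HasCompactSupport fun p => fderiv ℝ f p v := hc.fderiv_apply ℝ v
  have := integral_mul_fderiv_eq_neg_fderiv_mul_of_integrable (μ := (volume : Measure (E m k)))
    (f := fun _ : E m k => (1 : ℝ)) (g := f) (v := v)
    (by simp) (by simpa using hcd.integrable_of_hasCompactSupport hcc)
    (by simpa using h.continuous.integrable_of_hasCompactSupport hc) (fun _ _ => by fun_prop) (fun x _ => hd x)
  simpa using this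

lemma integral_Div_zero {W : E m k → E m k} (h : ContDiff ℝ 1 W) (hc : HasCompactSupport W) :
    ∫ p, Div W p = 0 := by
  have hd := h.differentiable one_ne_zero
  have e : ∀ p, Div W p = ∑ i, fderiv ℝ (fun q => co i (W q)) p (bas i) := fun p =>
    Finset.sum_congr rfl fun i _ => co_fderiv (hd p) i
  have h1 : ∀ i : Fin (m + k), ContDiff ℝ 1 fun q => co i (W q) := fun i => (co i).contDiff.comp h
  have h2 : ∀ i : Fin (m + k), HasCompactSupport fun q => co i (W q) := fun i => hc.comp_left (map_zero _)
  simp only [e]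
  rw [integral_finsetSum]
  · exact Finset.sum_eq_zero fun i _ => integral_fderiv_zero (h1 i) (h2 i) _
  · intro i _
    exact (((h1 i).continuous_fderiv one_ne_zero).clm_apply continuous_const).integrable_of_hasCompactSupport
      ((h2 i).fderiv_apply ℝ _)

/-- cutoff near z = 0 -/
def ch (δ : ℝ) (p : E m k) : ℝ := Real.smoothTransition (‖p.1‖ ^ 2 / δ ^ 2 - 1)

lemma contDiff_ch (δ : ℝ) : ContDiff ℝ 3 (ch (m := m) (k := k) δ) :=
  contDiff_T0.comp ((((contDiff_norm_sq ℝ).comp contDiff_fst).div_const _).sub contDiff_const)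

lemma fderiv_ch (δ : ℝ) (p w : E m k) :
    fderiv ℝ (ch δ) p w = T1 (‖p.1‖ ^ 2 / δ ^ 2 - 1) * (2 * inner ℝ p.1 w.1 / δ ^ 2) := by
  have h1 : HasFDerivAt (fun q : E m k => ‖q.1‖ ^ 2)
      ((2 • (innerSL ℝ p.1)).comp (ContinuousLinearMap.fst ℝ _ _)) p :=
    (hasStrictFDerivAt_norm_sq p.1).hasFDerivAt.comp p hasFDerivAt_fst
  have h2 := (hd_T0 (‖p.1‖ ^ 2 / δ ^ 2 - 1)).comp_hasFDerivAt p ((h1.mul_const ((δ ^ 2)⁻¹)).sub_const 1)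
  have h3 : HasFDerivAt (ch δ) _ p := h2
  rw [h3.fderiv]
  simp
  left; ring

lemma null_z (hm : 1 ≤ m) : volume {p : E m k | p.1 = 0} = 0 := by
  have : {p : E m k | p.1 = 0} = ({0} : Set (EuclideanSpace ℝ (Fin m))) ×ˢ univ := by
    ext p; simp
  rw [this, Measure.volume_eq_prod, Measure.prod_prod]
  haveI : Nonempty (Fin m) := ⟨⟨0, hm⟩⟩
  simp

set_option maxHeartbeats 2000000 in
lemma ibp (hm : 1 ≤ m) {W W0 : E m k → E m k} {J : E m k → ℝ} {C : ℝ}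
    (hW : ∀ p, p.1 ≠ 0 → ContDiffAt ℝ 1 W p) (hWc : HasCompactSupport W)
    (hW0 : ContDiff ℝ 1 W0) (hW0c : HasCompactSupport W0)
    (hdiff : ∀ p, p.1 ≠ 0 → ‖(W p - W0 p).1‖ ≤ C * ‖p.1‖)
    (hJ : Integrable J) (hle : ∀ p, p.1 ≠ 0 → J p ≤ Div W p) : ∫ p, J p ≤ 0 := by
  obtain ⟨M, hM, hT⟩ := T_bound
  obtain ⟨Kc, hK⟩ : ∃ Kc : Set (E m k), Kc = tsupport W ∪ tsupport W0 := ⟨_, rfl⟩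
  have hKc : IsCompact Kc := hK ▸ hWc.isCompact.union hW0c.isCompact
  have hC0 : 0 ≤ |C| := abs_nonneg C
  obtain ⟨d, hd⟩ : ∃ d : ℕ → ℝ, d = fun n : ℕ => 1 / ((n : ℝ) + 1) := ⟨_, rfl⟩
  have hdpos : ∀ n, 0 < d n := fun n => by rw [hd]; positivity
  have hdlim : Tendsto d atTop (𝓝 0) := hd ▸ tendsto_one_div_add_atTop_nhds_zero_nat
  obtain ⟨Sn, hSn⟩ : ∃ Sn : ℕ → Set (E m k), ∀ n, Sn n = Kc ∩ {p | 0 < ‖p.1‖ ∧ ‖p.1‖ ≤ 2 * d n} := ⟨_, fun _ => rfl⟩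
  have hSm : ∀ n, MeasurableSet (Sn n) := fun n => by
    rw [hSn n]
    exact hKc.isClosed.measurableSet.inter
      ((measurableSet_lt measurable_const measurable_fst.norm).inter
        (measurableSet_le measurable_fst.norm measurable_const))
  obtain ⟨c, hc⟩ : ∃ c : ℝ, c = M * (2 * (|C| * 4)) := ⟨_, rfl⟩
  have hc0 : 0 ≤ c := by rw [hc]; positivity
  obtain ⟨H, hH⟩ : ∃ H : ℕ → E m k → ℝ, ∀ n, H n = fun p => ch (d n) p * (J p - Div W0 p) - (Sn n).indicator (fun _ => c) p := ⟨_, fun _ => rfl⟩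
  -- smoothness of truncated fields
  have hchz : ∀ n (p : E m k), p.1 = 0 → ch (d n) =ᶠ[𝓝 p] fun _ => 0 := by
    intro n p hp
    have hcont : ContinuousAt (fun q : E m k => ‖q.1‖) p := (continuous_fst.norm).continuousAt
    have : ∀ᶠ q in 𝓝 p, ‖q.1‖ < d n := by
      apply hcont.eventually_lt continuousAt_const; simp [hp, hdpos n]
    filter_upwards [this] with q hq
    apply Real.smoothTransition.zero_of_nonpos
    have := hdpos n
    rw [sub_nonpos, div_le_one (by positivity)]
    gcongr
  have hchW : ∀ n, ContDiff ℝ 1 (fun p => ch (d n) p • W p) := by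
    intro n
    rw [contDiff_iff_contDiffAt]
    intro p
    by_cases hp : p.1 = 0
    · have : (fun p => ch (d n) p • W p) =ᶠ[𝓝 p] fun _ => 0 := by
        filter_upwards [hchz n p hp] with q hq; rw [hq, zero_smul]
      exact contDiffAt_const.congr_of_eventuallyEq this
    · exact (((contDiff_ch (d n)).of_le (by norm_num)).contDiffAt).smul (hW p hp)
  have hchWc : ∀ n, HasCompactSupport (fun p => ch (d n) p • W p) := fun n =>
    hWc.mono (fun p hp h0 => hp (by simp only [h0, smul_zero]))
  have hchW0 : ∀ n, ContDiff ℝ 1 (fun p => ch (d n) p • W0 p) := fun n =>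
    ((contDiff_ch (d n)).of_le (by norm_num)).smul hW0
  have hchW0c : ∀ n, HasCompactSupport (fun p => ch (d n) p • W0 p) := fun n =>
    hW0c.mono (fun p hp h0 => hp (by simp only [h0, smul_zero]))
  have fch : ∀ n (p : E m k), DifferentiableAt ℝ (ch (d n)) p := fun n p =>
    (contDiff_ch (d n)).differentiable (by norm_num) p
  have hch01 : ∀ n (p : E m k), 0 ≤ ch (d n) p ∧ ch (d n) p ≤ 1 := fun n p =>
    ⟨Real.smoothTransition.nonneg _, Real.smoothTransition.le_one _⟩
  have hcS : ∀ n p, 0 ≤ (Sn n).indicator (fun _ => c) p := fun n p => indicator_nonneg (fun _ _ => hc0) p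
  -- pointwise
  have hpt : ∀ n p, H n p ≤ Div (fun p => ch (d n) p • W p) p - Div (fun p => ch (d n) p • W0 p) p := by
    intro n p
    by_cases hp : p.1 = 0
    · have z1 : (fun p => ch (d n) p • W p) =ᶠ[𝓝 p] fun _ => 0 := by
        filter_upwards [hchz n p hp] with q hq; rw [hq, zero_smul]
      have z2 : (fun p => ch (d n) p • W0 p) =ᶠ[𝓝 p] fun _ => 0 := by
        filter_upwards [hchz n p hp] with q hq; rw [hq, zero_smul]
      rw [Div_congr z1, Div_congr z2, hH]
      have : ch (d n) p = 0 := (hchz n p hp).eq_of_nhds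
      simp only [this, zero_mul]
      linarith [hcS n p]
    · rw [Div_smul (fch n p) ((hW p hp).differentiableAt one_ne_zero),
        Div_smul (fch n p) (hW0.differentiable one_ne_zero p)]
      have h1 : fderiv ℝ (ch (d n)) p (W p) - fderiv ℝ (ch (d n)) p (W0 p)
          = fderiv ℝ (ch (d n)) p (W p - W0 p) := by rw [map_sub]
      have h2 : |fderiv ℝ (ch (d n)) p (W p - W0 p)| ≤ (Sn n).indicator (fun _ => c) p := by
        by_cases hpK : p ∈ Kc
        · by_cases hz : ‖p.1‖ ≤ 2 * d n
          · rw [indicator_of_mem (show p ∈ Sn n from (hSn n).symm ▸ ⟨hpK, norm_pos_iff.2 hp, hz⟩), fderiv_ch, abs_mul, hc]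
            have i1 : |inner ℝ p.1 (W p - W0 p).1| ≤ ‖p.1‖ * (|C| * ‖p.1‖) := by
              refine (abs_real_inner_le_norm _ _).trans ?_
              gcongr
              refine (hdiff p hp).trans ?_
              gcongr; exact le_abs_self C
            have i2 : |2 * inner ℝ p.1 (W p - W0 p).1 / d n ^ 2| ≤ 2 * (|C| * 4) := by
              have := hdpos n
              rw [abs_div, abs_mul, abs_of_pos (by positivity : (0 : ℝ) < d n ^ 2), div_le_iff₀ (by positivity), abs_two]
              have : ‖p.1‖ * ‖p.1‖ ≤ (2 * d n) * (2 * d n) := by gcongr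
              nlinarith
            exact mul_le_mul (hT _).1 i2 (abs_nonneg _) (by linarith)
          · have : T1 (‖p.1‖ ^ 2 / d n ^ 2 - 1) = 0 := by
              apply T1_zero; right
              have h0 := hdpos n
              push Not at hz
              rw [le_sub_iff_add_le, le_div_iff₀ (by positivity)]
              nlinarith
            rw [fderiv_ch, this, zero_mul, abs_zero]; exact hcS n p
        · have : W p - W0 p = 0 := by
            rw [hK, mem_union, not_or] at hpK
            rw [image_eq_zero_of_notMem_tsupport hpK.1, image_eq_zero_of_notMem_tsupport hpK.2, sub_zero]
          rw [this, map_zero, abs_zero]; exact hcS n p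
      have h3 := mul_le_mul_of_nonneg_left (hle p hp) (hch01 n p).1
      have h4 := (abs_le.1 h2).1
      simp only [hH]
      linarith
  have iW0 := integrable_Div hW0 hW0c
  have iS : ∀ n, Integrable ((Sn n).indicator (fun _ : E m k => c)) := fun n => by
    rw [integrable_indicator_iff (hSm n)]
    refine integrableOn_const (ne_of_lt (lt_of_le_of_lt (measure_mono ((hSn n).symm ▸ inter_subset_left)) hKc.measure_lt_top)) (by simp)
  have iH : ∀ n, Integrable (H n) := fun n => by
    rw [hH n]
    refine Integrable.sub ?_ (iS n)
    refine (hJ.sub iW0).bdd_mul (c := 1) (contDiff_ch (d n)).continuous.aestronglyMeasurable ?_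
    exact Eventually.of_forall fun p => by
      rw [Real.norm_eq_abs, abs_of_nonneg (hch01 n p).1]; exact (hch01 n p).2
  have hHi : ∀ n, ∫ p, H n p ≤ 0 := by
    intro n
    have := integral_mono (iH n) ((integrable_Div (hchW n) (hchWc n)).sub (integrable_Div (hchW0 n) (hchW0c n))) (hpt n)
    simp only [Pi.sub_apply] at this
    rw [integral_sub (integrable_Div (hchW n) (hchWc n)) (integrable_Div (hchW0 n) (hchW0c n)),
      integral_Div_zero (hchW n) (hchWc n), integral_Div_zero (hchW0 n) (hchW0c n)] at this
    linarith
  have hlim : Tendsto (fun n => ∫ p, H n p) atTop (𝓝 (∫ p, (J p - Div W0 p))) := by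
    refine tendsto_integral_of_dominated_convergence
      (fun p => |J p - Div W0 p| + Kc.indicator (fun _ => c) p) (fun n => (iH n).aestronglyMeasurable) ?_ ?_ ?_
    · refine (hJ.sub iW0).abs.add ?_
      rw [integrable_indicator_iff hKc.isClosed.measurableSet]
      exact integrableOn_const hKc.measure_lt_top.ne (by simp)
    · intro n
      refine Eventually.of_forall fun p => ?_
      rw [Real.norm_eq_abs, hH n]
      refine (abs_sub _ _).trans (add_le_add ?_ ?_)
      · rw [abs_mul, abs_of_nonneg (hch01 n p).1]
        exact mul_le_of_le_one_left (abs_nonneg _) (hch01 n p).2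
      · rw [abs_of_nonneg (hcS n p)]
        exact indicator_le_indicator_of_subset ((hSn n).symm ▸ inter_subset_left) (fun _ => hc0) p
    · have : ∀ᵐ p : E m k, p.1 ≠ 0 := by
        rw [ae_iff]; simpa using null_z hm
      filter_upwards [this] with p hp
      have hpos := norm_pos_iff.2 hp
      have hev : ∀ᶠ n in atTop, 2 * d n < ‖p.1‖ := by
        have : Tendsto (fun n => 2 * d n) atTop (𝓝 (2 * 0)) := hdlim.const_mul 2
        rw [mul_zero] at this
        exact this.eventually_lt_const hpos
      refine tendsto_const_nhds.congr' ?_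
      filter_upwards [hev] with n hn
      have h1 : ch (d n) p = 1 := by
        apply Real.smoothTransition.one_of_one_le
        have h0 := hdpos n
        rw [le_sub_iff_add_le, le_div_iff₀ (by positivity)]
        nlinarith
      have h2 : p ∉ Sn n := fun h => absurd ((hSn n) ▸ h).2.2 (not_le.2 hn)
      simp only [hH, h1, indicator_of_notMem h2]; ring
  have h0 := le_of_tendsto' hlim hHi
  rw [integral_sub hJ iW0, integral_Div_zero hW0 hW0c] at h0
  linarith
end BG
end

section
open scoped Topology
namespace BG
variable {m k : ℕ}
variable {γ lam Λ : ℝ}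

/-- cutoff -/
def ze (r R s : ℝ) : ℝ := Real.smoothTransition (4 / r * s - 1) * Real.smoothTransition (3 - 4 / R * s)
/-- its derivative -/
def zep (r R s : ℝ) : ℝ :=
  (T1 (4 / r * s - 1) * (4 / r)) * Real.smoothTransition (3 - 4 / R * s)
    + Real.smoothTransition (4 / r * s - 1) * (T1 (3 - 4 / R * s) * (-(4 / R)))
/-- its second derivative -/
def zepp (r R s : ℝ) : ℝ :=
  ((T2 (4 / r * s - 1) * (4 / r)) * (4 / r)) * Real.smoothTransition (3 - 4 / R * s)
    + (T1 (4 / r * s - 1) * (4 / r)) * (T1 (3 - 4 / R * s) * (-(4 / R)))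
    + ((T1 (4 / r * s - 1) * (4 / r)) * (T1 (3 - 4 / R * s) * (-(4 / R)))
    + Real.smoothTransition (4 / r * s - 1) * ((T2 (3 - 4 / R * s) * (-(4 / R))) * (-(4 / R))))

lemma hd_la (c d s : ℝ) : HasDerivAt (fun s => c * s - d) c s := by
  simpa using ((hasDerivAt_id s).const_mul c).sub_const d
lemma hd_lb (c d s : ℝ) : HasDerivAt (fun s => d - c * s) (-c) s := by
  simpa using ((hasDerivAt_id s).const_mul c).const_sub d

lemma cut_ze (r R : ℝ) : Cut (ze r R) (zep r R) (zepp r R) := by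
  refine ⟨fun s _ => ?_, fun s _ => ?_⟩
  · exact ((hd_T0 _).comp s (hd_la (4 / r) 1 s)).fun_mul ((hd_T0 _).comp s (hd_lb (4 / R) 3 s))
  · exact ((((hd_T1 _).comp s (hd_la (4 / r) 1 s)).mul_const (4 / r)).fun_mul
      ((hd_T0 _).comp s (hd_lb (4 / R) 3 s))).fun_add (((hd_T0 _).comp s (hd_la (4 / r) 1 s)).fun_mul
      (((hd_T1 _).comp s (hd_lb (4 / R) 3 s)).mul_const (-(4 / R))))

lemma contDiff_ze (r R : ℝ) : ContDiff ℝ 2 (ze r R) := by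
  have a : ContDiff ℝ 2 fun s : ℝ => 4 / r * s - 1 := by fun_prop
  have b : ContDiff ℝ 2 fun s : ℝ => 3 - 4 / R * s := by fun_prop
  have h := contDiff_T0.of_le (show (2 : WithTop ℕ∞) ≤ 3 by norm_num)
  exact (h.comp a).mul (h.comp b)

lemma contDiff_zep (r R : ℝ) : ContDiff ℝ 1 (zep r R) := by
  have a : ContDiff ℝ 1 fun s : ℝ => 4 / r * s - 1 := by fun_prop
  have b : ContDiff ℝ 1 fun s : ℝ => 3 - 4 / R * s := by fun_prop
  have h := contDiff_T0.of_le (show (1 : WithTop ℕ∞) ≤ 3 by norm_num)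
  have h1 := contDiff_T1.of_le (show (1 : WithTop ℕ∞) ≤ 2 by norm_num)
  exact (((h1.comp a).mul contDiff_const).mul (h.comp b)).add ((h.comp a).mul ((h1.comp b).mul contDiff_const))

section
variable {r R s : ℝ}

lemma ze_mem : 0 ≤ ze r R s ∧ ze r R s ≤ 1 :=
  ⟨mul_nonneg (Real.smoothTransition.nonneg _) (Real.smoothTransition.nonneg _),
    mul_le_one₀ (Real.smoothTransition.le_one _) (Real.smoothTransition.nonneg _)
      (Real.smoothTransition.le_one _)⟩

lemma xa_le (hr : 0 < r) (hs : s ≤ r / 4) : 4 / r * s - 1 ≤ 0 := by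
  rw [sub_nonpos, div_mul_eq_mul_div, div_le_one hr]; linarith
lemma xa_ge (hr : 0 < r) (hs : r / 2 ≤ s) : 1 ≤ 4 / r * s - 1 := by
  rw [le_sub_iff_add_le, div_mul_eq_mul_div, le_div_iff₀ hr]; linarith
lemma xb_le (hR : 0 < R) (hs : 3 * R / 4 ≤ s) : 3 - 4 / R * s ≤ 0 := by
  rw [sub_nonpos, div_mul_eq_mul_div, le_div_iff₀ hR]; linarith
lemma xb_ge (hR : 0 < R) (hs : s ≤ R / 2) : 1 ≤ 3 - 4 / R * s := by
  have : 4 / R * s ≤ 2 := by rw [div_mul_eq_mul_div, div_le_iff₀ hR]; linarith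
  linarith

lemma ze_one (hr : 0 < r) (hR : 0 < R) (h1 : r / 2 ≤ s) (h2 : s ≤ R / 2) : ze r R s = 1 := by
  rw [ze, Real.smoothTransition.one_of_one_le (xa_ge hr h1),
    Real.smoothTransition.one_of_one_le (xb_ge hR h2), one_mul]

lemma ze_zero (hr : 0 < r) (hR : 0 < R) (h : s ≤ r / 4 ∨ 3 * R / 4 ≤ s) :
    ze r R s = 0 ∧ zep r R s = 0 ∧ zepp r R s = 0 := by
  rcases h with h | h
  · have x := xa_le hr h
    simp only [ze, zep, zepp, Real.smoothTransition.zero_of_nonpos x, T1_zero _ (Or.inl x), T2_zero _ (Or.inl x)]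
    simp
  · have x := xb_le hR h
    simp only [ze, zep, zepp, Real.smoothTransition.zero_of_nonpos x, T1_zero _ (Or.inl x), T2_zero _ (Or.inl x)]
    simp

/-- the two annuli -/
def Xset (r R : ℝ) : Set ℝ := Icc (r / 4) (r / 2) ∪ Icc (R / 2) (3 * R / 4)

lemma zep_zero (hr : 0 < r) (hR : 0 < R) (hs : s ∉ Xset r R) :
    zep r R s = 0 ∧ zepp r R s = 0 := by
  simp only [Xset, mem_union, mem_Icc, not_or, not_and_or, not_le] at hs
  have a : T1 (4 / r * s - 1) = 0 ∧ T2 (4 / r * s - 1) = 0 := by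
    rcases hs.1 with h | h
    · have x := xa_le hr h.le
      exact ⟨T1_zero _ (Or.inl x), T2_zero _ (Or.inl x)⟩
    · have x := xa_ge hr h.le
      exact ⟨T1_zero _ (Or.inr x), T2_zero _ (Or.inr x)⟩
  have b : T1 (3 - 4 / R * s) = 0 ∧ T2 (3 - 4 / R * s) = 0 := by
    rcases hs.2 with h | h
    · have x := xb_ge hR h.le
      exact ⟨T1_zero _ (Or.inr x), T2_zero _ (Or.inr x)⟩
    · have x := xb_le hR h.le
      exact ⟨T1_zero _ (Or.inl x), T2_zero _ (Or.inl x)⟩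
  simp [zep, zepp, a.1, a.2, b.1, b.2]

lemma za_bound {M : ℝ} (hM : 1 ≤ M) {g : ℝ → ℝ} (hg : ∀ x, |g x| ≤ M) (hz : ∀ x, x ≤ 0 ∨ 1 ≤ x → g x = 0)
    (hr : 0 < r) (hs : 0 < s) : |g (4 / r * s - 1)| * (s * (4 / r)) ≤ 2 * M := by
  by_cases h : r / 2 ≤ s
  · rw [hz _ (Or.inr (xa_ge hr h))]; simp; linarith
  · push Not at h
    have : s * (4 / r) ≤ 2 := by rw [← mul_div_assoc, div_le_iff₀ hr]; linarith
    calc _ ≤ M * 2 := mul_le_mul (hg _) this (by positivity) (by linarith)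
      _ = _ := by ring

lemma zb_bound {M : ℝ} (hM : 1 ≤ M) {g : ℝ → ℝ} (hg : ∀ x, |g x| ≤ M) (hz : ∀ x, x ≤ 0 ∨ 1 ≤ x → g x = 0)
    (hR : 0 < R) (hs : 0 < s) : |g (3 - 4 / R * s)| * (s * (4 / R)) ≤ 3 * M := by
  by_cases h : 3 * R / 4 ≤ s
  · rw [hz _ (Or.inl (xb_le hR h))]; simp; linarith
  · push Not at h
    have : s * (4 / R) ≤ 3 := by rw [← mul_div_assoc, div_le_iff₀ hR]; linarith
    calc _ ≤ M * 3 := mul_le_mul (hg _) this (by positivity) (by linarith)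
      _ = _ := by ring

lemma za_le {g : ℝ → ℝ} (hz : ∀ x, x ≤ 0 ∨ 1 ≤ x → g x = 0)
    (hr : 0 < r) (hs : 0 < s) : |g (4 / r * s - 1)| * (s * (4 / r)) ^ 2 ≤ 2 * (|g (4 / r * s - 1)| * (s * (4 / r))) := by
  by_cases h : r / 2 ≤ s
  · rw [hz _ (Or.inr (xa_ge hr h))]; simp
  · push Not at h
    have : s * (4 / r) ≤ 2 := by rw [← mul_div_assoc, div_le_iff₀ hr]; linarith
    have h2 : 0 ≤ |g (4 / r * s - 1)| * (s * (4 / r)) := by positivity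
    calc _ = |g (4 / r * s - 1)| * (s * (4 / r)) * (s * (4 / r)) := by ring
      _ ≤ |g (4 / r * s - 1)| * (s * (4 / r)) * 2 := by gcongr
      _ = _ := by ring

lemma zb_le {g : ℝ → ℝ} (hz : ∀ x, x ≤ 0 ∨ 1 ≤ x → g x = 0)
    (hR : 0 < R) (hs : 0 < s) : |g (3 - 4 / R * s)| * (s * (4 / R)) ^ 2 ≤ 3 * (|g (3 - 4 / R * s)| * (s * (4 / R))) := by
  by_cases h : 3 * R / 4 ≤ s
  · rw [hz _ (Or.inl (xb_le hR h))]; simp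
  · push Not at h
    have : s * (4 / R) ≤ 3 := by rw [← mul_div_assoc, div_le_iff₀ hR]; linarith
    have h2 : 0 ≤ |g (3 - 4 / R * s)| * (s * (4 / R)) := by positivity
    calc _ = |g (3 - 4 / R * s)| * (s * (4 / R)) * (s * (4 / R)) := by ring
      _ ≤ |g (3 - 4 / R * s)| * (s * (4 / R)) * 3 := by gcongr
      _ = _ := by ring
end

lemma abs_mul_le_of {x t B : ℝ} (h : |x| ≤ B) (h0 : 0 ≤ t) (h1 : t ≤ 1) : |x * t| ≤ B := by
  rw [abs_mul, abs_of_nonneg h0]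
  exact (mul_le_of_le_one_right (abs_nonneg _) h1).trans h

lemma ze_bounds : ∃ C0 : ℝ, 1 ≤ C0 ∧ ∀ r R s : ℝ, 0 < r → 0 < R → 0 < s →
    |s * zep r R s| ≤ C0 ∧ |s ^ 2 * zepp r R s| ≤ C0 := by
  obtain ⟨M, hM, hT⟩ := T_bound
  refine ⟨30 * M ^ 2, by nlinarith, fun r R s hr hR hs => ?_⟩
  have hMM : M ≤ M ^ 2 := by nlinarith
  have a1 := za_bound hM (fun x => (hT x).1) T1_zero hr hs
  have a2 := za_bound hM (fun x => (hT x).2) T2_zero hr hs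
  have b1 := zb_bound hM (fun x => (hT x).1) T1_zero hR hs
  have b2 := zb_bound hM (fun x => (hT x).2) T2_zero hR hs
  have a3 := za_le T2_zero hr hs
  have b3 := zb_le T2_zero hR hs
  have ha : 0 < s * (4 / r) := by positivity
  have hb : 0 < s * (4 / R) := by positivity
  have ta := Real.smoothTransition.nonneg (4 / r * s - 1)
  have ta' := Real.smoothTransition.le_one (4 / r * s - 1)
  have tb := Real.smoothTransition.nonneg (3 - 4 / R * s)
  have tb' := Real.smoothTransition.le_one (3 - 4 / R * s)
  unfold zep zepp
  generalize Real.smoothTransition (4 / r * s - 1) = x at *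
  generalize Real.smoothTransition (3 - 4 / R * s) = y at *
  generalize T1 (4 / r * s - 1) = x1 at *
  generalize T1 (3 - 4 / R * s) = y1 at *
  generalize T2 (4 / r * s - 1) = x2 at *
  generalize T2 (3 - 4 / R * s) = y2 at *
  have A1 : |x1 * (s * (4 / r))| ≤ 2 * M := by rw [abs_mul, abs_of_pos ha]; exact a1
  have B1 : |y1 * (s * (4 / R))| ≤ 3 * M := by rw [abs_mul, abs_of_pos hb]; exact b1
  have A2 : |x2 * (s * (4 / r)) ^ 2| ≤ 4 * M := by
    rw [abs_mul, abs_of_pos (by positivity : 0 < (s * (4 / r)) ^ 2)]; linarith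
  have B2 : |y2 * (s * (4 / R)) ^ 2| ≤ 9 * M := by
    rw [abs_mul, abs_of_pos (by positivity : 0 < (s * (4 / R)) ^ 2)]; linarith
  have AB : |(x1 * (s * (4 / r))) * (y1 * (s * (4 / R)))| ≤ 6 * M ^ 2 := by
    rw [abs_mul]
    calc _ ≤ (2 * M) * (3 * M) := mul_le_mul A1 B1 (abs_nonneg _) (by linarith)
      _ = _ := by ring
  constructor
  · have e : s * (x1 * (4 / r) * y + x * (y1 * -(4 / R))) =
        (x1 * (s * (4 / r))) * y - (y1 * (s * (4 / R))) * x := by ring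
    rw [e]
    have i1 := abs_mul_le_of A1 tb tb'
    have i2 := abs_mul_le_of B1 ta ta'
    exact (abs_sub _ _).trans (by linarith)
  · have e : s ^ 2 * (x2 * (4 / r) * (4 / r) * y + x1 * (4 / r) * (y1 * -(4 / R)) +
        (x1 * (4 / r) * (y1 * -(4 / R)) + x * (y2 * -(4 / R) * -(4 / R)))) =
        (x2 * (s * (4 / r)) ^ 2) * y + (y2 * (s * (4 / R)) ^ 2) * x
          - 2 * ((x1 * (s * (4 / r))) * (y1 * (s * (4 / R)))) := by ring
    rw [e]
    have i1 := abs_mul_le_of A2 tb tb'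
    have i2 := abs_mul_le_of B2 ta ta'
    rw [abs_le] at *
    constructor <;> linarith [i1.1, i1.2, i2.1, i2.2, AB.1, AB.2]

section
variable {A : E m k → Matrix (Fin (m + k)) (Fin (m + k)) ℝ}

/-- the density g = ω w² ψ u² ρ⁻² -/
def gde (γ C α : ℝ) (u : E m k → ℝ) (p : E m k) : ℝ :=
  om (QQ m k γ) (rho γ p) * wt C α (rho γ p) ^ 2 * psi γ p * u p ^ 2 / rho γ p ^ 2

lemma psi_nonneg (p : E m k) : 0 ≤ psi γ p :=
  div_nonneg (rpow_nonneg (norm_nonneg _) _) (rpow_nonneg (rho_nonneg _ _) _)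

lemma psi_le_one (hγ : 0 < γ) (p : E m k) : psi γ p ≤ 1 := by
  unfold psi
  exact div_le_one_of_le₀ (rpow_le_rpow (norm_nonneg _) (norm_fst_le_rho hγ p) (by positivity))
    (rpow_nonneg (rho_nonneg _ _) _)

/-- the integrand -/
def Jf (γ lam C α C0 r R : ℝ) (u : E m k → ℝ) (p : E m k) : ℝ :=
  {q : E m k | rho γ q ∈ Icc (r / 4) (3 * R / 4)}.indicator
      (fun q => lam * α ^ 3 * (rho γ q * ze r R (rho γ q) ^ 2) * gde γ C α u q) p
    - {q : E m k | rho γ q ∈ Xset r R}.indicator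
      (fun q => lam⁻¹ * (500 * C0 ^ 2 * α ^ 2) * gde γ C α u q) p

set_option maxHeartbeats 1000000 in
lemma J_le (hγ : 0 < γ) (hlam : 0 < lam) (hC : C1coeff A) (hS : Symm A) (hE : Elliptic lam A)
    {C α K C0 r R : ℝ} (hG : Geo γ C A) (hC1 : 1 ≤ C) (hQ : 2 ≤ QQ m k γ) (hC0 : 1 ≤ C0)
    (hbd : ∀ r R s : ℝ, 0 < r → 0 < R → 0 < s → |s * zep r R s| ≤ C0 ∧ |s ^ 2 * zepp r R s| ≤ C0)
    (hr : 0 < r) (hR : R * (100 * C) ≤ 1) (hrR : r ≤ R)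
    {p : E m k} (hp : p.1 ≠ 0) (hpR : rho γ p ≤ R)
    {V u : E m k → ℝ} (hV : DifferentiableAt ℝ V p) (hu : ContDiffAt ℝ 2 u p) (hK : 0 ≤ K)
    (hVK : |V p| ≤ K * (th γ A p * rho γ p ^ 2)) (hFVK : |Fd γ A V p| ≤ K * (th γ A p * rho γ p ^ 2))
    (hsol : Div (Yv γ A u) p + V p * u p = 0)
    (a1 : 10 * (QQ m k γ + 1) ≤ α) (a2 : 10 * C ≤ α) (a3 : (86 * C) ^ 2 ≤ α)
    (a4 : 60 * C * K ≤ α ^ 2) :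
    Jf γ lam C α C0 r R u p ≤ Div (WT γ A C α (ze r R) (zep r R) V u) p := by
  have hR0 : 0 < R := hr.trans_le hrR
  have hρ := rho_pos hγ (ne_zero_of_fst hp)
  have hCR : C * rho γ p ≤ C * R := by gcongr
  have hp1 : 10 * C * rho γ p ≤ 1 / 10 := by nlinarith
  have hp2 : rho γ p < 1 := by nlinarith
  refine le_trans ?_ (final_pt hγ hlam hC hS hE hG hC1 hQ hp hp1 hV hu hK hVK hFVK hsol a1 a2 a3 a4
    (cut_ze r R) (contDiff_ze r R))
  have hmu := mu_bounds hγ hE hp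
  have hom := om_pos (Q := QQ m k γ) hρ
  have hw := wt_pos C α (rho γ p)
  have hα : 10 ≤ α := by linarith
  have he1 := e1_bound hγ hlam hE hG hp hp2
  -- theta bounds
  have t1 : lam * psi γ p / rho γ p ^ 2 ≤ th γ A p := by unfold th; gcongr; exact hmu.1
  have t2 : th γ A p ≤ lam⁻¹ * psi γ p / rho γ p ^ 2 := by unfold th; gcongr; exact hmu.2
  have gnn : 0 ≤ gde γ C α u p := by
    have := psi_nonneg (γ := γ) p
    unfold gde; positivity
  -- bracket
  have hbr : 24 * K * rho γ p ^ 2 * (rho γ p * zep r R (rho γ p)) ^ 2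
          + 48 * cc C α (QQ m k γ) (zep r R) (zepp r R) (rho γ p) ^ 2
          + 3 * (rho γ p ^ 2 * zepp r R (rho γ p) + rho γ p * zep r R (rho γ p) * (QQ m k γ - 1 + e1 γ A p)) ^ 2
      ≤ {q : E m k | rho γ q ∈ Xset r R}.indicator (fun _ => 500 * C0 ^ 2 * α ^ 2) p := by
    by_cases hX : rho γ p ∈ Xset r R
    · rw [indicator_of_mem (show p ∈ {q : E m k | rho γ q ∈ Xset r R} from hX)]
      obtain ⟨b1, b2⟩ := hbd r R (rho γ p) hr hR0 hρ
      have hg : |(2 - QQ m k γ) / 2 - gg C α (rho γ p) + 1| ≤ 2 * α := by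
        have g0 : 0 ≤ gg C α (rho γ p) := by unfold gg; apply mul_nonneg <;> linarith
        have g1 : gg C α (rho γ p) ≤ α := by
          unfold gg; apply mul_le_of_le_one_right (by linarith); nlinarith
        rw [abs_le]; constructor <;> linarith
      have hK2 : K * rho γ p ^ 2 ≤ α ^ 2 / 60 := by
        have x1 : K * rho γ p ^ 2 ≤ K * 1 := by gcongr; nlinarith
        have x2 : 60 * K ≤ 60 * C * K := by nlinarith
        linarith
      have hQ' : |QQ m k γ - 1 + e1 γ A p| ≤ QQ m k γ := by
        have := abs_le.1 he1
        rw [abs_le]; constructor <;> linarith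
      unfold cc
      generalize rho γ p * zep r R (rho γ p) = z at *
      generalize rho γ p ^ 2 * zepp r R (rho γ p) = z2 at *
      generalize (2 - QQ m k γ) / 2 - gg C α (rho γ p) + 1 = c at *
      generalize QQ m k γ - 1 + e1 γ A p = d at *
      have s1 : z ^ 2 ≤ C0 ^ 2 := sq_le_sq' (abs_le.1 b1).1 (abs_le.1 b1).2
      have s2 : |c * z + z2| ≤ 3 * (α * C0) := by
        refine (abs_add_le _ _).trans ?_
        rw [abs_mul]
        have : |c| * |z| ≤ (2 * α) * C0 := mul_le_mul hg b1 (abs_nonneg _) (by linarith)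
        have l1 : C0 ≤ α * C0 := le_mul_of_one_le_left (by linarith) (by linarith)
        linarith
      have s3 : |z2 + z * d| ≤ α * C0 := by
        refine (abs_add_le _ _).trans ?_
        rw [abs_mul]
        have : |z| * |d| ≤ C0 * QQ m k γ := mul_le_mul b1 hQ' (abs_nonneg _) (by linarith)
        have l1 : C0 * (QQ m k γ + 1) ≤ C0 * α := mul_le_mul_of_nonneg_left (by linarith) (by linarith)
        linarith
      have s2' : (c * z + z2) ^ 2 ≤ (3 * (α * C0)) ^ 2 := sq_le_sq' (abs_le.1 s2).1 (abs_le.1 s2).2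
      have s3' : (z2 + z * d) ^ 2 ≤ (α * C0) ^ 2 := sq_le_sq' (abs_le.1 s3).1 (abs_le.1 s3).2
      have s1' : 24 * K * rho γ p ^ 2 * z ^ 2 ≤ 24 * (α ^ 2 / 60) * C0 ^ 2 := by
        rw [mul_assoc 24 K]
        exact mul_le_mul (by linarith) s1 (sq_nonneg _) (by positivity)
      have : 0 ≤ α ^ 2 * C0 ^ 2 := by positivity
      linarith [mul_pow 3 (α * C0) 2, mul_pow α C0 2]
    · rw [indicator_of_notMem (show p ∉ {q : E m k | rho γ q ∈ Xset r R} from hX)]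
      obtain ⟨b1, b2⟩ := zep_zero hr hR0 hX
      simp [cc, b1, b2]
  have e1' : {q : E m k | rho γ q ∈ Icc (r / 4) (3 * R / 4)}.indicator
      (fun q => lam * α ^ 3 * (rho γ q * ze r R (rho γ q) ^ 2) * gde γ C α u q) p =
      lam * α ^ 3 * (rho γ p * ze r R (rho γ p) ^ 2) * gde γ C α u p := by
    by_cases h : p ∈ {q : E m k | rho γ q ∈ Icc (r / 4) (3 * R / 4)}
    · rw [indicator_of_mem h]
    · rw [indicator_of_notMem h]
      have h' : rho γ p ≤ r / 4 ∨ 3 * R / 4 ≤ rho γ p := by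
        simp only [mem_setOf_eq, mem_Icc, not_and_or, not_le] at h
        exact h.imp le_of_lt le_of_lt
      rw [(ze_zero hr hR0 h').1]; ring
  have e2' : {q : E m k | rho γ q ∈ Xset r R}.indicator
      (fun q => lam⁻¹ * (500 * C0 ^ 2 * α ^ 2) * gde γ C α u q) p =
      lam⁻¹ * {q : E m k | rho γ q ∈ Xset r R}.indicator (fun _ => 500 * C0 ^ 2 * α ^ 2) p * gde γ C α u p := by
    by_cases h : p ∈ {q : E m k | rho γ q ∈ Xset r R}
    · rw [indicator_of_mem h, indicator_of_mem h]
    · rw [indicator_of_notMem h, indicator_of_notMem h]; ring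
  rw [Jf, e1', e2']
  have inn : 0 ≤ {q : E m k | rho γ q ∈ Xset r R}.indicator (fun _ => 500 * C0 ^ 2 * α ^ 2) p :=
    indicator_nonneg (fun _ _ => by positivity) p
  generalize {q : E m k | rho γ q ∈ Xset r R}.indicator (fun _ => 500 * C0 ^ 2 * α ^ 2) p = I at *
  generalize 24 * K * rho γ p ^ 2 * (rho γ p * zep r R (rho γ p)) ^ 2
          + 48 * cc C α (QQ m k γ) (zep r R) (zepp r R) (rho γ p) ^ 2
          + 3 * (rho γ p ^ 2 * zepp r R (rho γ p) + rho γ p * zep r R (rho γ p) * (QQ m k γ - 1 + e1 γ A p)) ^ 2 = Br at *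
  generalize hX : om (QQ m k γ) (rho γ p) * wt C α (rho γ p) ^ 2 * u p ^ 2 = X
  have hX0 : 0 ≤ X := by rw [← hX]; positivity
  have hge : gde γ C α u p = X * (psi γ p / rho γ p ^ 2) := by rw [gde, ← hX]; ring
  have hth := th_pos hγ hlam hE hp
  have k1 : X * (lam * psi γ p / rho γ p ^ 2) * (α ^ 3 * rho γ p * ze r R (rho γ p) ^ 2)
      ≤ X * th γ A p * (α ^ 3 * rho γ p * ze r R (rho γ p) ^ 2) := by gcongr
  have k2 : X * th γ A p * Br ≤ X * (lam⁻¹ * psi γ p / rho γ p ^ 2) * I := by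
    calc X * th γ A p * Br ≤ X * th γ A p * I := by gcongr
      _ ≤ _ := by gcongr
  rw [hge]
  have f1 : lam * α ^ 3 * (rho γ p * ze r R (rho γ p) ^ 2) * (X * (psi γ p / rho γ p ^ 2)) =
    X * (lam * psi γ p / rho γ p ^ 2) * (α ^ 3 * rho γ p * ze r R (rho γ p) ^ 2) := by ring
  have f2 : lam⁻¹ * I * (X * (psi γ p / rho γ p ^ 2)) = X * (lam⁻¹ * psi γ p / rho γ p ^ 2) * I := by ring
  rw [f1, f2]
  have f3 : om (QQ m k γ) (rho γ p) * th γ A p * wt C α (rho γ p) ^ 2 * u p ^ 2 *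
      (α ^ 3 * rho γ p * ze r R (rho γ p) ^ 2 - Br) =
      X * th γ A p * (α ^ 3 * rho γ p * ze r R (rho γ p) ^ 2) - X * th γ A p * Br := by rw [← hX]; ring
  rw [f3]
  linarith
end
end BG
end

section
open scoped Topology
namespace BG
variable {m k : ℕ}
variable {γ lam Λ : ℝ}

section
variable {C α Q s r R : ℝ}
lemma cd_om (hs : 0 < s) : ContDiffAt ℝ 1 (om Q) s := by
  unfold om; exact contDiffAt_id.rpow_const_of_ne hs.ne'
lemma cd_gg : ContDiffAt ℝ 1 (gg C α) s := by unfold gg; fun_prop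
lemma cd_kap : ContDiffAt ℝ 1 (kap C α Q) s := by unfold kap gg; fun_prop
lemma cd_et (hs : 0 < s) : ContDiffAt ℝ 1 (et C α Q) s :=
  contDiffAt_const.mul (cd_gg.mul (cd_om hs))
lemma cd_Gt (hs : 0 < s) : ContDiffAt ℝ 1 (Gt C α Q) s :=
  contDiffAt_const.mul ((cd_gg.mul cd_kap).mul (cd_om hs))
lemma cd_ht (hs : 0 < s) : ContDiffAt ℝ 1 (ht C α Q) s :=
  contDiffAt_const.mul (contDiffAt_id.mul (cd_om hs))
lemma cd_ff (hs : 0 < s) : ContDiffAt ℝ 2 (ff C α (ze r R)) s :=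
  (contDiffAt_wt hs).mul (contDiff_ze r R).contDiffAt
lemma cd_ff' (hs : 0 < s) : ContDiffAt ℝ 1 (ff' C α (ze r R) (zep r R)) s :=
  (contDiffAt_wt hs).mul ((contDiff_zep r R).contDiffAt.sub
    ((cd_gg.div contDiffAt_id hs.ne').mul ((contDiff_ze r R).of_le (by norm_num)).contDiffAt))
lemma cd_NN (hs : 0 < s) : ContDiffAt ℝ 1 (NN C α Q (zep r R)) s :=
  ((cd_om hs).mul ((contDiffAt_wt hs).pow 2)).mul ((contDiffAt_id.mul (contDiff_zep r R).contDiffAt).pow 2)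
end

/-- closed gauge annulus -/
def Ann (γ a b : ℝ) : Set (E m k) := {p | rho γ p ∈ Icc a b}

lemma isCompact_le (hγ : 0 < γ) (b : ℝ) : IsCompact {p : E m k | rho γ p ≤ b} := by
  have hb : Bornology.IsBounded {p : E m k | rho γ p ≤ b} := by
    refine (isBounded_iff_forall_norm_le).2 ⟨max b (b ^ (γ + 1)), fun p hp => ?_⟩
    have hp' : rho γ p ≤ b := hp
    rw [Prod.norm_def]
    refine max_le_max ((norm_fst_le_rho hγ p).trans hp') ?_
    have h := norm_snd_le_rho hγ p
    have h2 : rho γ p ^ (γ + 1) ≤ b ^ (γ + 1) := rpow_le_rpow (rho_nonneg _ _) hp' (by linarith)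
    have h3 : 0 ≤ γ * ‖p.2‖ := by positivity
    linarith
  exact Metric.isCompact_of_isClosed_isBounded (isClosed_le (continuous_rho hγ) continuous_const) hb

lemma isCompact_Ann (hγ : 0 < γ) (a b : ℝ) : IsCompact (Ann (m := m) (k := k) γ a b) :=
  (isCompact_le hγ b).of_isClosed_subset (isClosed_Icc.preimage (continuous_rho hγ)) (fun _ hp => hp.2)

lemma ne_zero_of_rho (hγ : 0 < γ) {p : E m k} (h : 0 < rho γ p) : p ≠ 0 := by
  rintro rfl; rw [rho_zero hγ] at h; exact lt_irrefl _ h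

section
variable {A : E m k → Matrix (Fin (m + k)) (Fin (m + k)) ℝ} {C α r R : ℝ} {V u : E m k → ℝ}

/-- the cutoff-weighted function -/
def vv (γ C α r R : ℝ) (u : E m k → ℝ) (q : E m k) : ℝ := ff C α (ze r R) (rho γ q) * u q

/-- outside of the support of the cutoff -/
def Out (γ r R : ℝ) : Set (E m k) := {q | rho γ q < r / 4 ∨ 3 * R / 4 < rho γ q}

lemma isOpen_Out (hγ : 0 < γ) : IsOpen (Out (m := m) (k := k) γ r R) :=
  (isOpen_lt (continuous_rho hγ) continuous_const).union (isOpen_lt continuous_const (continuous_rho hγ))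

lemma Out_or (p : E m k) : p ∈ Out γ r R ∨ p ∈ Ann γ (r / 4) (3 * R / 4) := by
  simp only [Out, Ann, mem_setOf_eq, mem_Icc]
  by_cases h1 : rho γ p < r / 4
  · exact Or.inl (Or.inl h1)
  · by_cases h2 : 3 * R / 4 < rho γ p
    · exact Or.inl (Or.inr h2)
    · exact Or.inr ⟨not_lt.1 h1, not_lt.1 h2⟩

lemma ze_Out (hr : 0 < r) (hR : 0 < R) {q : E m k} (hq : q ∈ Out γ r R) :
    ze r R (rho γ q) = 0 ∧ zep r R (rho γ q) = 0 :=
  let h := ze_zero (s := rho γ q) hr hR (hq.imp le_of_lt le_of_lt)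
  ⟨h.1, h.2.1⟩

lemma vv_Out (hγ : 0 < γ) (hr : 0 < r) (hR : 0 < R) {q : E m k} (hq : q ∈ Out γ r R) :
    vv γ C α r R u =ᶠ[𝓝 q] fun _ => 0 := by
  filter_upwards [(isOpen_Out hγ).mem_nhds hq] with x hx
  rw [vv, ff, (ze_Out hr hR hx).1]; ring

lemma WT_eq (q : E m k) : WT γ A C α (ze r R) (zep r R) V u q =
    (24 : ℝ) • W4 γ A (NN C α (QQ m k γ) (zep r R)) u q - CW γ A C α V (vv γ C α r R u) q := rfl

lemma WT_Out (hγ : 0 < γ) (hr : 0 < r) (hR : 0 < R) {q : E m k} (hq : q ∈ Out γ r R) :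
    WT γ A C α (ze r R) (zep r R) V u q = 0 := by
  have hv := vv_Out (C := C) (α := α) (u := u) hγ hr hR hq
  have h0 : vv γ C α r R u q = 0 := hv.eq_of_nhds
  have hf : fderiv ℝ (vv γ C α r R u) q = 0 := by rw [hv.fderiv_eq]; simp
  have hD : ∀ j, Dc (vv γ C α r R u) q j = 0 := fun j => by rw [Dc, hf]; simp
  have hY : Yv γ A (vv γ C α r R u) q = 0 := by simp [Yv, hD]
  have hq' : quadA γ A (vv γ C α r R u) q = 0 := by rw [quadA_eq]; simp [hD]
  have hN : NN C α (QQ m k γ) (zep r R) (rho γ q) = 0 := by rw [NN, (ze_Out hr hR hq).2]; ring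
  rw [WT_eq]
  simp only [CW, W1, W2, W4, hN, hY, hq', h0]
  simp

lemma contDiffAt_th (hγ : 0 < γ) (hC : C1coeff A) {p : E m k} (hp : p.1 ≠ 0) :
    ContDiffAt ℝ 1 (th γ A) p :=
  (contDiffAt_mu hγ hC hp).div ((contDiffAt_rho hγ hp).pow 2)
    (pow_ne_zero _ (rho_pos hγ (ne_zero_of_fst hp)).ne')

lemma contDiffAt_WT (hγ : 0 < γ) (hlam : 0 < lam) (hC : C1coeff A) (hE : Elliptic lam A)
    {p : E m k} (hp : p.1 ≠ 0) (hV : ContDiffAt ℝ 1 V p) (hu : ContDiffAt ℝ 2 u p) :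
    ContDiffAt ℝ 1 (WT γ A C α (ze r R) (zep r R) V u) p := by
  have hρ := rho_pos hγ (ne_zero_of_fst hp)
  have hv : ContDiffAt ℝ 2 (vv γ C α r R u) p := (contDiffAt_radial hγ hp (cd_ff hρ)).mul hu
  have hv1 := hv.of_le (show (1 : WithTop ℕ∞) ≤ 2 by norm_num)
  have hu1 := hu.of_le (show (1 : WithTop ℕ∞) ≤ 2 by norm_num)
  have fF := contDiffAt_Ff hγ hlam hC hE hp
  have fX := contDiffAt_Fd hγ hlam hC hE hp hv
  have fY := contDiffAt_Yv (γ := γ) hC hp hv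
  have fq := contDiffAt_quadA (γ := γ) hC hp hv
  have fe := contDiffAt_radial hγ hp (cd_et (C := C) (α := α) (Q := QQ m k γ) hρ)
  have fG := contDiffAt_radial hγ hp (cd_Gt (C := C) (α := α) (Q := QQ m k γ) hρ)
  have fh := contDiffAt_radial hγ hp (cd_ht (C := C) (α := α) (Q := QQ m k γ) hρ)
  have fN := contDiffAt_radial hγ hp (cd_NN (C := C) (α := α) (Q := QQ m k γ) (r := r) (R := R) hρ)
  have w1 : ContDiffAt ℝ 1 (W1 γ A (et C α (QQ m k γ)) (vv γ C α r R u)) p :=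
    ((contDiffAt_const.mul (fe.mul fX)).smul fY).sub ((fe.mul fq).smul fF)
  have w2 : ContDiffAt ℝ 1 (W2 γ A (Gt C α (QQ m k γ)) (th γ A) (vv γ C α r R u)) p :=
    (fG.mul ((contDiffAt_th hγ hC hp).mul (hv1.pow 2))).smul fF
  have w3 : ContDiffAt ℝ 1 (W2 γ A (et C α (QQ m k γ)) V (vv γ C α r R u)) p :=
    (fe.mul (hV.mul (hv1.pow 2))).smul fF
  have w4 : ContDiffAt ℝ 1 (W4 γ A (ht C α (QQ m k γ)) (vv γ C α r R u)) p :=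
    (fh.mul hv1).smul fY
  have w5 : ContDiffAt ℝ 1 (W4 γ A (NN C α (QQ m k γ) (zep r R)) u) p :=
    (fN.mul hu1).smul (contDiffAt_Yv (γ := γ) hC hp hu)
  exact (w5.const_smul (24 : ℝ)).sub (((w1.add w2).add w3).sub w4)

/-- Euler field derivative -/
def Zu (γ : ℝ) (u : E m k → ℝ) (q : E m k) : ℝ := ∑ j, cz γ j * co j q * Dc u q j

/-- coefficient of the model field -/
def aco (γ C α r R : ℝ) (X u : E m k → ℝ) (q : E m k) : ℝ :=
  24 * (NN C α (QQ m k γ) (zep r R) (rho γ q) * u q)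
    - 2 * (et C α (QQ m k γ) (rho γ q) * (ff C α (ze r R) (rho γ q) * X q
        + u q * (ff' C α (ze r R) (zep r R) (rho γ q) * rho γ q))) * ff C α (ze r R) (rho γ q)
    + ht C α (QQ m k γ) (rho γ q) * (ff C α (ze r R) (rho γ q) * u q) * ff C α (ze r R) (rho γ q)

/-- z-part of Y -/
def Yz (A : E m k → Matrix (Fin (m + k)) (Fin (m + k)) ℝ) (u : E m k → ℝ) (i : Fin (m + k)) (q : E m k) : ℝ :=
  ∑ j : Fin (m + k), if (j : ℕ) < m then A q i j * Dc u q j else 0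

/-- model field -/
def W0f (γ : ℝ) (A : E m k → Matrix (Fin (m + k)) (Fin (m + k)) ℝ) (C α r R : ℝ) (u : E m k → ℝ)
    (q : E m k) : E m k :=
  ∑ i : Fin (m + k), (aco γ C α r R (Zu γ u) u q * if (i : ℕ) < m then Yz A u i q else 0) • bas i

lemma W0f_Out (hr : 0 < r) (hR : 0 < R) {q : E m k} (hq : q ∈ Out γ r R) :
    W0f γ A C α r R u q = 0 := by
  have h := ze_Out hr hR hq
  have : aco γ C α r R (Zu γ u) u q = 0 := by
    simp [aco, NN, ff, h.1, h.2]
  simp [W0f, this]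

lemma contDiffAt_radial1 (hγ : 0 < γ) {p : E m k} (hp : 0 < rho γ p) {h : ℝ → ℝ}
    (hh : ContDiffAt ℝ 1 h (rho γ p)) : ContDiffAt ℝ 1 (fun q => h (rho γ q)) p :=
  hh.comp p (contDiffAt_rho_one hγ (ne_zero_of_rho hγ hp))

lemma contDiffAt_W0f (hγ : 0 < γ) (hC : C1coeff A) {p : E m k} (hρ : 0 < rho γ p)
    (hu : ContDiffAt ℝ 2 u p) : ContDiffAt ℝ 1 (W0f γ A C α r R u) p := by
  have hu1 := hu.of_le (show (1 : WithTop ℕ∞) ≤ 2 by norm_num)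
  have fe := contDiffAt_radial1 hγ hρ (cd_et (C := C) (α := α) (Q := QQ m k γ) hρ)
  have fh := contDiffAt_radial1 hγ hρ (cd_ht (C := C) (α := α) (Q := QQ m k γ) hρ)
  have fN := contDiffAt_radial1 hγ hρ (cd_NN (C := C) (α := α) (Q := QQ m k γ) (r := r) (R := R) hρ)
  have f1 := contDiffAt_radial1 hγ hρ ((cd_ff (C := C) (α := α) (r := r) (R := R) hρ).of_le
    (show (1 : WithTop ℕ∞) ≤ 2 by norm_num))
  have f2 := contDiffAt_radial1 hγ hρ (cd_ff' (C := C) (α := α) (r := r) (R := R) hρ)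
  have fr := contDiffAt_rho_one hγ (ne_zero_of_rho hγ hρ)
  have fD := fun j => contDiffAt_Dc hu j
  have fZ : ContDiffAt ℝ 1 (Zu γ u) p :=
    ContDiffAt.sum fun j _ => (contDiffAt_const.mul (co j).contDiff.contDiffAt).mul (fD j)
  have fa : ContDiffAt ℝ 1 (aco γ C α r R (Zu γ u) u) p :=
    ((contDiffAt_const.mul (fN.mul hu1)).sub ((contDiffAt_const.mul (fe.mul ((f1.mul fZ).add
      (hu1.mul (f2.mul fr))))).mul f1)).add ((fh.mul (f1.mul hu1)).mul f1)
  unfold W0f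
  refine ContDiffAt.sum fun i _ => (fa.mul ?_).smul contDiffAt_const
  split_ifs
  · unfold Yz
    refine ContDiffAt.sum fun j _ => ?_
    split_ifs
    · exact (hC i j).contDiffAt.mul (fD j)
    · exact contDiffAt_const
  · exact contDiffAt_const
end
end BG
end

section
open scoped Topology
namespace BG
variable {m k : ℕ}
variable {γ lam Λ : ℝ}

/-- bounded on S -/
def Bd (S : Set (E m k)) (g : E m k → ℝ) : Prop := ∃ M, 0 ≤ M ∧ ∀ p ∈ S, |g p| ≤ M
/-- bounded by a multiple of the norm of z on S -/
def Oz (S : Set (E m k)) (g : E m k → ℝ) : Prop := ∃ M, 0 ≤ M ∧ ∀ p ∈ S, |g p| ≤ M * ‖p.1‖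

section
variable {S T : Set (E m k)} {f g : E m k → ℝ}
lemma Bd.mul (hf : Bd S f) (hg : Bd S g) : Bd S (fun p => f p * g p) := by
  obtain ⟨a, ha, h1⟩ := hf; obtain ⟨b, hb, h2⟩ := hg
  refine ⟨a * b, by positivity, fun p hp => ?_⟩
  rw [abs_mul]; exact mul_le_mul (h1 p hp) (h2 p hp) (abs_nonneg _) ha
lemma Bd.add (hf : Bd S f) (hg : Bd S g) : Bd S (fun p => f p + g p) := by
  obtain ⟨a, ha, h1⟩ := hf; obtain ⟨b, hb, h2⟩ := hg
  exact ⟨a + b, by positivity, fun p hp => (abs_add_le _ _).trans (add_le_add (h1 p hp) (h2 p hp))⟩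
lemma Bd.sub (hf : Bd S f) (hg : Bd S g) : Bd S (fun p => f p - g p) := by
  obtain ⟨a, ha, h1⟩ := hf; obtain ⟨b, hb, h2⟩ := hg
  exact ⟨a + b, by positivity, fun p hp => (abs_sub _ _).trans (add_le_add (h1 p hp) (h2 p hp))⟩
lemma Bd.const (c : ℝ) : Bd S (fun _ => c) := ⟨|c|, abs_nonneg _, fun _ _ => le_rfl⟩
lemma Oz.add (hf : Oz S f) (hg : Oz S g) : Oz S (fun p => f p + g p) := by
  obtain ⟨a, ha, h1⟩ := hf; obtain ⟨b, hb, h2⟩ := hg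
  refine ⟨a + b, by positivity, fun p hp => (abs_add_le _ _).trans ?_⟩
  rw [add_mul]; exact add_le_add (h1 p hp) (h2 p hp)
lemma Bd.mul_Oz (hf : Bd S f) (hg : Oz S g) : Oz S (fun p => f p * g p) := by
  obtain ⟨a, ha, h1⟩ := hf; obtain ⟨b, hb, h2⟩ := hg
  refine ⟨a * b, by positivity, fun p hp => ?_⟩
  rw [abs_mul, mul_assoc]; exact mul_le_mul (h1 p hp) (h2 p hp) (abs_nonneg _) ha
lemma Oz.mul_Bd (hf : Oz S f) (hg : Bd S g) : Oz S (fun p => f p * g p) := by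
  have := hg.mul_Oz hf
  simpa only [mul_comm] using this
lemma Oz.zero : Oz S (fun _ => 0) := ⟨0, le_rfl, fun _ _ => by simp⟩
lemma Bd.sum {ι : Type} {t : Finset ι} {f : ι → E m k → ℝ} (h : ∀ i, Bd S (f i)) :
    Bd S (fun p => ∑ i ∈ t, f i p) := by
  classical
  induction t using Finset.induction_on with
  | empty => simpa using Bd.const 0
  | insert a s ha ih => simpa only [Finset.sum_insert ha] using (h a).add ih
lemma Oz.sum {ι : Type} {t : Finset ι} {f : ι → E m k → ℝ} (h : ∀ i, Oz S (f i)) :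
    Oz S (fun p => ∑ i ∈ t, f i p) := by
  classical
  induction t using Finset.induction_on with
  | empty => simpa using Oz.zero
  | insert a s ha ih => simpa only [Finset.sum_insert ha] using (h a).add ih
lemma Oz.congr (hf : Oz S f) (h : ∀ p ∈ S, g p = f p) : Oz S g := by
  obtain ⟨a, ha, h1⟩ := hf
  exact ⟨a, ha, fun p hp => by rw [h p hp]; exact h1 p hp⟩
lemma Bd.congr (hf : Bd S f) (h : ∀ p ∈ S, g p = f p) : Bd S g := by
  obtain ⟨a, ha, h1⟩ := hf
  exact ⟨a, ha, fun p hp => by rw [h p hp]; exact h1 p hp⟩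
lemma Bd.of_cont (hT : IsCompact T) (hST : S ⊆ T) (hf : ∀ p ∈ T, ContinuousAt f p) : Bd S f := by
  obtain ⟨M, hM⟩ := hT.exists_bound_of_continuousOn (f := f) fun p hp => (hf p hp).continuousWithinAt
  exact ⟨max M 0, le_max_right _ _, fun p hp => (hM p (hST hp)).trans (le_max_left _ _)⟩
end

section
variable {A : E m k → Matrix (Fin (m + k)) (Fin (m + k)) ℝ} {C α r R : ℝ} {V u : E m k → ℝ}

lemma continuousAt_Dc {v : E m k → ℝ} {p : E m k} (hv : ContDiffAt ℝ 1 v p) (j : Fin (m + k)) :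
    ContinuousAt (fun q => Dc v q j) p := by
  have h : ContDiffAt ℝ 0 (fderiv ℝ v) p := hv.fderiv_right (m := 0) (by norm_num)
  exact h.continuousAt.clm_apply continuousAt_const

lemma continuous_dd (hγ : 0 < γ) (i : Fin (m + k)) : Continuous (fun q : E m k => dd γ i q) := by
  unfold dd
  split_ifs
  · exact continuous_const
  · exact continuous_fst.norm.rpow_const fun _ => Or.inr hγ.le

/-- second coefficient -/
def bco (γ : ℝ) (A : E m k → Matrix (Fin (m + k)) (Fin (m + k)) ℝ) (C α r R : ℝ) (V u : E m k → ℝ)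
    (q : E m k) : ℝ :=
  et C α (QQ m k γ) (rho γ q) * quadA γ A (vv γ C α r R u) q
  - 2 * (et C α (QQ m k γ) (rho γ q) * (ff C α (ze r R) (rho γ q) * Fd γ A u q
        + u q * (ff' C α (ze r R) (zep r R) (rho γ q) * rho γ q)))
      * (u q * (ff' C α (ze r R) (zep r R) (rho γ q) * (rho γ q * th γ A q)))
  - Gt C α (QQ m k γ) (rho γ q) * (th γ A q * vv γ C α r R u q ^ 2)
  - et C α (QQ m k γ) (rho γ q) * (V q * vv γ C α r R u q ^ 2)
  + ht C α (QQ m k γ) (rho γ q) * vv γ C α r R u q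
      * (u q * (ff' C α (ze r R) (zep r R) (rho γ q) * (rho γ q * th γ A q)))

lemma WT_split (hγ : 0 < γ) (hlam : 0 < lam) (hE : Elliptic lam A) {p : E m k}
    (hp : p.1 ≠ 0) (hu : DifferentiableAt ℝ u p) :
    WT γ A C α (ze r R) (zep r R) V u p
      = aco γ C α r R (Fd γ A u) u p • Yv γ A u p + bco γ A C α r R V u p • Ff γ A p := by
  have hρ := rho_pos hγ (ne_zero_of_fst hp)
  have hf := hd_ff (C := C) (α := α) hρ (cut_ze r R)
  have hY := Yv_mul (A := A) hγ hlam hE hp hf hu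
  have hF := Fd_prod (A := A) hγ hlam hE hp hf hu
  have hY' : Yv γ A (vv γ C α r R u) p = ff C α (ze r R) (rho γ p) • Yv γ A u p
      + (u p * (ff' C α (ze r R) (zep r R) (rho γ p) * (rho γ p * th γ A p))) • Ff γ A p := hY
  have hF' : Fd γ A (vv γ C α r R u) p = ff C α (ze r R) (rho γ p) * Fd γ A u p
      + u p * (ff' C α (ze r R) (zep r R) (rho γ p) * rho γ p) := hF
  rw [WT_eq]
  simp only [CW, W1, W2, W4, hY', hF', aco, bco]
  simp only [vv]
  module

set_option maxHeartbeats 1000000 in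
lemma diff_bound (hγ : 0 < γ) (hlam : 0 < lam) (hC : C1coeff A) (hE : Elliptic lam A)
    (hG : Geo γ C A) (hr : 0 < r) (hR : 0 < R) (hR1 : R ≤ 1)
    (hu : ∀ p, rho γ p < 1 → ContDiffAt ℝ 2 u p) {K : ℝ} (hK : 0 ≤ K)
    (hV : ∀ p : E m k, p.1 ≠ 0 → rho γ p < 1 → |V p| ≤ K) :
    ∃ M, ∀ p : E m k, p.1 ≠ 0 →
      ‖(WT γ A C α (ze r R) (zep r R) V u p - W0f γ A C α r R u p).1‖ ≤ M * ‖p.1‖ := by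
  obtain ⟨T, hT⟩ : ∃ T : Set (E m k), T = Ann γ (r / 4) (3 * R / 4) := ⟨_, rfl⟩
  obtain ⟨S, hS⟩ : ∃ S : Set (E m k), S = {p | p.1 ≠ 0 ∧ p ∈ T} := ⟨_, rfl⟩
  have hTc : IsCompact T := hT ▸ isCompact_Ann hγ _ _
  have hST : S ⊆ T := fun p hp => by rw [hS] at hp; exact hp.2
  have h0 : ∀ p ∈ S, p.1 ≠ 0 := fun p hp => by rw [hS] at hp; exact hp.1
  have hT1 : ∀ p ∈ T, 0 < rho γ p ∧ rho γ p < 1 := by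
    intro p hp
    rw [hT] at hp
    have h1 : r / 4 ≤ rho γ p := hp.1
    have h2 : rho γ p ≤ 3 * R / 4 := hp.2
    constructor <;> linarith
  have u1 : ∀ p ∈ T, ContDiffAt ℝ 1 u p := fun p hp => (hu p (hT1 p hp).2).of_le (by norm_num)
  have ofr : ∀ h : ℝ → ℝ, (∀ s, 0 < s → ContinuousAt h s) → Bd S (fun q => h (rho γ q)) := by
    intro h hh
    exact Bd.of_cont hTc hST fun p hp =>
      ContinuousAt.comp (hh _ (hT1 p hp).1) (continuous_rho hγ).continuousAt
  have be : Bd S (fun q => et C α (QQ m k γ) (rho γ q)) := ofr _ fun s hs => (cd_et hs).continuousAt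
  have bh : Bd S (fun q => ht C α (QQ m k γ) (rho γ q)) := ofr _ fun s hs => (cd_ht hs).continuousAt
  have bG : Bd S (fun q => Gt C α (QQ m k γ) (rho γ q)) := ofr _ fun s hs => (cd_Gt hs).continuousAt
  have bN : Bd S (fun q => NN C α (QQ m k γ) (zep r R) (rho γ q)) := ofr _ fun s hs => (cd_NN hs).continuousAt
  have b1 : Bd S (fun q => ff C α (ze r R) (rho γ q)) := ofr _ fun s hs => (cd_ff hs).continuousAt
  have b2 : Bd S (fun q => ff' C α (ze r R) (zep r R) (rho γ q)) := ofr _ fun s hs => (cd_ff' hs).continuousAt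
  have br : Bd S (fun q => rho γ q) := ofr (fun s => s) fun s hs => continuousAt_id
  have bu : Bd S u := Bd.of_cont hTc hST fun p hp => (u1 p hp).continuousAt
  have bD : ∀ j, Bd S (fun q => Dc u q j) := fun j =>
    Bd.of_cont hTc hST fun p hp => continuousAt_Dc (u1 p hp) j
  have bA : ∀ i j, Bd S (fun q => A q i j) := fun i j =>
    Bd.of_cont hTc hST fun p hp => (hC i j).continuous.continuousAt
  have bd : ∀ i, Bd S (fun q => dd γ i q) := fun i =>
    Bd.of_cont hTc hST fun p hp => (continuous_dd hγ i).continuousAt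
  have bcA : ∀ i j, Bd S (fun q => cA γ A i j q) := fun i j => ((bd i).mul (bd j)).mul (bA i j)
  have bv : Bd S (fun q => vv γ C α r R u q) := b1.mul bu
  have hv : ∀ p ∈ T, ContDiffAt ℝ 1 (vv γ C α r R u) p := fun p hp =>
    (contDiffAt_radial1 hγ (hT1 p hp).1 ((cd_ff (hT1 p hp).1).of_le (by norm_num))).mul (u1 p hp)
  have bDv : ∀ j, Bd S (fun q => Dc (vv γ C α r R u) q j) := fun j =>
    Bd.of_cont hTc hST fun p hp => continuousAt_Dc (hv p hp) j
  have bq : Bd S (fun q => quadA γ A (vv γ C α r R u) q) :=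
    (Bd.sum (t := Finset.univ) fun i => Bd.sum (t := Finset.univ) fun j =>
      ((bcA i j).mul (bDv i)).mul (bDv j)).congr fun p _ => quadA_eq _ _ _ _
  have bF : ∀ j, Bd S (fun q => co j (Ff γ A q)) := fun j =>
    ⟨|C|, abs_nonneg _, fun p hp => (hG.hco p (h0 p hp) (hT1 p (hST hp)).2 j).trans (le_abs_self _)⟩
  have bX : Bd S (fun q => Fd γ A u q) :=
    (Bd.sum (t := Finset.univ) fun j => (bF j).mul (bD j)).congr fun p _ => fderiv_eq_sum _ _ _
  have bV : Bd S V := ⟨K, hK, fun p hp => hV p (h0 p hp) (hT1 p (hST hp)).2⟩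
  have bt : Bd S (fun q => th γ A q) := by
    refine ⟨lam⁻¹ / (r / 4) ^ 2, by positivity, fun p hp => ?_⟩
    have hρ := (hT1 p (hST hp)).1
    rw [abs_of_pos (th_pos hγ hlam hE (h0 p hp)), th]
    have hh : r / 4 ≤ rho γ p := by have := hST hp; rw [hT] at this; exact this.1
    have hmu := (mu_bounds hγ hE (h0 p hp)).2
    have hps := psi_le_one hγ p
    have hl : 0 < lam⁻¹ := inv_pos.2 hlam
    have h3 : mu γ A p ≤ lam⁻¹ := hmu.trans (by nlinarith)
    gcongr
  have bzj : ∀ j, Bd S (fun q => co j q) := fun j =>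
    Bd.of_cont hTc hST fun p hp => (co j).continuous.continuousAt
  have bZ : Bd S (fun q => Zu γ u q) :=
    Bd.sum (t := Finset.univ) fun j => ((Bd.const (cz γ j)).mul (bzj j)).mul (bD j)
  have ba0 : Bd S (fun q => aco γ C α r R (Zu γ u) u q) :=
    (((Bd.const 24).mul (bN.mul bu)).sub (((Bd.const 2).mul (be.mul ((b1.mul bZ).add
      (bu.mul (b2.mul br))))).mul b1)).add ((bh.mul (b1.mul bu)).mul b1)
  have bv2 : Bd S (fun q => vv γ C α r R u q ^ 2) := (bv.mul bv).congr fun p _ => pow_two _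
  have bb : Bd S (fun q => bco γ A C α r R V u q) :=
    ((((be.mul bq).sub (((Bd.const 2).mul (be.mul ((b1.mul bX).add (bu.mul (b2.mul br))))).mul
      (bu.mul (b2.mul (br.mul bt))))).sub (bG.mul (bt.mul bv2))).sub (be.mul (bV.mul bv2))).add
      ((bh.mul bv).mul (bu.mul (b2.mul (br.mul bt))))
  have oFZ : Oz S (fun q => Fd γ A u q - Zu γ u q) := by
    have : ∀ j, Oz S (fun q => co j (Ff γ A q) - cz γ j * co j q) := fun j =>
      ⟨|C|, abs_nonneg _, fun p hp => (hG.hEr p (h0 p hp) (hT1 p (hST hp)).2 j).trans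
        (mul_le_mul_of_nonneg_right (le_abs_self _) (norm_nonneg _))⟩
    refine (Oz.sum (t := Finset.univ) fun j => (this j).mul_Bd (bD j)).congr fun p _ => ?_
    rw [Fd, fderiv_eq_sum, Zu, ← Finset.sum_sub_distrib]
    exact Finset.sum_congr rfl fun j _ => by ring
  have oa : Oz S (fun q => aco γ C α r R (Fd γ A u) u q - aco γ C α r R (Zu γ u) u q) := by
    refine ((((Bd.const (-2)).mul (be.mul (b1.mul b1)))).mul_Oz oFZ).congr fun p _ => ?_
    simp only [aco]; ring
  have bY : ∀ i, Bd S (fun q => co i (Yv γ A u q)) := fun i =>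
    (Bd.sum (t := Finset.univ) fun j => (bcA i j).mul (bD j)).congr fun p _ => co_Yv _ _ _ _ _
  have oY : ∀ i : Fin (m + k), (i : ℕ) < m → Oz S (fun q => co i (Yv γ A u q) - Yz A u i q) := by
    intro i hi
    have : ∀ j : Fin (m + k), Oz S (fun q => if (j : ℕ) < m then 0 else
        (dd γ j q * Dc u q j) * A q i j) := by
      intro j
      by_cases hj : (j : ℕ) < m
      · simpa only [if_pos hj] using Oz.zero
      · simp only [if_neg hj]
        exact ((bd j).mul (bD j)).mul_Oz ⟨|C|, abs_nonneg _, fun p hp =>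
          (hG.hb p (h0 p hp) (hT1 p (hST hp)).2 i j hi hj).trans
          (mul_le_mul_of_nonneg_right (le_abs_self _) (norm_nonneg _))⟩
    refine (Oz.sum (t := Finset.univ) this).congr fun p _ => ?_
    rw [co_Yv, Yz, ← Finset.sum_sub_distrib]
    refine Finset.sum_congr rfl fun j _ => ?_
    have hdi : dd γ i p = 1 := by simp [dd, hi]
    by_cases hj : (j : ℕ) < m
    · have hdj : dd γ j p = 1 := by simp [dd, hj]
      simp [hj, cA, hdi, hdj]
    · simp only [if_neg hj, cA, hdi]; ring
  have oF : ∀ i : Fin (m + k), (i : ℕ) < m → Oz S (fun q => co i (Ff γ A q)) := fun i hi =>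
    ⟨|C|, abs_nonneg _, fun p hp => (hG.hco1 p (h0 p hp) (hT1 p (hST hp)).2 i hi).trans
      (mul_le_mul_of_nonneg_right (le_abs_self _) (norm_nonneg _))⟩
  have key : ∀ i : Fin (m + k), Oz S (fun q => if (i : ℕ) < m then
      co i (WT γ A C α (ze r R) (zep r R) V u q - W0f γ A C α r R u q) else 0) := by
    intro i
    by_cases hi : (i : ℕ) < m
    · simp only [if_pos hi]
      refine (((oa.mul_Bd (bY i)).add (ba0.mul_Oz (oY i hi))).add (bb.mul_Oz (oF i hi))).congr
        fun p hp => ?_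
      rw [WT_split hγ hlam hE (h0 p hp) ((u1 p (hST hp)).differentiableAt (by norm_num)), map_sub,
        map_add, map_smul, map_smul, W0f, co_sum_smul]
      simp only [if_pos hi, smul_eq_mul]
      ring
    · simpa only [if_neg hi] using Oz.zero
  have key2 : Oz S (fun q => ∑ i : Fin (m + k), |if (i : ℕ) < m then
      co i (WT γ A C α (ze r R) (zep r R) V u q - W0f γ A C α r R u q) else 0|) :=
    Oz.sum (t := Finset.univ) fun i => by
      obtain ⟨M, hM, h⟩ := key i
      exact ⟨M, hM, fun p hp => by rw [abs_abs]; exact h p hp⟩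
  obtain ⟨M, hM, h⟩ := key2
  refine ⟨M, fun p hp => ?_⟩
  rcases Out_or (γ := γ) (r := r) (R := R) p with ho | ha
  · rw [WT_Out hγ hr hR ho, W0f_Out hr hR ho]; simp; positivity
  · have hpS : p ∈ S := by rw [hS]; exact ⟨hp, hT ▸ ha⟩
    refine le_trans ?_ ((le_abs_self _).trans (h p hpS))
    obtain ⟨w, hw⟩ : ∃ w, w = WT γ A C α (ze r R) (zep r R) V u p - W0f γ A C α r R u p := ⟨_, rfl⟩
    simp only [← hw]
    have h2 := sum_co_lt (m := m) (k := k) w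
    refine abs_le_of_sq_le_sq' ?_ (Finset.sum_nonneg fun _ _ => abs_nonneg _) |>.2
    rw [← h2]
    have h3 := Finset.sum_sq_le_sq_sum_of_nonneg (s := Finset.univ)
      (f := fun i : Fin (m + k) => |if (i : ℕ) < m then co i w else 0|) (fun i _ => abs_nonneg _)
    simpa only [sq_abs] using h3
end
end BG
end

section
open scoped Topology
namespace BG
variable {m k : ℕ}
variable {γ lam Λ : ℝ}

section
variable {A : E m k → Matrix (Fin (m + k)) (Fin (m + k)) ℝ} {C α r R : ℝ} {V u : E m k → ℝ}

lemma continuousAt_psi (hγ : 0 < γ) {p : E m k} (hp : 0 < rho γ p) : ContinuousAt (psi γ) p := by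
  unfold psi
  refine ContinuousAt.div ?_ ?_ (rpow_pos_of_pos hp _).ne'
  · exact (continuous_fst.norm.rpow_const fun _ => Or.inr (by positivity)).continuousAt
  · exact ((continuous_rho hγ).rpow_const fun _ => Or.inr (by positivity)).continuousAt

lemma continuousAt_gde (hγ : 0 < γ) {p : E m k} (hp : 0 < rho γ p) (hu : ContinuousAt u p) :
    ContinuousAt (gde γ C α u) p := by
  have hr : ContinuousAt (rho γ) p := (continuous_rho hγ).continuousAt
  have h1 : ContinuousAt (fun q => om (QQ m k γ) (rho γ q)) p :=
    ContinuousAt.comp (g := om (QQ m k γ)) (cd_om hp).continuousAt hr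
  have h2 : ContinuousAt (fun q => wt C α (rho γ q)) p :=
    ContinuousAt.comp (g := wt C α) (hd_wt hp).continuousAt hr
  exact (((h1.mul (h2.pow 2)).mul (continuousAt_psi hγ hp)).mul (hu.pow 2)).div (hr.pow 2)
    (pow_ne_zero _ hp.ne')

lemma gde_nonneg (p : E m k) : 0 ≤ gde γ C α u p := by
  unfold gde om
  have h1 := rho_nonneg γ p
  have h2 := psi_nonneg (γ := γ) p
  positivity

lemma integrable_Jf (hγ : 0 < γ) {C0 : ℝ} (hr : 0 < r) (hrR : r ≤ R) (hR1 : R ≤ 1)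
    (hu : ∀ p, rho γ p < 1 → ContDiffAt ℝ 2 u p) : Integrable (Jf (m := m) (k := k) γ lam C α C0 r R u) := by
  have key : ∀ T : Set ℝ, IsClosed T → T ⊆ Icc (r / 4) (3 * R / 4) → ∀ f : E m k → ℝ,
      (∀ p, 0 < rho γ p → rho γ p < 1 → ContinuousAt f p) →
      Integrable ({q : E m k | rho γ q ∈ T}.indicator f) := by
    intro T hT hTI f hf
    have hcl : IsClosed {q : E m k | rho γ q ∈ T} := hT.preimage (continuous_rho hγ)
    have hc : IsCompact {q : E m k | rho γ q ∈ T} :=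
      (isCompact_Ann hγ (r / 4) (3 * R / 4)).of_isClosed_subset hcl fun p hp => hTI hp
    rw [integrable_indicator_iff hcl.measurableSet]
    refine ContinuousOn.integrableOn_compact hc fun p hp => (hf p ?_ ?_).continuousWithinAt
    · have := (hTI hp).1; linarith
    · have := (hTI hp).2; linarith
  unfold Jf
  have hg : ∀ p : E m k, 0 < rho γ p → rho γ p < 1 → ContinuousAt (gde γ C α u) p := fun p h1 h2 =>
    continuousAt_gde hγ h1 (hu p h2).continuousAt
  refine (key _ isClosed_Icc subset_rfl _ fun p h1 h2 => ?_).sub (key _ ?_ ?_ _ fun p h1 h2 => ?_)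
  · have hz : ContinuousAt (fun q : E m k => ze r R (rho γ q)) p :=
      ((contDiff_ze r R).continuous.comp (continuous_rho hγ)).continuousAt
    exact (continuousAt_const.mul ((continuous_rho hγ).continuousAt.mul (hz.pow 2))).mul (hg p h1 h2)
  · exact isClosed_Icc.union isClosed_Icc
  · rintro s (h | h)
    · exact ⟨h.1, by have := h.2; linarith⟩
    · exact ⟨by have := h.1; linarith, h.2⟩
  · exact continuousAt_const.mul (hg p h1 h2)

lemma Jf_Out {C0 : ℝ} (hr : 0 < r) (hrR : r ≤ R) {p : E m k} (hp : p ∈ Out γ r R) :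
    Jf γ lam C α C0 r R u p = 0 := by
  have h1 : p ∉ {q : E m k | rho γ q ∈ Icc (r / 4) (3 * R / 4)} := by
    rintro ⟨a, b⟩
    rcases hp with h | h <;> linarith
  have h2 : p ∉ {q : E m k | rho γ q ∈ Xset r R} := by
    rintro (⟨a, b⟩ | ⟨a, b⟩) <;> rcases hp with h | h <;> linarith
  rw [Jf, indicator_of_notMem h1, indicator_of_notMem h2, sub_zero]

lemma Div_zero_of {W : E m k → E m k} {p : E m k} (h : W =ᶠ[𝓝 p] fun _ => 0) : Div W p = 0 := by
  rw [Div_congr h]; simp [Div]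

lemma hasCompactSupport_Out {W : E m k → E m k} (hγ : 0 < γ) (h : ∀ q ∈ Out γ r R, W q = 0) :
    HasCompactSupport W := by
  refine HasCompactSupport.of_support_subset_isCompact (isCompact_Ann hγ (r / 4) (3 * R / 4)) ?_
  intro p hp
  rcases Out_or (γ := γ) (r := r) (R := R) p with ho | ha
  · exact absurd (h p ho) hp
  · exact ha

lemma carleman (hm : 1 ≤ m) (hγ : 0 < γ) (hlam : 0 < lam) (hC : C1coeff A) (hS : Symm A) (hE : Elliptic lam A)
    {K C0 : ℝ} (hG : Geo γ C A) (hC1 : 1 ≤ C) (hQ : 2 ≤ QQ m k γ) (hC0 : 1 ≤ C0)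
    (hbd : ∀ r R s : ℝ, 0 < r → 0 < R → 0 < s → |s * zep r R s| ≤ C0 ∧ |s ^ 2 * zepp r R s| ≤ C0)
    (hr : 0 < r) (hR : R * (100 * C) ≤ 1) (hrR : r ≤ R)
    (hV : ∀ p : E m k, p.1 ≠ 0 → rho γ p < 1 → ContDiffAt ℝ 1 V p)
    (hu : ∀ p, rho γ p < 1 → ContDiffAt ℝ 2 u p) (hK : 0 ≤ K)
    (hVK : ∀ p : E m k, p.1 ≠ 0 → rho γ p < 1 → |V p| + |Fd γ A V p| ≤ K * (lam * psi γ p))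
    (hsol : ∀ p : E m k, p.1 ≠ 0 → rho γ p < 1 → Lop γ A u p + V p * u p = 0)
    (a1 : 10 * (QQ m k γ + 1) ≤ α) (a2 : 10 * C ≤ α) (a3 : (86 * C) ^ 2 ≤ α)
    (a4 : 60 * C * K ≤ α ^ 2) :
    ∫ p, Jf (m := m) (k := k) γ lam C α C0 r R u p ≤ 0 := by
  have hR0 : 0 < R := hr.trans_le hrR
  have hR1 : R ≤ 1 / 100 := by nlinarith
  have hV' : ∀ p : E m k, p.1 ≠ 0 → rho γ p < 1 → |V p| ≤ K * lam := by
    intro p h1 h2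
    have a := hVK p h1 h2
    have b := abs_nonneg (Fd γ A V p)
    have c : K * (lam * psi γ p) ≤ K * (lam * 1) := by
      have := psi_le_one hγ p
      gcongr
    linarith
  obtain ⟨M, hM⟩ := diff_bound (A := A) (C := C) (α := α) (r := r) (R := R) (V := V) (u := u)
    hγ hlam hC hE hG hr hR0 (by linarith) hu (K := K * lam) (by positivity) hV'
  have hAnn : ∀ p : E m k, p ∈ Ann γ (r / 4) (3 * R / 4) → 0 < rho γ p ∧ rho γ p < 1 := by
    intro p hp
    have h1 : r / 4 ≤ rho γ p := hp.1
    have h2 : rho γ p ≤ 3 * R / 4 := hp.2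
    constructor <;> linarith
  have hnb : ∀ W : E m k → E m k, (∀ q ∈ Out γ r R, W q = 0) → ∀ p ∈ Out γ r R, W =ᶠ[𝓝 p] fun _ => 0 := by
    intro W hW p hp
    filter_upwards [(isOpen_Out hγ).mem_nhds hp] with x hx
    exact hW x hx
  refine ibp hm (W := WT γ A C α (ze r R) (zep r R) V u) (W0 := W0f γ A C α r R u) (C := M)
    ?_ ?_ ?_ ?_ hM (integrable_Jf hγ hr hrR (by linarith) hu) ?_
  · intro p hp
    rcases Out_or (γ := γ) (r := r) (R := R) p with ho | ha
    · exact contDiffAt_const.congr_of_eventuallyEq (hnb _ (fun q hq => WT_Out hγ hr hR0 hq) p ho)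
    · exact contDiffAt_WT hγ hlam hC hE hp (hV p hp (hAnn p ha).2) (hu p (hAnn p ha).2)
  · exact hasCompactSupport_Out hγ fun q hq => WT_Out hγ hr hR0 hq
  · refine contDiff_iff_contDiffAt.2 fun p => ?_
    rcases Out_or (γ := γ) (r := r) (R := R) p with ho | ha
    · exact contDiffAt_const.congr_of_eventuallyEq (hnb _ (fun q hq => W0f_Out hr hR0 hq) p ho)
    · exact contDiffAt_W0f hγ hC (hAnn p ha).1 (hu p (hAnn p ha).2)
  · exact hasCompactSupport_Out hγ fun q hq => W0f_Out hr hR0 hq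
  · intro p hp
    by_cases hpR : rho γ p ≤ R
    · have hp1 : rho γ p < 1 := by linarith
      have hρ := rho_pos hγ (ne_zero_of_fst hp)
      have hmu := (mu_bounds hγ hE hp).1
      have e : th γ A p * rho γ p ^ 2 = mu γ A p := by
        rw [th]; field_simp
      have hk := hVK p hp hp1
      have hk2 : K * (lam * psi γ p) ≤ K * mu γ A p := by gcongr
      have n1 := abs_nonneg (Fd γ A V p)
      have n2 := abs_nonneg (V p)
      refine J_le hγ hlam hC hS hE hG hC1 hQ hC0 hbd hr hR hrR hp hpR
        ((hV p hp hp1).differentiableAt (by norm_num)) (hu p hp1) hK ?_ ?_ ?_ a1 a2 a3 a4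
      · rw [e]; linarith
      · rw [e]; linarith
      · rw [← Lop_eq hC hp (hu p hp1)]; exact hsol p hp hp1
    · have ho : p ∈ Out γ r R := Or.inr (by linarith)
      rw [Jf_Out hr hrR ho, Div_zero_of (hnb _ (fun q hq => WT_Out hγ hr hR0 hq) p ho)]

lemma wt_anti {a b : ℝ} (hα : 0 ≤ α) (ha : 0 < a) (hab : a ≤ b) (hb : 10 * C * b ≤ 1) :
    wt C α b ≤ wt C α a := by
  unfold wt
  have hb0 : 0 < b := ha.trans_le hab
  have h := log_le_sub_one_of_pos (div_pos ha hb0)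
  rw [log_div ha.ne' hb0.ne'] at h
  have h2 : a / b - 1 = -((b - a) / b) := by field_simp; ring
  have h3 : 10 * C * (b - a) ≤ (b - a) / b := by
    rw [le_div_iff₀ hb0]
    nlinarith
  have h4 : α * (log a - 10 * C * a) ≤ α * (log b - 10 * C * b) := by
    apply mul_le_mul_of_nonneg_left _ hα; linarith
  exact exp_le_exp.2 (by linarith)

lemma wt_B (hα : 0 ≤ α) (hC1 : 1 ≤ C) (hr : 0 < r) (hrR : r ≤ R) :
    wt C α (r / 4) ^ 2 ≤ wt C α (R / 4) ^ 2 * (R / r) ^ (2 * α) := by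
  have hR0 : 0 < R := hr.trans_le hrR
  unfold wt
  rw [rpow_def_of_pos (div_pos hR0 hr), ← exp_nat_mul, ← exp_nat_mul, ← exp_add, exp_le_exp,
    log_div hr.ne' (by norm_num), log_div hR0.ne' (by norm_num), log_div hR0.ne' hr.ne']
  push_cast
  have : 0 ≤ α * (C * (R - r)) := mul_nonneg hα (mul_nonneg (by linarith) (by linarith))
  nlinarith

lemma wt_C (hα : 0 ≤ α) (hR0 : 0 < R) (hR : R * (100 * C) ≤ 1) :
    wt C α (R / 2) ^ 2 ≤ wt C α (R / 4) ^ 2 * exp (-α) := by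
  unfold wt
  have h4 : log (4 : ℝ) = 2 * log 2 := by
    rw [show (4 : ℝ) = 2 ^ (2 : ℕ) by norm_num, log_pow]; norm_num
  rw [← exp_nat_mul, ← exp_nat_mul, ← exp_add, exp_le_exp,
    log_div hR0.ne' (by norm_num), log_div hR0.ne' (by norm_num), h4]
  push_cast
  have h2 := log_two_gt_d9
  have : 0 ≤ α * (log 2 - 1 / 2 - 5 / 2 * (C * R)) := mul_nonneg hα (by linarith)
  linarith

lemma gde_eq {p : E m k} (hp : 0 < rho γ p) :
    gde γ C α u p = rho γ p ^ (-QQ m k γ) * wt C α (rho γ p) ^ 2 * (u p ^ 2 * psi γ p) := by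
  have : rho γ p ^ (2 - QQ m k γ) = rho γ p ^ (-QQ m k γ) * rho γ p ^ 2 := by
    rw [sub_eq_neg_add, rpow_add hp]; norm_num
  rw [gde, om, this]
  field_simp

end
end BG
end

section
open scoped Topology
namespace BG
variable {m k : ℕ}
variable {γ lam Λ : ℝ}

section
variable {C α r R : ℝ} {u : E m k → ℝ}

set_option maxHeartbeats 1000000 in
lemma pt_bound (hγ : 0 < γ) (hlam : 0 < lam) (hC1 : 1 ≤ C) (hQ : 2 ≤ QQ m k γ) {C0 M : ℝ}
    (hα : 1 ≤ α) (hr : 0 < r) (hR : R * (100 * C) ≤ 1) (hrR : r ≤ R)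
    (hu1 : ∀ p : E m k, rho γ p < 1 → |u p| ≤ 1) (hM : ∀ p : E m k, rho γ p < r → |u p| ≤ M)
    (hM0 : 0 ≤ M) (p : E m k) :
    (ball γ (R / 4)).indicator (fun q => u q ^ 2 * psi γ q) p ≤
      (lam * α ^ 3 * (R / 4) ^ (1 - QQ m k γ) * wt C α (R / 4) ^ 2)⁻¹ * Jf γ lam C α C0 r R u p
      + (ball γ 1).indicator (fun _ => (1 + 2000 * C0 ^ 2 * lam⁻¹ ^ 2 / R) *
          (M ^ 2 * (R / r) ^ (2 * α + QQ m k γ) + exp (-α))) p := by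
  have hR0 : 0 < R := hr.trans_le hrR
  have hR1 : R ≤ 1 / 100 := by nlinarith
  obtain ⟨Q, hQe⟩ : ∃ Q, Q = QQ m k γ := ⟨_, rfl⟩
  obtain ⟨d, hd⟩ : ∃ d, d = (R / 4) ^ (1 - Q) := ⟨_, rfl⟩
  obtain ⟨w, hw⟩ : ∃ w, w = wt C α (R / 4) ^ 2 := ⟨_, rfl⟩
  obtain ⟨P, hP⟩ : ∃ P, P = M ^ 2 * (R / r) ^ (2 * α + Q) := ⟨_, rfl⟩
  obtain ⟨L, hL⟩ : ∃ L, L = 2000 * C0 ^ 2 * lam⁻¹ ^ 2 / R := ⟨_, rfl⟩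
  rw [← hQe, ← hd, ← hw, ← hP, ← hL]
  have hd0 : 0 < d := hd ▸ rpow_pos_of_pos (by positivity) _
  have hw0 : 0 < w := hw ▸ pow_pos (wt_pos _ _ _) _
  have hα0 : 0 < α := by linarith
  have hRr : 1 ≤ R / r := (one_le_div hr).2 hrR
  have hL0 : 0 ≤ L := hL ▸ by positivity
  have hpow : 1 ≤ (R / r) ^ (2 * α + Q) := one_le_rpow hRr (by rw [hQe]; linarith)
  have hMP : M ^ 2 ≤ P := by rw [hP]; nlinarith [sq_nonneg M]
  have hP0 : 0 ≤ P := (sq_nonneg M).trans hMP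
  have he0 := exp_pos (-α)
  obtain ⟨D, hD⟩ : ∃ D, D = lam * α ^ 3 * d * w := ⟨_, rfl⟩
  have hD0 : 0 < D := hD ▸ by positivity
  rw [← hD]
  have hρ0 := rho_nonneg γ p
  have hψ0 := psi_nonneg (γ := γ) p
  have hψ1 := psi_le_one hγ p
  have hg0 := gde_nonneg (γ := γ) (C := C) (α := α) (u := u) p
  have e1 : (R / 4) ^ (1 - Q) = (R / 4) * (R / 4) ^ (-Q) := by
    rw [sub_eq_add_neg, rpow_add (by positivity), rpow_one]
  -- first part
  have first : (ball γ (R / 4)).indicator (fun q => u q ^ 2 * psi γ q) p ≤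
      D⁻¹ * {q : E m k | rho γ q ∈ Icc (r / 4) (3 * R / 4)}.indicator
        (fun q => lam * α ^ 3 * (rho γ q * ze r R (rho γ q) ^ 2) * gde γ C α u q) p
      + (ball γ 1).indicator (fun _ => P) p := by
    have hT0 : 0 ≤ {q : E m k | rho γ q ∈ Icc (r / 4) (3 * R / 4)}.indicator
        (fun q => lam * α ^ 3 * (rho γ q * ze r R (rho γ q) ^ 2) * gde γ C α u q) p :=
      indicator_apply_nonneg fun _ => by positivity
    have hP1 : 0 ≤ (ball γ 1).indicator (fun _ => P) p := indicator_apply_nonneg fun _ => hP0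
    by_cases hb : rho γ p < R / 4
    · rw [indicator_of_mem (show p ∈ ball γ (R / 4) from hb)]
      by_cases hb2 : rho γ p < r / 2
      · rw [indicator_of_mem (show p ∈ ball γ 1 from (show rho γ p < 1 by linarith))]
        have h1 := hM p (by linarith)
        have h2 : u p ^ 2 ≤ M ^ 2 := sq_le_sq' (by linarith [abs_le.1 h1]) (abs_le.1 h1).2
        have h3 : u p ^ 2 * psi γ p ≤ u p ^ 2 * 1 := by gcongr
        have h4 : 0 ≤ D⁻¹ * {q : E m k | rho γ q ∈ Icc (r / 4) (3 * R / 4)}.indicator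
          (fun q => lam * α ^ 3 * (rho γ q * ze r R (rho γ q) ^ 2) * gde γ C α u q) p := by positivity
        linarith
      · push Not at hb2
        have hρ : 0 < rho γ p := by linarith
        rw [indicator_of_mem (show p ∈ {q : E m k | rho γ q ∈ Icc (r / 4) (3 * R / 4)} from
          ⟨by linarith, by linarith⟩), ze_one hr hR0 hb2 (by linarith), gde_eq hρ, ← hQe]
        have h1 : d ≤ rho γ p * rho γ p ^ (-Q) := by
          have : rho γ p * rho γ p ^ (-Q) = rho γ p ^ (1 - Q) := by
            rw [sub_eq_add_neg, rpow_add hρ, rpow_one]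
          rw [this, hd]
          exact rpow_le_rpow_of_nonpos hρ hb.le (by linarith)
        have h2 : w ≤ wt C α (rho γ p) ^ 2 := by
          rw [hw]
          exact pow_le_pow_left₀ (wt_pos _ _ _).le
            (wt_anti hα0.le hρ hb.le (by linarith)) 2
        have h3 : D * (u p ^ 2 * psi γ p) ≤ lam * α ^ 3 * (rho γ p * 1 ^ 2) *
            (rho γ p ^ (-Q) * wt C α (rho γ p) ^ 2 * (u p ^ 2 * psi γ p)) := by
          have : D ≤ lam * α ^ 3 * ((rho γ p * rho γ p ^ (-Q)) * wt C α (rho γ p) ^ 2) := by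
            rw [hD, mul_assoc (lam * α ^ 3)]
            gcongr
          have h5 : 0 ≤ u p ^ 2 * psi γ p := by positivity
          have h6 := mul_le_mul_of_nonneg_right this h5
          linarith
        have h4 := mul_le_mul_of_nonneg_left h3 (inv_pos.2 hD0).le
        rw [inv_mul_cancel_left₀ hD0.ne'] at h4
        linarith
    · rw [indicator_of_notMem (show p ∉ ball γ (R / 4) from hb)]
      positivity
  -- second part
  have second : {q : E m k | rho γ q ∈ Xset r R}.indicator
      (fun q => lam⁻¹ * (500 * C0 ^ 2 * α ^ 2) * gde γ C α u q) p ≤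
      D * (ball γ 1).indicator (fun _ => L * (P + exp (-α))) p := by
    have hli : 0 < lam⁻¹ := inv_pos.2 hlam
    have hLD : L * D = lam⁻¹ * (500 * C0 ^ 2 * α ^ 2) * (α * ((4 / R) * d * w)) := by
      rw [hL, hD]; field_simp; ring
    have hdR : (4 / R) * d = (R / 4) ^ (-Q) := by
      rw [hd, e1]; field_simp
    by_cases hX : rho γ p ∈ Xset r R
    · rw [indicator_of_mem (show p ∈ {q : E m k | rho γ q ∈ Xset r R} from hX)]
      have hρ : 0 < rho γ p := by
        rcases hX with ⟨a, b⟩ | ⟨a, b⟩ <;> linarith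
      have hρ1 : rho γ p < 1 := by
        rcases hX with ⟨a, b⟩ | ⟨a, b⟩ <;> linarith
      have hρC : 10 * C * rho γ p ≤ 1 := by
        have : rho γ p ≤ R := by rcases hX with ⟨a, b⟩ | ⟨a, b⟩ <;> linarith
        nlinarith
      rw [indicator_of_mem (show p ∈ ball γ 1 from hρ1), gde_eq hρ, ← hQe]
      have claim : rho γ p ^ (-Q) * wt C α (rho γ p) ^ 2 * (u p ^ 2 * psi γ p) ≤
          (R / 4) ^ (-Q) * w * (P + exp (-α)) := by
        have hq0 : 0 < (R / 4) ^ (-Q) := rpow_pos_of_pos (by positivity) _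
        rcases hX with ⟨a, b⟩ | ⟨a, b⟩
        · have h1 := hM p (by linarith)
          have h2 : u p ^ 2 ≤ M ^ 2 := sq_le_sq' (by linarith [abs_le.1 h1]) (abs_le.1 h1).2
          have h3 : u p ^ 2 * psi γ p ≤ M ^ 2 := by nlinarith [sq_nonneg (u p)]
          have h4 : rho γ p ^ (-Q) ≤ (R / 4) ^ (-Q) * (R / r) ^ Q := by
            have e : (R / 4) ^ (-Q) * (R / r) ^ Q = (r / 4) ^ (-Q) := by
              rw [rpow_neg (by positivity), rpow_neg (by positivity), ← div_eq_inv_mul,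
                ← div_rpow (by positivity) (by positivity), ← inv_rpow (by positivity)]
              congr 1; field_simp
            rw [e]
            exact rpow_le_rpow_of_nonpos (by positivity) a (by linarith)
          have h5 : wt C α (rho γ p) ^ 2 ≤ w * (R / r) ^ (2 * α) := by
            rw [hw]
            exact (pow_le_pow_left₀ (wt_pos _ _ _).le
              (wt_anti hα0.le (by positivity) a hρC) 2).trans (wt_B hα0.le hC1 hr hrR)
          have h6 : rho γ p ^ (-Q) * wt C α (rho γ p) ^ 2 * (u p ^ 2 * psi γ p) ≤
              ((R / 4) ^ (-Q) * (R / r) ^ Q) * (w * (R / r) ^ (2 * α)) * M ^ 2 := by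
            gcongr
          refine h6.trans ?_
          have h7 : ((R / 4) ^ (-Q) * (R / r) ^ Q) * (w * (R / r) ^ (2 * α)) * M ^ 2
              = (R / 4) ^ (-Q) * w * P := by
            rw [hP, rpow_add (by positivity)]; ring
          rw [h7]
          gcongr
          linarith
        · have h1 := hu1 p hρ1
          have h2 : u p ^ 2 ≤ 1 := by rw [sq_le_one_iff_abs_le_one]; exact h1
          have h3 : u p ^ 2 * psi γ p ≤ 1 := by nlinarith [sq_nonneg (u p)]
          have h4 : rho γ p ^ (-Q) ≤ (R / 4) ^ (-Q) :=
            rpow_le_rpow_of_nonpos (by positivity) (by linarith) (by linarith)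
          have h5 : wt C α (rho γ p) ^ 2 ≤ w * exp (-α) := by
            rw [hw]
            exact (pow_le_pow_left₀ (wt_pos _ _ _).le
              (wt_anti hα0.le (by positivity) a hρC) 2).trans (wt_C hα0.le hR0 hR)
          have h6 : rho γ p ^ (-Q) * wt C α (rho γ p) ^ 2 * (u p ^ 2 * psi γ p) ≤
              (R / 4) ^ (-Q) * (w * exp (-α)) * 1 := by
            gcongr
          refine h6.trans ?_
          have h7 : (R / 4) ^ (-Q) * (w * exp (-α)) * 1 = (R / 4) ^ (-Q) * w * exp (-α) := by ring
          rw [h7]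
          gcongr
          linarith
      have h8 : D * (L * (P + exp (-α))) = lam⁻¹ * (500 * C0 ^ 2 * α ^ 2) *
          (α * ((R / 4) ^ (-Q) * w * (P + exp (-α)))) := by
        rw [← hdR]
        calc D * (L * (P + exp (-α))) = (L * D) * (P + exp (-α)) := by ring
          _ = _ := by rw [hLD]; ring
      rw [h8]
      have hq0 : 0 < (R / 4) ^ (-Q) := rpow_pos_of_pos (by positivity) _
      have h9 : 0 ≤ (R / 4) ^ (-Q) * w * (P + exp (-α)) := by positivity
      have h10 : (R / 4) ^ (-Q) * w * (P + exp (-α)) ≤ α * ((R / 4) ^ (-Q) * w * (P + exp (-α))) :=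
        le_mul_of_one_le_left h9 hα
      exact mul_le_mul_of_nonneg_left (claim.trans h10) (by positivity)
    · rw [indicator_of_notMem (show p ∉ {q : E m k | rho γ q ∈ Xset r R} from hX)]
      exact mul_nonneg hD0.le (indicator_apply_nonneg fun _ => by positivity)
  have second' := mul_le_mul_of_nonneg_left second (inv_pos.2 hD0).le
  rw [inv_mul_cancel_left₀ hD0.ne'] at second'
  have third : (ball γ 1).indicator (fun _ => P) p + (ball γ 1).indicator (fun _ => L * (P + exp (-α))) p
      ≤ (ball γ 1).indicator (fun _ => (1 + L) * (P + exp (-α))) p := by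
    by_cases hb : p ∈ ball (m := m) (k := k) γ 1
    · simp only [indicator_of_mem hb]; linarith
    · simp only [indicator_of_notMem hb]; linarith
  rw [Jf, mul_sub]
  linarith

lemma vol_ball (hγ : 0 < γ) : volume (ball (m := m) (k := k) γ 1) < ⊤ :=
  (measure_mono (t := {p : E m k | rho γ p ≤ 1}) (fun p (hp : rho γ p < 1) => show rho γ p ≤ 1 from hp.le)).trans_lt
    (isCompact_le (m := m) (k := k) hγ 1).measure_lt_top

lemma int_bound (hγ : 0 < γ) (hlam : 0 < lam) (hC1 : 1 ≤ C) (hQ : 2 ≤ QQ m k γ) {C0 M : ℝ}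
    (hα : 1 ≤ α) (hr : 0 < r) (hR : R * (100 * C) ≤ 1) (hrR : r ≤ R)
    (hu : ∀ p : E m k, rho γ p < 1 → ContDiffAt ℝ 2 u p)
    (hu1 : ∀ p : E m k, rho γ p < 1 → |u p| ≤ 1) (hM : ∀ p : E m k, rho γ p < r → |u p| ≤ M)
    (hM0 : 0 ≤ M) (hJ : ∫ p, Jf (m := m) (k := k) γ lam C α C0 r R u p ≤ 0) :
    ∫ p in ball γ (R / 4), u p ^ 2 * psi γ p ≤
      volume.real (ball (m := m) (k := k) γ 1) * ((1 + 2000 * C0 ^ 2 * lam⁻¹ ^ 2 / R) *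
          (M ^ 2 * (R / r) ^ (2 * α + QQ m k γ) + exp (-α))) := by
  have hR0 : 0 < R := hr.trans_le hrR
  have hR1 : R ≤ 1 / 100 := by nlinarith
  have hJi := integrable_Jf (lam := lam) (C := C) (α := α) (C0 := C0) hγ hr hrR (by linarith) hu
  have hb := (isOpen_ball (m := m) (k := k) hγ 1).measurableSet
  rw [← integral_indicator (isOpen_ball hγ _).measurableSet]
  have hi : Integrable ((ball (m := m) (k := k) γ 1).indicator
      (fun _ => (1 + 2000 * C0 ^ 2 * lam⁻¹ ^ 2 / R) *
          (M ^ 2 * (R / r) ^ (2 * α + QQ m k γ) + exp (-α)))) := by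
    rw [integrable_indicator_iff hb]
    exact integrableOn_const (vol_ball hγ).ne
  have hpt := fun p => pt_bound (C0 := C0) hγ hlam hC1 hQ hα hr hR hrR hu1 hM hM0 p
  have hnn : ∀ p : E m k, 0 ≤ (ball γ (R / 4)).indicator (fun q => u q ^ 2 * psi γ q) p := fun p =>
    indicator_apply_nonneg fun _ => mul_nonneg (sq_nonneg _) (psi_nonneg _)
  refine (integral_mono_of_nonneg (ae_of_all _ hnn) ((hJi.const_mul _).add hi)
    (ae_of_all _ hpt)).trans ?_
  simp only [Pi.add_apply]
  rw [integral_add (hJi.const_mul _) hi, integral_const_mul, integral_indicator hb, setIntegral_const,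
    smul_eq_mul]
  have hD0 : 0 ≤ (lam * α ^ 3 * (R / 4) ^ (1 - QQ m k γ) * wt C α (R / 4) ^ 2)⁻¹ := by
    have := rpow_nonneg (show 0 ≤ R / 4 by positivity) (1 - QQ m k γ)
    have hα0 : 0 ≤ α := by linarith
    positivity
  have := mul_nonpos_of_nonneg_of_nonpos hD0 hJ
  linarith

end

section
variable {u : E m k → ℝ}

lemma final_num {s c1 M x α Q : ℝ} (hs : 0 < s) (hc1 : 0 < c1) (hM0 : 0 ≤ M) (hx : 0 < x)
    (h : s ≤ c1 * (M ^ 2 * (x⁻¹) ^ (2 * α + Q) + exp (-α))) (hα : |log (2 * c1 / s)| ≤ α) :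
    √(s / (2 * c1)) * x ^ (α + Q / 2) ≤ M := by
  have h1 : c1 * exp (-α) ≤ s / 2 := by
    have h2 : log (2 * c1 / s) ≤ α := (le_abs_self _).trans hα
    have h3 : 2 * c1 / s ≤ exp α := by
      rw [← exp_log (show 0 < 2 * c1 / s by positivity)]; exact exp_le_exp.2 h2
    rw [exp_neg, mul_inv_le_iff₀ (exp_pos _)]
    rw [div_le_iff₀ hs] at h3
    linarith
  have hxp : 0 < x ^ (2 * α + Q) := rpow_pos_of_pos hx _
  have h2 : s / 2 ≤ c1 * (M ^ 2 * (x ^ (2 * α + Q))⁻¹) := by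
    rw [← inv_rpow hx.le]; linarith
  have h3 : s / (2 * c1) * x ^ (2 * α + Q) ≤ M ^ 2 := by
    have := mul_le_mul_of_nonneg_right h2 hxp.le
    rw [show c1 * (M ^ 2 * (x ^ (2 * α + Q))⁻¹) * x ^ (2 * α + Q) = c1 * M ^ 2 by field_simp] at this
    rw [show s / (2 * c1) * x ^ (2 * α + Q) = (s / 2 * x ^ (2 * α + Q)) / c1 by field_simp,
      div_le_iff₀ hc1]
    linarith
  refine abs_le_of_sq_le_sq' ?_ hM0 |>.2
  rw [mul_pow, sq_sqrt (by positivity), ← rpow_natCast (x ^ (α + Q / 2)), ← rpow_mul hx.le]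
  refine le_trans (le_of_eq ?_) h3
  congr 2; push_cast; ring

lemma le_sup (r : ℝ) (hr : 0 < r) (hγ : 0 < γ) (hu1 : ∀ p : E m k, rho γ p < r → |u p| ≤ 1) :
    0 ≤ (⨆ p ∈ ball γ r, |u p|) ∧ ∀ p : E m k, rho γ p < r → |u p| ≤ ⨆ p ∈ ball γ r, |u p| := by
  refine ⟨Real.iSup_nonneg fun p => Real.iSup_nonneg fun _ => abs_nonneg _, fun p hp => ?_⟩
  have hb : BddAbove (range fun p : E m k => ⨆ _ : p ∈ ball γ r, |u p|) := by
    refine ⟨1, ?_⟩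
    rintro _ ⟨q, rfl⟩
    exact Real.iSup_le (fun h => hu1 q h) zero_le_one
  refine le_trans ?_ (le_ciSup hb p)
  have : p ∈ ball γ r := hp
  simp [this]
end

set_option maxHeartbeats 2000000 in
lemma main_thm (m k : ℕ) (hm : 1 ≤ m) (hk : 1 ≤ k) (γ : ℝ) (hγ : 0 < γ)
    (lam Λ : ℝ) (hlam : 0 < lam) (hΛ : 0 < Λ) :
    ∃ R₀ : ℝ, 0 < R₀ ∧
      ∃ C₁ C₂ : ℝ → ℝ, (∀ s : ℝ, 0 < s → 0 < C₁ s ∧ 0 < C₂ s) ∧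
        ∀ A : E m k → Matrix (Fin (m + k)) (Fin (m + k)) ℝ,
          C1coeff A → Symm A → Elliptic lam A → A 0 = 1 → HypH γ Λ A →
          ∀ K : ℝ, 0 ≤ K → ∀ V : E m k → ℝ,
            ContDiffOn ℝ 1 V (ball γ 1 ∩ {p : E m k | p.1 ≠ 0}) →
            (∀ p ∈ ball γ 1 ∩ {p : E m k | p.1 ≠ 0},
              |V p| + |Fop γ A V p| ≤ K * psi γ p) →
            ∀ u : E m k → ℝ,
              ContDiffOn ℝ 2 u (ball γ 1) →
              (∀ p ∈ ball γ 1, |u p| ≤ 1) →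
              (∀ p ∈ ball γ 1, Lop γ A u p + V p * u p = 0) →
              0 < (∫ p in ball γ (R₀ / 4), u p ^ 2 * psi γ p) →
              ∀ r : ℝ, 0 < r → r ≤ R₀ →
                C₁ (∫ p in ball γ (R₀ / 4), u p ^ 2 * psi γ p) *
                    (r / R₀) ^ (C₂ (∫ p in ball γ (R₀ / 4), u p ^ 2 * psi γ p)
                      * (K ^ ((1 : ℝ) / 2) + 1))
                  ≤ ⨆ p ∈ ball γ r, |u p| := by
  obtain ⟨C, hC1, hGeo⟩ := geo_exists (m := m) (k := k) hγ hlam hΛ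
  obtain ⟨C0, hC0, hbd⟩ := ze_bounds
  have hQ : 2 ≤ QQ m k γ := by
    have h1 : (1 : ℝ) ≤ m := by exact_mod_cast hm
    have h2 : (1 : ℝ) ≤ k := by exact_mod_cast hk
    unfold QQ; nlinarith
  obtain ⟨Q, hQe⟩ : ∃ Q, Q = QQ m k γ := ⟨_, rfl⟩
  obtain ⟨R, hRe⟩ : ∃ R, R = 1 / (100 * C) := ⟨_, rfl⟩
  have hC0' : 0 < C := by linarith
  have hR0 : 0 < R := hRe ▸ by positivity
  have hR : R * (100 * C) ≤ 1 := by rw [hRe]; field_simp; exact le_rfl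
  have hR1 : R ≤ 1 / 100 := by nlinarith
  obtain ⟨c1, hc1e⟩ : ∃ c1, c1 = (volume.real (ball (m := m) (k := k) γ 1) + 1) *
    (1 + 2000 * C0 ^ 2 * lam⁻¹ ^ 2 / R) := ⟨_, rfl⟩
  have hv0 : 0 ≤ volume.real (ball (m := m) (k := k) γ 1) := measureReal_nonneg
  have hc1 : 0 < c1 := hc1e ▸ by positivity
  obtain ⟨a0, ha0⟩ : ∃ a0, a0 = 10 * (Q + 1) + 10 * C + (86 * C) ^ 2 + 60 * C / lam := ⟨_, rfl⟩
  have h60 : 0 < 60 * C / lam := by positivity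
  have h86 : 0 < (86 * C) ^ 2 := by positivity
  have ha1 : 1 ≤ a0 := by rw [ha0]; linarith
  refine ⟨R, hR0, fun s => √(s / (2 * c1)), fun s => a0 + |log (2 * c1 / s)| + Q, ?_, ?_⟩
  · intro s hs
    exact ⟨sqrt_pos.2 (by positivity), by have := abs_nonneg (log (2 * c1 / s)); linarith⟩
  intro A hC hS hE _ hH K hK V hV hVK u hu hu1 hsol hs r hr hrR
  have hG := hGeo A hC hS hE hH
  have hsq : 0 ≤ K ^ ((1 : ℝ) / 2) := rpow_nonneg hK _
  have hsq2 : K ^ ((1 : ℝ) / 2) ^ 1 * K ^ ((1 : ℝ) / 2) = K := by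
    rw [pow_one, ← rpow_add' hK (by norm_num)]; norm_num
  rw [pow_one] at hsq2
  obtain ⟨t, ht⟩ : ∃ t, t = K ^ ((1 : ℝ) / 2) := ⟨_, rfl⟩
  rw [← ht] at hsq hsq2 ⊢
  obtain ⟨s, hse⟩ : ∃ s, s = ∫ p in ball γ (R / 4), u p ^ 2 * psi γ p := ⟨_, rfl⟩
  rw [← hse] at hs
  simp only [← hse]
  obtain ⟨l, hl⟩ : ∃ l, l = |log (2 * c1 / s)| := ⟨_, rfl⟩
  have hl0 : 0 ≤ l := hl ▸ abs_nonneg _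
  obtain ⟨α, hα⟩ : ∃ α, α = a0 * (t + 1) + l := ⟨_, rfl⟩
  have haα : a0 ≤ α := by
    have : 0 ≤ a0 * t := by positivity
    rw [hα]; linarith
  have hα1 : 1 ≤ α := ha1.trans haα
  have a4 : 60 * C * (K / lam) ≤ α ^ 2 := by
    have h1 : 60 * C * (K / lam) = (60 * C / lam) * (t * t) := by rw [hsq2]; ring
    have h2 : 60 * C / lam ≤ a0 ^ 2 := by
      have : 60 * C / lam ≤ a0 := by rw [ha0]; linarith
      nlinarith
    have h3 : a0 * t ≤ α := by rw [hα]; nlinarith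
    have h4 : 0 ≤ a0 * t := by positivity
    rw [h1]
    calc (60 * C / lam) * (t * t) ≤ a0 ^ 2 * (t * t) := by gcongr
      _ = (a0 * t) ^ 2 := by ring
      _ ≤ α ^ 2 := by gcongr
  have hop : IsOpen (ball (m := m) (k := k) γ 1) := isOpen_ball hγ 1
  have hop2 : IsOpen (ball γ 1 ∩ {p : E m k | p.1 ≠ 0}) := hop.inter isOpen_fst_ne
  have hu' : ∀ p : E m k, rho γ p < 1 → ContDiffAt ℝ 2 u p := fun p hp =>
    hu.contDiffAt (hop.mem_nhds hp)
  have hJ := carleman (r := r) (R := R) (α := α) (C0 := C0) (K := K / lam) (V := V) (u := u) hm hγ hlam hC hS hE hG hC1 hQ hC0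
    hbd hr hR hrR (fun p h1 h2 => hV.contDiffAt (hop2.mem_nhds ⟨h2, h1⟩)) hu' (by positivity)
    (fun p h1 h2 => by
      have := hVK p ⟨h2, h1⟩
      rw [Fop_eq hS] at this
      rw [← mul_assoc, div_mul_cancel₀ _ hlam.ne']
      exact this)
    (fun p h1 h2 => hsol p h2) (by rw [← hQe]; linarith) (by linarith) (by linarith) a4
  obtain ⟨M, hMe⟩ : ∃ M, M = ⨆ p ∈ ball (m := m) (k := k) γ r, |u p| := ⟨_, rfl⟩
  obtain ⟨hM0, hM⟩ := le_sup (m := m) (k := k) (γ := γ) (u := u) r hr hγ fun p hp =>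
    hu1 p (show rho γ p < 1 by linarith)
  rw [← hMe] at hM0 ⊢
  simp only [← hMe] at hM
  have hb := int_bound (M := M) hγ hlam hC1 hQ hα1 hr hR hrR hu' (fun p hp => hu1 p hp) hM hM0 hJ
  rw [← hse, ← hQe] at hb
  have hx : 0 < r / R := by positivity
  have hx1 : r / R ≤ 1 := (div_le_one hR0).2 hrR
  have hb2 : s ≤ c1 * (M ^ 2 * ((r / R)⁻¹) ^ (2 * α + Q) + exp (-α)) := by
    rw [inv_div]
    refine hb.trans ?_
    have : 0 ≤ (R / r) ^ (2 * α + Q) := rpow_nonneg (by positivity) _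
    have he := exp_pos (-α)
    have hle : volume.real (ball (m := m) (k := k) γ 1) ≤ volume.real (ball (m := m) (k := k) γ 1) + 1 := by
      linarith
    refine (mul_le_mul_of_nonneg_right hle (by positivity)).trans (le_of_eq ?_)
    rw [hc1e, ← mul_assoc]
  refine le_trans ?_ (final_num hs hc1 hM0 hx hb2 (by rw [← hl, hα]; nlinarith))
  refine mul_le_mul_of_nonneg_left (rpow_le_rpow_of_exponent_ge hx hx1 ?_) (sqrt_nonneg _)
  rw [← hl, hα]
  have h1 : 0 ≤ l * t := by positivity
  have h2 : 0 ≤ Q * t := by rw [← hQe] at hQ; positivity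
  rw [← hQe] at hQ
  nlinarith
end BG
end

open BG in
/-- Donnelly–Fefferman type quantitative uniqueness
(Theorem `DF1` of the paper). -/
theorem donnelly_fefferman_quantitative_uniqueness
    (m k : ℕ) (hm : 1 ≤ m) (hk : 1 ≤ k) (γ : ℝ) (hγ : 0 < γ)
    (lam Λ : ℝ) (hlam : 0 < lam) (hΛ : 0 < Λ) :
    ∃ R₀ : ℝ, 0 < R₀ ∧
      ∃ C₁ C₂ : ℝ → ℝ, (∀ s : ℝ, 0 < s → 0 < C₁ s ∧ 0 < C₂ s) ∧
        ∀ A : E m k → Matrix (Fin (m + k)) (Fin (m + k)) ℝ,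
          C1coeff A → Symm A → Elliptic lam A → A 0 = 1 → HypH γ Λ A →
          ∀ K : ℝ, 0 ≤ K → ∀ V : E m k → ℝ,
            ContDiffOn ℝ 1 V (ball γ 1 ∩ {p : E m k | p.1 ≠ 0}) →
            (∀ p ∈ ball γ 1 ∩ {p : E m k | p.1 ≠ 0},
              |V p| + |Fop γ A V p| ≤ K * psi γ p) →
            ∀ u : E m k → ℝ,
              ContDiffOn ℝ 2 u (ball γ 1) →
              (∀ p ∈ ball γ 1, |u p| ≤ 1) →
              (∀ p ∈ ball γ 1, Lop γ A u p + V p * u p = 0) →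
              0 < (∫ p in ball γ (R₀ / 4), u p ^ 2 * psi γ p) →
              ∀ r : ℝ, 0 < r → r ≤ R₀ →
                C₁ (∫ p in ball γ (R₀ / 4), u p ^ 2 * psi γ p) *
                    (r / R₀) ^ (C₂ (∫ p in ball γ (R₀ / 4), u p ^ 2 * psi γ p)
                      * (K ^ ((1 : ℝ) / 2) + 1))
                  ≤ ⨆ p ∈ ball γ r, |u p| := by
  exact BG.main_thm m k hm hk γ hγ lam Λ hlam hΛ
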